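/- arXiv:0909.5674 — 2 statements merged into one kernel-verified Lean document; each statement's English description precedes it below -/
import Mathlib

section
/- Near-CMC uniqueness (Proposition 3.17): Suppose |t − γ| > 2 and μ = 0. Then there is at most one d > 0 for which some solution ψ of the model Lichnerowicz equation L_d satisfies ψ(0) = 1; that is, if ψ₁ is a solution of L_{d₁} with ψ₁(0) = 1 and ψ₂ is a solution of L_{d₂} with ψ₂(0) = 1, then d₁ = d₂. -/
open Real Filter

/-- The 2π-periodic function equal to −1 on (−π,0) and 1 on (0,π). -/
noncomputable def lam (x : ℝ) : ℝ := if 0 < Real.sin x then 1 else -1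

/-- The critical exponent q = 2n/(n−2). -/
noncomputable def qex (n : ℕ) : ℝ := 2 * n / ((n : ℝ) - 2)

/-- The coupling constant κ = (n−1)/n. -/
noncomputable def kap (n : ℕ) : ℝ := ((n : ℝ) - 1) / n

/-- A solution of the model Lichnerowicz equation `L_d` with parameters t, γ, η, μ:
a 2π-periodic, positive, C¹ function, twice differentiable off the multiples of π,
satisfying the equation there. -/
def IsModelSolution (n : ℕ) (t γ η μ d : ℝ) (ψ : ℝ → ℝ) : Prop :=
  (∀ x, ψ (x + 2 * Real.pi) = ψ x) ∧
  (∀ x, 0 < ψ x) ∧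
  ContDiff ℝ 1 ψ ∧
  ∀ x : ℝ, (∀ k : ℤ, x ≠ (k : ℝ) * Real.pi) →
    DifferentiableAt ℝ (deriv ψ) x ∧
    -2 * kap n * qex n * d ^ (-(qex n - 2)) * deriv (deriv ψ) x
      - 2 * η ^ 2 * d ^ (-(2 * qex n)) * ψ x ^ (-qex n - 1)
      - kap n * (μ * d ^ (-qex n) + γ + lam x) ^ 2 * ψ x ^ (-qex n - 1)
      + kap n * (t + lam x) ^ 2 * ψ x ^ (qex n - 1) = 0

/-- The integrand of the travel time, after substituting `w² = 1 - U / X`. -/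
noncomputable def travelIntegrand (κ h w : ℝ) : ℝ :=
  (1 - w ^ 2) ^ (κ - 1 / 2) * (1 - h * (1 - w ^ 2)) ^ (-(1 / 2) : ℝ)

/-- The rescaled time needed to travel from `U = 1` to the turning point `U = X`. -/
noncomputable def travelTime (κ X h : ℝ) : ℝ :=
  2 * X ^ (κ + 1 / 2) * ∫ w in (0 : ℝ)..√(1 - 1 / X), travelIntegrand κ h w

lemma one_sub_mul_pos {h s : ℝ} (hh : h < 1) (h0 : 0 < s) (h1 : s ≤ 1) : 0 < 1 - h * s := by
  rcases le_or_gt h 0 with hn | hp <;> nlinarith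

lemma sq_lt_one_of_abs_lt {w : ℝ} (hw : |w| < 1) : 0 < 1 - w ^ 2 := by
  have := (sq_lt_one_iff_abs_lt_one w).2 hw
  linarith

lemma travelIntegrand_pos {κ h w : ℝ} (hh : h < 1) (hw : |w| < 1) :
    0 < travelIntegrand κ h w := by
  have h1 := sq_lt_one_of_abs_lt hw
  have h2 := one_sub_mul_pos hh h1 (by nlinarith [sq_nonneg w])
  unfold travelIntegrand
  positivity

lemma continuousAt_travelIntegrand {κ h w : ℝ} (hh : h < 1) (hw : |w| < 1) :
    ContinuousAt (travelIntegrand κ h) w := by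
  have h1 := sq_lt_one_of_abs_lt hw
  have h2 := one_sub_mul_pos hh h1 (by nlinarith [sq_nonneg w])
  unfold travelIntegrand
  refine ContinuousAt.mul ?_ ?_
  · exact ContinuousAt.rpow_const (by fun_prop) (Or.inl h1.ne')
  · exact ContinuousAt.rpow_const (by fun_prop) (Or.inl h2.ne')

lemma abs_le_of_mem_uIcc_zero {m w : ℝ} (hw : w ∈ Set.uIcc 0 m) : |w| ≤ |m| := by
  have := Set.abs_sub_left_of_mem_uIcc hw
  simpa using this

lemma intervalIntegrable_travelIntegrand {κ h m : ℝ} (hh : h < 1) (hm : |m| < 1) :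
    IntervalIntegrable (travelIntegrand κ h) MeasureTheory.volume 0 m := by
  apply ContinuousOn.intervalIntegrable
  intro w hw
  exact (continuousAt_travelIntegrand hh
    ((abs_le_of_mem_uIcc_zero hw).trans_lt hm)).continuousWithinAt

lemma hasDerivAt_integral_travelIntegrand {κ h m : ℝ} (hh : h < 1) (hm : |m| < 1) :
    HasDerivAt (fun u => ∫ w in (0 : ℝ)..u, travelIntegrand κ h w) (travelIntegrand κ h m) m := by
  apply intervalIntegral.integral_hasDerivAt_right (intervalIntegrable_travelIntegrand hh hm)
  · refine ContinuousAt.stronglyMeasurableAtFilter (s := {w | |w| < 1})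
      (isOpen_lt (by fun_prop) (by fun_prop)) ?_ m hm
    intro w hw
    exact continuousAt_travelIntegrand hh hw
  · exact continuousAt_travelIntegrand hh hm

lemma continuousAt_integral_travelIntegrand {κ h m : ℝ} (hh : h < 1) (hm : |m| < 1) :
    ContinuousAt (fun p : ℝ × ℝ => ∫ w in (0 : ℝ)..p.2, travelIntegrand κ p.1 w) (h, m) := by
  obtain ⟨m', hm1, hm2⟩ := exists_between hm
  obtain ⟨h', hh1, hh2⟩ := exists_between hh
  have hm0 : 0 ≤ m' := (abs_nonneg m).trans hm1.le
  have hd1 : 0 < 1 - m' ^ 2 := by nlinarith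
  set δ := min (1 - m' ^ 2) (1 - h') with hδ
  have hδ0 : 0 < δ := lt_min hd1 (by linarith)
  let g : ℝ → ℝ → ℝ := fun h w =>
    (max (1 - w ^ 2) δ) ^ (κ - 1 / 2) * (max (1 - h * (1 - w ^ 2)) δ) ^ (-(1 / 2) : ℝ)
  have hg : Continuous g.uncurry := by
    have e : g.uncurry = fun p : ℝ × ℝ => (max (1 - p.2 ^ 2) δ) ^ (κ - 1 / 2) *
      (max (1 - p.1 * (1 - p.2 ^ 2)) δ) ^ (-(1 / 2) : ℝ) := by
      funext p; rfl
    rw [e]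
    refine Continuous.mul ?_ ?_
    · exact Continuous.rpow_const (by fun_prop)
        (fun p => Or.inl (lt_max_of_lt_right hδ0).ne')
    · exact Continuous.rpow_const (by fun_prop)
        (fun p => Or.inl (lt_max_of_lt_right hδ0).ne')
  have hc := intervalIntegral.continuous_parametric_primitive_of_continuous
    (μ := MeasureTheory.volume) (a₀ := 0) hg
  refine hc.continuousAt.congr ?_
  have hU : {p : ℝ × ℝ | p.1 < h' ∧ |p.2| < m'} ∈ nhds (h, m) :=
    (IsOpen.inter (isOpen_lt continuous_fst continuous_const)
      (isOpen_lt continuous_snd.abs continuous_const)).mem_nhds ⟨hh1, hm1⟩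
  filter_upwards [hU] with p hp
  apply intervalIntegral.integral_congr
  intro w hw
  have hw1 := (abs_le_of_mem_uIcc_zero hw).trans hp.2.le
  have hw2 : w ^ 2 ≤ m' ^ 2 := by
    rw [← sq_abs w]; exact pow_le_pow_left₀ (abs_nonneg _) hw1 2
  have b1 : δ ≤ 1 - w ^ 2 := (min_le_left _ _).trans (by linarith)
  have b2 : δ ≤ 1 - p.1 * (1 - w ^ 2) := by
    rcases le_or_gt p.1 0 with hn | hpos
    · have : 0 ≤ -p.1 * (1 - w ^ 2) := mul_nonneg (by linarith) (by linarith)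
      have : δ ≤ 1 := (min_le_left _ _).trans (by nlinarith)
      linarith
    · have : δ ≤ 1 - h' := min_le_right _ _
      have := hp.1
      nlinarith [sq_nonneg w]
  simp only [g, travelIntegrand, max_eq_left b1, max_eq_left b2]

lemma abs_sqrt_one_sub_inv_lt {X : ℝ} (hX : 0 < X) : |√(1 - 1 / X)| < 1 := by
  rw [abs_of_nonneg (sqrt_nonneg _), sqrt_lt' one_pos]
  have : 0 < 1 / X := by positivity
  linarith

lemma continuousAt_travelTime {κ X h : ℝ} (hX : 0 < X) (hh : h < 1) :
    ContinuousAt (fun p : ℝ × ℝ => travelTime κ p.1 p.2) (X, h) := by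
  unfold travelTime
  refine ContinuousAt.mul ?_ ?_
  · exact continuousAt_const.mul (ContinuousAt.rpow_const (by fun_prop) (Or.inl hX.ne'))
  · have h1 : ContinuousAt (fun p : ℝ × ℝ => ((p.2, √(1 - 1 / p.1)) : ℝ × ℝ)) (X, h) := by
      refine ContinuousAt.prodMk (by fun_prop) ?_
      refine ContinuousAt.sqrt ?_
      exact continuousAt_const.sub (continuousAt_const.div (by fun_prop) hX.ne')
    exact ContinuousAt.comp (f := fun p : ℝ × ℝ => ((p.2, √(1 - 1 / p.1)) : ℝ × ℝ))
      (x := (X, h)) (continuousAt_integral_travelIntegrand hh (abs_sqrt_one_sub_inv_lt hX)) h1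

lemma travelIntegrand_le {κ h₁ h₂ w : ℝ} (h : h₁ ≤ h₂) (hh : h₂ < 1) (hw : |w| < 1) :
    travelIntegrand κ h₁ w ≤ travelIntegrand κ h₂ w := by
  have h1 := sq_lt_one_of_abs_lt hw
  have h2 := one_sub_mul_pos hh h1 (by nlinarith [sq_nonneg w])
  unfold travelIntegrand
  refine mul_le_mul_of_nonneg_left ?_ (by positivity)
  exact rpow_le_rpow_of_nonpos h2 (by nlinarith) (by norm_num)

lemma integral_travelIntegrand_pos {κ h m : ℝ} (hh : h < 1) (h0 : 0 < m) (hm : m < 1) :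
    0 < ∫ w in (0 : ℝ)..m, travelIntegrand κ h w := by
  apply intervalIntegral.intervalIntegral_pos_of_pos_on
    (intervalIntegrable_travelIntegrand hh (by rwa [abs_of_pos h0])) _ h0
  intro w hw
  exact travelIntegrand_pos hh (by rw [abs_of_pos hw.1]; exact hw.2.trans hm)

lemma travelTime_mono_right {κ X h₁ h₂ : ℝ} (hX : 0 < X) (h : h₁ ≤ h₂) (hh : h₂ < 1) :
    travelTime κ X h₁ ≤ travelTime κ X h₂ := by
  unfold travelTime
  refine mul_le_mul_of_nonneg_left ?_ (by positivity)
  have hm := abs_sqrt_one_sub_inv_lt hX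
  refine intervalIntegral.integral_mono_on (sqrt_nonneg _)
    (intervalIntegrable_travelIntegrand (h.trans_lt hh) hm)
    (intervalIntegrable_travelIntegrand hh hm) ?_
  intro w hw
  refine travelIntegrand_le h hh ?_
  rw [abs_of_nonneg hw.1]
  exact hw.2.trans_lt ((le_abs_self _).trans_lt hm)

lemma travelTime_strictMono {κ X₁ X₂ h₁ h₂ : ℝ} (hκ : 0 ≤ κ + 1 / 2) (h1 : 1 ≤ X₁) (hX : X₁ < X₂)
    (h : h₁ ≤ h₂) (hh : h₂ < 1) :
    travelTime κ X₁ h₁ < travelTime κ X₂ h₂ := by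
  refine lt_of_le_of_lt (travelTime_mono_right (by linarith) h hh) ?_
  unfold travelTime
  have p1 : 0 < X₁ := by linarith
  have p2 : 0 < X₂ := by linarith
  have hs : √(1 - 1 / X₁) < √(1 - 1 / X₂) := by
    apply sqrt_lt_sqrt
    · have : 1 / X₁ ≤ 1 := by rw [div_le_one p1]; exact h1
      linarith
    · have := one_div_lt_one_div_of_lt p1 hX
      linarith
  have hs0 : 0 < √(1 - 1 / X₂) := (sqrt_nonneg _).trans_lt hs
  have hm1 := abs_sqrt_one_sub_inv_lt p1
  have hm2 := abs_sqrt_one_sub_inv_lt p2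
  have i1 := intervalIntegrable_travelIntegrand (κ := κ) hh hm1
  have i2 := intervalIntegrable_travelIntegrand (κ := κ) hh hm2
  have key : 0 < ∫ w in √(1 - 1 / X₁)..√(1 - 1 / X₂), travelIntegrand κ h₂ w := by
    apply intervalIntegral.intervalIntegral_pos_of_pos_on (i1.symm.trans i2) _ hs
    intro w hw
    refine travelIntegrand_pos hh ?_
    rw [abs_of_pos ((sqrt_nonneg _).trans_lt hw.1)]
    exact hw.2.trans ((le_abs_self _).trans_lt hm2)
  have hsplit := intervalIntegral.integral_add_adjacent_intervals i1 (i1.symm.trans i2)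
  have hlt : ∫ w in (0 : ℝ)..√(1 - 1 / X₁), travelIntegrand κ h₂ w
      < ∫ w in (0 : ℝ)..√(1 - 1 / X₂), travelIntegrand κ h₂ w := by linarith
  have hpos := integral_travelIntegrand_pos (κ := κ) hh hs0 ((le_abs_self _).trans_lt hm2)
  calc _ < 2 * X₁ ^ (κ + 1 / 2) * ∫ w in (0 : ℝ)..√(1 - 1 / X₂), travelIntegrand κ h₂ w := by
        apply mul_lt_mul_of_pos_left hlt; positivity
    _ ≤ _ := by
        apply mul_le_mul_of_nonneg_right _ hpos.le
        have := rpow_le_rpow p1.le hX.le hκ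
        linarith

lemma hasDerivAt_travelTime {κ X h : ℝ} (hX : 1 < X) (hh : h < 1) :
    HasDerivAt (fun Z => travelTime κ Z h)
      (((κ + 1 / 2) * travelTime κ X h + 1 / √((1 - 1 / X) * (1 - h / X))) / X) X := by
  have p : 0 < X := by linarith
  have hX1 : 1 / X < 1 := by rw [div_lt_one p]; exact hX
  have hX0 : 0 < 1 / X := by positivity
  have hm : 0 < 1 - 1 / X := by linarith
  have hs := sqrt_pos.2 hm
  have hhX : 0 < 1 - h / X := by
    have : h / X < 1 := by rw [div_lt_one p]; linarith
    linarith
  have d1 : HasDerivAt (fun Z : ℝ => 1 - 1 / Z) (1 / X ^ 2) X := by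
    have : HasDerivAt (fun Z : ℝ => 1 - 1 / Z) (- -(X ^ 2)⁻¹) X := by
      simpa only [one_div] using (hasDerivAt_inv p.ne').const_sub 1
    exact this.congr_deriv (by ring)
  have d2 := d1.sqrt hm.ne'
  have d3 := (hasDerivAt_integral_travelIntegrand (κ := κ) hh
    (abs_sqrt_one_sub_inv_lt p)).comp X d2
  have d4 := ((hasDerivAt_id X).rpow_const (p := κ + 1 / 2) (Or.inl p.ne')).const_mul 2
  have d5 := d4.mul d3
  have d6 : HasDerivAt (fun Z => travelTime κ Z h) _ X := d5
  convert d6 using 1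
  have hsq : √(1 - 1 / X) ^ 2 = 1 - 1 / X := sq_sqrt hm.le
  have e1 : travelIntegrand κ h √(1 - 1 / X) = X ^ (-(κ - 1 / 2)) / √(1 - h / X) := by
    unfold travelIntegrand
    rw [hsq, rpow_neg p.le (κ - 1 / 2)]
    have : 1 - (1 - 1 / X) = X⁻¹ := by rw [one_div]; ring
    rw [this, inv_rpow p.le]
    have : 1 - h * X⁻¹ = 1 - h / X := by ring
    rw [this, rpow_neg hhX.le, ← sqrt_eq_rpow]
    field_simp
  have e2 : X ^ (κ + 1 / 2) = X ^ (κ + 1 / 2 - 1) * X := by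
    rw [← rpow_add_one p.ne', sub_add_cancel]
  have e3 : X ^ (κ + 1 / 2) * X ^ (-(κ - 1 / 2)) = X := by
    rw [← rpow_add p]; ring_nf; simp
  have hr := sqrt_pos.2 hhX
  simp only [Function.comp, e1, id]
  rw [sqrt_mul hm.le]
  have : travelTime κ X h = 2 * X ^ (κ + 1 / 2) *
    ∫ w in (0 : ℝ)..√(1 - 1 / X), travelIntegrand κ h w := rfl
  rw [this]
  set J := ∫ w in (0 : ℝ)..√(1 - 1 / X), travelIntegrand κ h w
  set s := √(1 - 1 / X)
  set r := √(1 - h / X)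
  have e4 : 2 * X ^ (κ + 1 / 2) * (X ^ (-(κ - 1 / 2)) / r * (1 / X ^ 2 / (2 * s)))
      = 1 / (s * r) / X := by
    have : 2 * X ^ (κ + 1 / 2) * (X ^ (-(κ - 1 / 2)) / r * (1 / X ^ 2 / (2 * s)))
      = (X ^ (κ + 1 / 2) * X ^ (-(κ - 1 / 2))) * (1 / (X ^ 2 * s * r)) := by
      field_simp
    rw [this, e3]
    field_simp
  rw [e4]
  rw [e2]
  field_simp

lemma exists_le_travelTime {κ b c : ℝ} (hκ : κ ≤ 1 / 2) (hκ' : 0 ≤ κ + 1 / 2) (hc : 0 < c)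
    (hcb : c < b) (M : ℝ) : ∃ X, 1 < X ∧ c * X ^ 2 < b ∧ M ≤ travelTime κ X (c * X ^ 2 / b) := by
  have hb : 0 < b := hc.trans hcb
  set Z := √(b / c) with hZ
  have hZ1 : 1 < Z := by
    rw [hZ, lt_sqrt (by norm_num)]; rw [one_pow, lt_div_iff₀ hc]; linarith
  have hZ2 : c * Z ^ 2 = b := by rw [hZ, sq_sqrt (by positivity)]; field_simp
  have lower : ∀ X, 1 < X → c * X ^ 2 < b →
      2 * Real.log (√(1 - 1 / X) / √(1 - c * X ^ 2 / b)) ≤ travelTime κ X (c * X ^ 2 / b) := by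
    intro X h1 h2
    set h := c * X ^ 2 / b with hh
    have p : 0 < X := by linarith
    have hh0 : 0 < h := by positivity
    have hh1 : h < 1 := by rw [hh, div_lt_one hb]; exact h2
    have hm := abs_sqrt_one_sub_inv_lt p
    have hs : 0 < √(1 - 1 / X) := by
      apply sqrt_pos.2
      have : 1 / X < 1 := by rw [div_lt_one p]; exact h1
      linarith
    set m := √(1 - 1 / X)
    set δ := √(1 - h) with hδ
    have hδ0 : 0 < δ := sqrt_pos.2 (by linarith)
    have hδ2 : δ ^ 2 = 1 - h := sq_sqrt (by linarith)
    have hder : ∀ w ∈ Set.uIcc 0 m, HasDerivAt (fun w => Real.log (δ + w)) (1 / (δ + w)) w := by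
      intro w hw
      rw [Set.uIcc_of_le hs.le] at hw
      have := ((hasDerivAt_id w).const_add δ).log (by simp only [id]; linarith [hw.1])
      simpa using this
    have hcont : ContinuousOn (fun w => 1 / (δ + w)) (Set.uIcc 0 m) := by
      apply ContinuousOn.div (by fun_prop) (by fun_prop)
      intro w hw
      rw [Set.uIcc_of_le hs.le] at hw
      linarith [hw.1]
    have hint := intervalIntegral.integral_eq_sub_of_hasDerivAt hder hcont.intervalIntegrable
    have hle : ∫ w in (0 : ℝ)..m, 1 / (δ + w) ≤ ∫ w in (0 : ℝ)..m, travelIntegrand κ h w := by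
      refine intervalIntegral.integral_mono_on hs.le hcont.intervalIntegrable
        (intervalIntegrable_travelIntegrand hh1 hm) ?_
      intro w hw
      have hwa : |w| < 1 := by
        rw [abs_of_nonneg hw.1]; exact hw.2.trans_lt ((le_abs_self _).trans_lt hm)
      have hw1 := sq_lt_one_of_abs_lt hwa
      have hw2 := one_sub_mul_pos hh1 hw1 (by nlinarith [sq_nonneg w])
      unfold travelIntegrand
      have k1 : 1 ≤ (1 - w ^ 2) ^ (κ - 1 / 2) :=
        one_le_rpow_of_pos_of_le_one_of_nonpos hw1 (by nlinarith) (by linarith)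
      have k2 : 1 / (δ + w) ≤ (1 - h * (1 - w ^ 2)) ^ (-(1 / 2) : ℝ) := by
        rw [rpow_neg hw2.le, ← sqrt_eq_rpow, ← one_div]
        apply one_div_le_one_div_of_le (sqrt_pos.2 hw2)
        rw [sqrt_le_left (by linarith [hw.1])]
        nlinarith [mul_nonneg hδ0.le hw.1, sq_nonneg w]
      calc 1 / (δ + w) ≤ 1 * (1 - h * (1 - w ^ 2)) ^ (-(1 / 2) : ℝ) := by rw [one_mul]; exact k2
        _ ≤ _ := by gcongr
    have hlog : Real.log (m / δ) ≤ ∫ w in (0 : ℝ)..m, 1 / (δ + w) := by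
      rw [hint, add_zero, ← Real.log_div (by linarith) hδ0.ne']
      apply Real.log_le_log (by positivity)
      gcongr
      linarith
    have hX : 1 ≤ X ^ (κ + 1 / 2) := one_le_rpow h1.le hκ'
    have hpos := integral_travelIntegrand_pos (κ := κ) hh1 hs ((le_abs_self _).trans_lt hm)
    unfold travelTime
    calc 2 * Real.log (m / δ) ≤ 2 * ∫ w in (0 : ℝ)..m, travelIntegrand κ h w := by linarith
      _ ≤ _ := by
        apply mul_le_mul_of_nonneg_right _ hpos.le
        linarith
  have hev : ∀ᶠ X in nhdsWithin Z (Set.Iio Z), 1 < X ∧ c * X ^ 2 < b := by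
    have h1 : ∀ᶠ X in nhdsWithin Z (Set.Iio Z), 1 < X :=
      nhdsWithin_le_nhds (lt_mem_nhds hZ1)
    filter_upwards [h1, self_mem_nhdsWithin] with X h1 h2
    refine ⟨h1, ?_⟩
    have h2 : X < Z := h2
    rw [← hZ2]
    have : X ^ 2 < Z ^ 2 := by nlinarith
    nlinarith
  have hnum : Tendsto (fun X => √(1 - 1 / X)) (nhdsWithin Z (Set.Iio Z)) (nhds √(1 - 1 / Z)) := by
    have : ContinuousAt (fun X : ℝ => √(1 - 1 / X)) Z := by
      refine ContinuousAt.sqrt ?_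
      exact continuousAt_const.sub (continuousAt_const.div continuousAt_id (by linarith))
    exact this.tendsto.mono_left nhdsWithin_le_nhds
  have hden : Tendsto (fun X => √(1 - c * X ^ 2 / b)) (nhdsWithin Z (Set.Iio Z))
      (nhdsWithin 0 (Set.Ioi 0)) := by
    rw [tendsto_nhdsWithin_iff]
    constructor
    · have : ContinuousAt (fun X : ℝ => √(1 - c * X ^ 2 / b)) Z := by fun_prop
      have h2 := this.tendsto.mono_left (nhdsWithin_le_nhds (s := Set.Iio Z))
      simp only [hZ2, div_self hb.ne', sub_self, sqrt_zero] at h2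
      exact h2
    · filter_upwards [hev] with X hX
      apply sqrt_pos.2
      have : c * X ^ 2 / b < 1 := by rw [div_lt_one hb]; exact hX.2
      linarith
  have hnum0 : 0 < √(1 - 1 / Z) := by
    apply sqrt_pos.2
    have : 1 / Z < 1 := by rw [div_lt_one (by linarith)]; exact hZ1
    linarith
  have hdiv : Tendsto (fun X => √(1 - 1 / X) / √(1 - c * X ^ 2 / b))
      (nhdsWithin Z (Set.Iio Z)) atTop := by
    simp only [div_eq_mul_inv]
    have := hnum.pos_mul_atTop hnum0 (tendsto_inv_nhdsGT_zero.comp hden)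
    simpa [Function.comp, div_eq_mul_inv] using this
  have hlog := (Real.tendsto_log_atTop.comp hdiv).const_mul_atTop (two_pos)
  have hfin := (hlog.eventually_ge_atTop M).and hev
  obtain ⟨X, hX1, hX2, hX3⟩ := hfin.exists
  exact ⟨X, hX2, hX3, hX1.trans (lower X hX2 hX3)⟩

/-- `X` is the turning point reached from `1` in (rescaled) time `ℓ`. -/
def IsTurningPoint (κ q b c ℓ X : ℝ) : Prop :=
  1 < X ∧ c * X ^ 2 < b ∧ travelTime κ X (c * X ^ 2 / b) = √(2 * q * b) * ℓ

/-- The squared speed at `U = 1` of an orbit with turning point `X`, up to normalization. -/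
noncomputable def launchEnergy (b c X : ℝ) : ℝ := (X - 1) * (b / X - c)

lemma launchEnergy_le {b c X Z : ℝ} (hc : 0 ≤ c) (h1 : 0 < X) (h : X ≤ Z) (hZ : c * Z ^ 2 ≤ b) :
    launchEnergy b c X ≤ launchEnergy b c Z := by
  have hZ0 : 0 < Z := by linarith
  have e : launchEnergy b c Z - launchEnergy b c X = (Z - X) * (b - c * (X * Z)) / (X * Z) := by
    unfold launchEnergy
    field_simp
    ring
  have : 0 ≤ (Z - X) * (b - c * (X * Z)) / (X * Z) := by
    apply div_nonneg (mul_nonneg (by linarith) _) (by positivity)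
    have : c * (X * Z) ≤ c * Z ^ 2 := by
      apply mul_le_mul_of_nonneg_left _ hc
      nlinarith
    linarith
  linarith

lemma travelTime_lt_of_lt {κ b c X Z : ℝ} (hκ : 0 ≤ κ + 1 / 2) (hc : 0 ≤ c) (hb : 0 < b)
    (h1 : 1 ≤ X) (h : X < Z) (hZ : c * Z ^ 2 < b) :
    travelTime κ X (c * X ^ 2 / b) < travelTime κ Z (c * Z ^ 2 / b) := by
  apply travelTime_strictMono hκ h1 h
  · apply div_le_div_of_nonneg_right _ hb.le
    apply mul_le_mul_of_nonneg_left _ hc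
    nlinarith
  · rw [div_lt_one hb]; exact hZ

lemma IsTurningPoint.lt_of_lt {κ q b c ℓ X Z : ℝ} (h : IsTurningPoint κ q b c ℓ X)
    (hκ : 0 ≤ κ + 1 / 2) (hc : 0 ≤ c) (hb : 0 < b) (hZ : c * Z ^ 2 < b)
    (hlt : travelTime κ Z (c * Z ^ 2 / b) < √(2 * q * b) * ℓ) : Z < X := by
  by_contra! hle
  rcases hle.eq_or_lt with rfl | h'
  · exact hlt.ne h.2.2
  · have := travelTime_lt_of_lt hκ hc hb h.1.le h' hZ
    rw [h.2.2] at this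
    exact lt_asymm this hlt

lemma IsTurningPoint.gt_of_gt {κ q b c ℓ X Z : ℝ} (h : IsTurningPoint κ q b c ℓ X)
    (hκ : 0 ≤ κ + 1 / 2) (hc : 0 ≤ c) (hb : 0 < b) (hZ : 1 ≤ Z)
    (hlt : √(2 * q * b) * ℓ < travelTime κ Z (c * Z ^ 2 / b)) : X < Z := by
  by_contra! hle
  rcases hle.eq_or_lt with rfl | h'
  · exact hlt.ne' h.2.2
  · have := travelTime_lt_of_lt hκ hc hb hZ h' h.2.1
    rw [h.2.2] at this
    exact lt_asymm this hlt

lemma IsTurningPoint.unique {κ q b c ℓ X Z : ℝ} (h : IsTurningPoint κ q b c ℓ X)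
    (h' : IsTurningPoint κ q b c ℓ Z) (hκ : 0 ≤ κ + 1 / 2) (hc : 0 ≤ c) (hb : 0 < b) : X = Z := by
  rcases lt_trichotomy X Z with hl | he | hg
  · have := travelTime_lt_of_lt hκ hc hb h.1.le hl h'.2.1
    rw [h.2.2, h'.2.2] at this
    exact absurd this (lt_irrefl _)
  · exact he
  · have := travelTime_lt_of_lt hκ hc hb h'.1.le hg h.2.1
    rw [h.2.2, h'.2.2] at this
    exact absurd this (lt_irrefl _)

lemma exists_isTurningPoint {κ q b c ℓ : ℝ} (hκ : κ ≤ 1 / 2) (hκ' : 0 ≤ κ + 1 / 2) (hq : 0 < q)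
    (hc : 0 < c) (hcb : c < b) (hℓ : 0 < ℓ) : ∃ X, IsTurningPoint κ q b c ℓ X := by
  have hb : 0 < b := hc.trans hcb
  obtain ⟨M, h1, h2, h3⟩ := exists_le_travelTime hκ hκ' hc hcb (√(2 * q * b) * ℓ)
  have hcont : ContinuousOn (fun X => travelTime κ X (c * X ^ 2 / b)) (Set.Icc 1 M) := by
    intro X hX
    have hh : c * X ^ 2 / b < 1 := by
      rw [div_lt_one hb]
      have : X ^ 2 ≤ M ^ 2 := pow_le_pow_left₀ (by linarith [hX.1]) hX.2 2
      nlinarith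
    have h0 : ContinuousAt (fun X : ℝ => ((X, c * X ^ 2 / b) : ℝ × ℝ)) X := by fun_prop
    exact (ContinuousAt.comp (f := fun X : ℝ => ((X, c * X ^ 2 / b) : ℝ × ℝ)) (x := X)
      (continuousAt_travelTime (κ := κ) (by linarith [hX.1]) hh) h0).continuousWithinAt
  have hR : 0 < √(2 * q * b) * ℓ := by positivity
  have h10 : travelTime κ 1 (c * 1 ^ 2 / b) = 0 := by simp [travelTime]
  obtain ⟨X, hX, hX'⟩ := intermediate_value_Icc h1.le hcont
    ⟨by simp only [h10]; exact hR.le, h3⟩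
  simp only at hX'
  refine ⟨X, lt_of_le_of_ne hX.1 ?_, ?_, hX'⟩
  · rintro rfl
    rw [h10] at hX'
    exact hR.ne hX'
  · have : X ^ 2 ≤ M ^ 2 := pow_le_pow_left₀ (by linarith [hX.1]) hX.2 2
    nlinarith

lemma continuousOn_turningPoint {κ q : ℝ} {b c ℓ X : ℝ → ℝ} {S : Set ℝ} (hκ : 0 ≤ κ + 1 / 2)
    (hb : Continuous b) (hc : Continuous c) (hℓ : Continuous ℓ)
    (hc0 : ∀ t ∈ S, 0 < c t) (hX : ∀ t ∈ S, IsTurningPoint κ q (b t) (c t) (ℓ t) (X t)) :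
    ContinuousOn X S := by
  have hb0 : ∀ t ∈ S, 0 < b t := fun t ht => by
    have := (hX t ht).2.1
    have := hc0 t ht
    nlinarith [mul_nonneg this.le (sq_nonneg (X t))]
  have hcont : ∀ t ∈ S, ∀ Z, 0 < Z → c t * Z ^ 2 < b t →
      ContinuousAt (fun t => travelTime κ Z (c t * Z ^ 2 / b t) - √(2 * q * b t) * ℓ t) t := by
    intro t ht Z hZ0 hZ
    have h0 : ContinuousAt (fun t : ℝ => ((Z, c t * Z ^ 2 / b t) : ℝ × ℝ)) t :=
      continuousAt_const.prodMk
        (ContinuousAt.div (by fun_prop) (by fun_prop) (hb0 t ht).ne')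
    have hh : c t * Z ^ 2 / b t < 1 := by rw [div_lt_one (hb0 t ht)]; exact hZ
    refine ContinuousAt.sub (ContinuousAt.comp (f := fun t : ℝ => ((Z, c t * Z ^ 2 / b t) : ℝ × ℝ))
      (x := t) (continuousAt_travelTime (κ := κ) hZ0 hh) h0) (by fun_prop)
  have hdom : ∀ t ∈ S, ∀ Z, c t * Z ^ 2 < b t → ∀ᶠ s in nhds t, c s * Z ^ 2 < b s := by
    intro t _ Z hZ
    exact (ContinuousAt.eventually_lt (f := fun s => c s * Z ^ 2) (by fun_prop)
      hb.continuousAt hZ)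
  intro t ht
  obtain ⟨h1, h2, h3⟩ := hX t ht
  rw [ContinuousWithinAt, tendsto_order]
  constructor
  · intro y hy
    obtain ⟨Z, hZ1, hZ2⟩ := exists_between (max_lt hy h1)
    have z1 : 1 < Z := (le_max_right _ _).trans_lt hZ1
    have zd : c t * Z ^ 2 < b t := by
      have : Z ^ 2 < X t ^ 2 := by nlinarith
      nlinarith [hc0 t ht]
    have hlt := travelTime_lt_of_lt hκ (hc0 t ht).le (hb0 t ht) z1.le hZ2 h2
    have ev := (hcont t ht Z (by linarith) zd).eventually_lt_const
      (u := 0) (by rw [h3] at hlt; linarith)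
    filter_upwards [nhdsWithin_le_nhds ev, nhdsWithin_le_nhds (hdom t ht Z zd),
      self_mem_nhdsWithin] with s hs hd hsS
    exact (le_max_left _ _).trans_lt
      (hZ1.trans ((hX s hsS).lt_of_lt hκ (hc0 s hsS).le (hb0 s hsS) hd (by linarith)))
  · intro y hy
    have hev : ∀ᶠ Z in nhds (X t), c t * Z ^ 2 < b t :=
      ContinuousAt.eventually_lt (f := fun Z => c t * Z ^ 2) (g := fun _ => b t)
        (by fun_prop) (by fun_prop) h2
    have hev2 : ∀ᶠ Z in nhdsWithin (X t) (Set.Ioi (X t)), c t * Z ^ 2 < b t ∧ Z < y ∧ X t < Z := by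
      filter_upwards [nhdsWithin_le_nhds hev, nhdsWithin_le_nhds (gt_mem_nhds hy),
        self_mem_nhdsWithin] with Z a1 a2 a3
      exact ⟨a1, a2, a3⟩
    obtain ⟨Z, zd, hZ1, hZ2⟩ := hev2.exists
    have hlt := travelTime_lt_of_lt hκ (hc0 t ht).le (hb0 t ht) h1.le hZ2 zd
    have ev := (hcont t ht Z (by linarith) zd).eventually_const_lt
      (u := 0) (by rw [h3] at hlt; linarith)
    filter_upwards [nhdsWithin_le_nhds ev, self_mem_nhdsWithin] with s hs hsS
    exact ((hX s hsS).gt_of_gt hκ (hc0 s hsS).le (hb0 s hsS) (by linarith) (by linarith)).trans hZ1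

lemma eventually_mul_pos_of_hasDerivAt {F : ℝ → ℝ} {F' : ℝ} (h : HasDerivAt F F' 0)
    (h0 : F 0 = 0) (hF : 0 < F') : ∀ᶠ s in nhdsWithin (0 : ℝ) {0}ᶜ, 0 < s * F s := by
  have := (hasDerivAt_iff_tendsto_slope.1 h).eventually_const_lt hF
  filter_upwards [this, self_mem_nhdsWithin] with s hs hs0
  have hs0 : s ≠ 0 := hs0
  rw [slope_def_field, h0, sub_zero, sub_zero] at hs
  have : s * F s = (F s / s) * s ^ 2 := by field_simp
  rw [this]
  positivity

lemma eventually_turningPoint_compare {κ q : ℝ} {b c ℓ X : ℝ → ℝ} {X' H' R' : ℝ}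
    (hκ : 0 ≤ κ + 1 / 2) (hb : ContinuousAt b 0) (hc : ContinuousAt c 0)
    (hc0 : 0 < c 0) (h0 : IsTurningPoint κ q (b 0) (c 0) (ℓ 0) (X 0))
    (hX : HasDerivAt X X' 0) (hH : HasDerivAt (fun s => c s * X s ^ 2 / b s) H' 0)
    (hR : HasDerivAt (fun s => √(2 * q * b s) * ℓ s) R' 0) (hH' : H' < 0)
    (hR' : ((κ + 1 / 2) * (√(2 * q * b 0) * ℓ 0) + 1 / √(launchEnergy (b 0) (c 0) (X 0) / b 0))
      / X 0 * X' < R') :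
    ∀ᶠ s in nhdsWithin (0 : ℝ) {0}ᶜ, ∀ Z, IsTurningPoint κ q (b s) (c s) (ℓ s) Z →
      0 < s * (Z - X s) := by
  obtain ⟨h1, h2, h3⟩ := h0
  have hb0 : 0 < b 0 := by nlinarith [mul_nonneg hc0.le (sq_nonneg (X 0))]
  have hX0 : 0 < X 0 := by linarith
  set H0 := c 0 * X 0 ^ 2 / b 0 with hH0
  have hH1 : H0 < 1 := by rw [hH0, div_lt_one hb0]; exact h2
  have e : (1 - 1 / X 0) * (1 - H0 / X 0) = launchEnergy (b 0) (c 0) (X 0) / b 0 := by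
    rw [hH0, launchEnergy]; field_simp
  have d1 := (hasDerivAt_travelTime (κ := κ) h1 hH1).comp (0 : ℝ) hX
  rw [e, h3] at d1
  have ev1 := eventually_mul_pos_of_hasDerivAt (hR.sub d1)
    (by simp only [Pi.sub_apply, Function.comp]; linarith) (by linarith)
  have ev2 := eventually_mul_pos_of_hasDerivAt (hH.const_sub H0)
    (by simp [hH0]) (by linarith)
  have ev3 : ∀ᶠ s in nhds (0 : ℝ), c s * X s ^ 2 / b s < 1 :=
    hH.continuousAt.eventually_lt_const hH1
  have ev4 : ∀ᶠ s in nhds (0 : ℝ), 1 < X s := hX.continuousAt.eventually_const_lt h1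
  have ev5 : ∀ᶠ s in nhds (0 : ℝ), 0 < b s := hb.eventually_const_lt hb0
  have ev6 : ∀ᶠ s in nhds (0 : ℝ), 0 < c s := hc.eventually_const_lt hc0
  filter_upwards [ev1, ev2, nhdsWithin_le_nhds ev3, nhdsWithin_le_nhds ev4,
    nhdsWithin_le_nhds ev5, nhdsWithin_le_nhds ev6, self_mem_nhdsWithin] with
    s a1 a2 a3 a4 a5 a6 a7 Z hZ
  have a8 : c s * X s ^ 2 < b s := by rwa [div_lt_one a5] at a3
  simp only [Pi.sub_apply, Function.comp] at a1
  rcases lt_or_gt_of_ne (show s ≠ 0 from a7) with hs | hs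
  · have g1 := neg_of_mul_pos_right a1 hs.le
    have g2 := neg_of_mul_pos_right a2 hs.le
    have := travelTime_mono_right (κ := κ) (X := X s) (by linarith) (sub_neg.1 g2).le a3
    exact mul_pos_of_neg_of_neg hs (sub_neg.2 (hZ.gt_of_gt hκ a6.le a5 a4.le (by linarith)))
  · have g1 := pos_of_mul_pos_right a1 hs.le
    have g2 := pos_of_mul_pos_right a2 hs.le
    have := travelTime_mono_right (κ := κ) (X := X s) (by linarith) (sub_pos.1 g2).le hH1
    exact mul_pos hs (sub_pos.2 (hZ.lt_of_lt hκ a6.le a5 a8 (by linarith)))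

lemma false_of_upcrossing {G : ℝ → ℝ} {T : ℝ} (hT : 0 < T) (hG : ContinuousOn G (Set.Icc 0 T))
    (hGT : G T = 0) (hr : ∀ᶠ s in nhdsWithin (0 : ℝ) (Set.Ioi 0), 0 < G s)
    (hl : ∀ x ∈ Set.Ioc 0 T, G x = 0 → ∀ᶠ s in nhdsWithin x (Set.Iio x), G s < 0) : False := by
  have hev : ∀ᶠ s in nhdsWithin (0 : ℝ) (Set.Ioi 0), 0 < G s ∧ s < T ∧ 0 < s := by
    filter_upwards [hr, nhdsWithin_le_nhds (gt_mem_nhds hT), self_mem_nhdsWithin] with s a b c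
    exact ⟨a, b, c⟩
  obtain ⟨y, hy, hyT, hy0⟩ := hev.exists
  have hGy : ContinuousOn G (Set.Icc y T) := hG.mono (Set.Icc_subset_Icc_left hy0.le)
  have hcl : IsClosed {x ∈ Set.Icc y T | G x = 0} := by
    exact hGy.preimage_isClosed_of_isClosed isClosed_Icc (isClosed_singleton (x := (0 : ℝ)))
  have hne : {x ∈ Set.Icc y T | G x = 0}.Nonempty := ⟨T, ⟨hyT.le, le_rfl⟩, hGT⟩
  have hbd : BddBelow {x ∈ Set.Icc y T | G x = 0} := ⟨y, fun x hx => hx.1.1⟩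
  have hz := hcl.csInf_mem hne hbd
  set z := sInf {x ∈ Set.Icc y T | G x = 0} with hzdef
  have hyz : y < z := by
    refine lt_of_le_of_ne hz.1.1 ?_
    intro h
    rw [← h] at hz
    exact hy.ne' hz.2
  have hev2 : ∀ᶠ s in nhdsWithin z (Set.Iio z), G s < 0 ∧ y < s ∧ s < z := by
    filter_upwards [hl z ⟨hy0.trans hyz, hz.1.2⟩ hz.2, nhdsWithin_le_nhds (lt_mem_nhds hyz),
      self_mem_nhdsWithin] with s a b c
    exact ⟨a, b, c⟩
  obtain ⟨s, hs, hys, hsz⟩ := hev2.exists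
  obtain ⟨x, hx, hx0⟩ := intermediate_value_Icc' hys.le
    (hGy.mono (Set.Icc_subset_Icc_right (hsz.le.trans hz.1.2))) ⟨hs.le, hy.le⟩
  have := csInf_le hbd ⟨⟨hx.1, hx.2.trans (hsz.le.trans hz.1.2)⟩, hx0⟩
  rw [← hzdef] at this
  linarith [hx.2]

lemma exists_intermediate_rate {q y : ℝ} (hq : 2 < q) (hy : 0 < y) :
    ∃ η : ℝ, 0 < η ∧ η < 2 ∧ η * (q + 1) < 2 * q ∧ η * (1 / 2 - 1 / q + y) < 1 ∧
      1 < η * (1 / 2 + 1 / q + y) := by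
  have hq0 : 0 < q := by linarith
  have hiq : 0 < 1 / q := by positivity
  have hD0 : 0 < y + 1 / 2 + 1 / q / 2 := by positivity
  have hqq : q * (1 / q) = 1 := by field_simp
  refine ⟨1 / (y + 1 / 2 + 1 / q / 2), by positivity, ?_, ?_, ?_, ?_⟩
  · rw [div_lt_iff₀ hD0]; linarith
  · rw [div_mul_eq_mul_div, div_lt_iff₀ hD0]; nlinarith [mul_pos hq0 hy]
  · rw [div_mul_eq_mul_div, div_lt_one hD0]; linarith
  · rw [div_mul_eq_mul_div, lt_div_iff₀ hD0]; linarith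

/-- At a crossing there are speeds `η₁`, `η₂` for the test curves `X e^{η₁ s}`, `Y e^{η₂ s}` which
are too slow, respectively too fast, and along which the energy difference increases. -/
lemma exists_test_speeds {q N α β a X Y y : ℝ} (hq : 2 < q) (hq6 : q ≤ 6)
    (hN : N * (q - 2) = 4 * q) (hα : 0 < α) (hα2 : α < 2) (hαβ : α < β)
    (ha : 3 / 2 * α ^ 2 < a) (hX : 1 < X) (hY : 1 < Y)
    (hXd : (α ^ 2 + a) * X ^ 2 < (2 + β) ^ 2)
    (hYd : β ^ 2 * Y ^ 2 < (2 - α) ^ 2 + a) (hy : 0 < y)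
    (hP : launchEnergy ((2 + β) ^ 2) (α ^ 2 + a) X = launchEnergy ((2 - α) ^ 2 + a) (β ^ 2) Y) :
    ∃ η₁ η₂ : ℝ, 2 * η₁ * (α ^ 2 + a) < N * a ∧ η₁ * (1 / 2 - 1 / q + y) < 1 ∧ 0 < η₂ ∧
      1 - N * a / (2 * ((2 - α) ^ 2 + a)) < η₂ * (1 / 2 + 1 / q + y) ∧
      0 < η₁ * ((2 + β) ^ 2 / X - (α ^ 2 + a) * X) + N * a * (X - 1 / Y)
        - η₂ * (((2 - α) ^ 2 + a) / Y - β ^ 2 * Y) := by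
  have hN0 : 0 < N := by nlinarith
  have hN4 : 4 < N := by nlinarith
  have ha0 : 0 < a := by nlinarith [sq_nonneg α]
  have hX0 : 0 < X := by linarith
  have hY0 : 0 < Y := by linarith
  have hA : 0 < (2 - α) ^ 2 + a := by positivity
  obtain ⟨η, hη0, hη2, hη1, hs1, hs2⟩ := exists_intermediate_rate hq hy
  have c1 : 2 * η * (α ^ 2 + a) < N * a := by
    have k1 : α ^ 2 + a < 5 / 3 * a := by linarith
    have k2 : 10 / 3 * η ≤ N := by
      have : (10 / 3 * η) * ((q - 2) * (q + 1)) ≤ N * ((q - 2) * (q + 1)) := by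
        have e : N * ((q - 2) * (q + 1)) = 4 * q * (q + 1) := by rw [← hN]; ring
        rw [e]
        have := mul_le_mul_of_nonneg_left hη1.le (show 0 ≤ 10 / 3 * (q - 2) by linarith)
        nlinarith
      exact le_of_mul_le_mul_right this (by nlinarith)
    have := mul_le_mul_of_nonneg_right k2 ha0.le
    have := mul_lt_mul_of_pos_left k1 (show 0 < 2 * η by linarith)
    linarith
  have hφ₁ : 0 < (2 + β) ^ 2 / X - (α ^ 2 + a) * X := by
    have : (2 + β) ^ 2 / X - (α ^ 2 + a) * X = ((2 + β) ^ 2 - (α ^ 2 + a) * X ^ 2) / X := by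
      field_simp
    rw [this]
    exact div_pos (by linarith) hX0
  have hφ : 0 < ((2 - α) ^ 2 + a) / Y - β ^ 2 * Y := by
    have : ((2 - α) ^ 2 + a) / Y - β ^ 2 * Y = ((2 - α) ^ 2 + a - β ^ 2 * Y ^ 2) / Y := by
      field_simp
    rw [this]
    exact div_pos (by linarith) hY0
  have hY1 : 1 / Y < 1 := by rw [div_lt_one hY0]; exact hY
  have hYX : 0 < N * a * (X - 1 / Y) := mul_pos (by positivity) (by linarith)
  by_cases hk : N * a / (2 * ((2 - α) ^ 2 + a)) < 1
  · have hφ1 : (2 + β) ^ 2 / X - (α ^ 2 + a) * X = ((2 - α) ^ 2 + a) / Y - β ^ 2 * Y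
        + 4 * (α + β) - 2 * (α ^ 2 + a) * X + 2 * β ^ 2 * Y := by
      have e1 : launchEnergy ((2 + β) ^ 2) (α ^ 2 + a) X =
          (2 + β) ^ 2 - (α ^ 2 + a) * X - (2 + β) ^ 2 / X + (α ^ 2 + a) := by
        unfold launchEnergy; field_simp; ring
      have e2 : launchEnergy ((2 - α) ^ 2 + a) (β ^ 2) Y =
          ((2 - α) ^ 2 + a) - β ^ 2 * Y - ((2 - α) ^ 2 + a) / Y + β ^ 2 := by
        unfold launchEnergy; field_simp; ring
      rw [e1, e2] at hP
      linarith
    have hκ0 : 0 < N * a / (2 * ((2 - α) ^ 2 + a)) := by positivity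
    have hκA : N * a / (2 * ((2 - α) ^ 2 + a)) * ((2 - α) ^ 2 + a) = N * a / 2 := by field_simp
    generalize N * a / (2 * ((2 - α) ^ 2 + a)) = κ at hk hκ0 hκA ⊢
    refine ⟨η, (1 - κ) * η, c1, hs1, mul_pos (by linarith) hη0, ?_, ?_⟩
    · have := mul_lt_mul_of_pos_left hs2 (sub_pos.2 hk)
      linarith
    · rw [hφ1]
      have e2 : η * (((2 - α) ^ 2 + a) / Y - β ^ 2 * Y + 4 * (α + β) - 2 * (α ^ 2 + a) * X
            + 2 * β ^ 2 * Y) + N * a * (X - 1 / Y)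
          - (1 - κ) * η * (((2 - α) ^ 2 + a) / Y - β ^ 2 * Y)
          = η * (4 * (α + β)) + (N * a - 2 * η * (α ^ 2 + a)) * X
          - N * a * (1 - η / 2) * (1 / Y) + η * (2 - κ) * (β ^ 2 * Y) := by
        linear_combination (η / Y) * hκA
      rw [e2]
      have k1 : (N * a - 2 * η * (α ^ 2 + a)) * 1 ≤ (N * a - 2 * η * (α ^ 2 + a)) * X :=
        mul_le_mul_of_nonneg_left hX.le (by linarith)
      have k2 : N * a * (1 - η / 2) * (1 / Y) ≤ N * a * (1 - η / 2) * 1 :=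
        mul_le_mul_of_nonneg_left hY1.le (mul_nonneg (by positivity) (by linarith))
      have k3 : 0 < η * (2 - κ) * (β ^ 2 * Y) := by
        have : 0 < β := by linarith
        have : 0 < 2 - κ := by linarith
        positivity
      have k4 : 0 < η * (4 * (α + β) - 2 * α ^ 2 - 2 * a + N / 2 * a) := by
        apply mul_pos hη0
        have h1 : 0 < (N / 2 - 2) * a := mul_pos (by linarith) ha0
        have h2 : 0 < α * (2 - α) := mul_pos hα (by linarith)
        linarith
      linarith
  · push Not at hk
    refine ⟨η, N * a * (X - 1 / Y) / (((2 - α) ^ 2 + a) / Y - β ^ 2 * Y), c1, hs1,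
      div_pos hYX hφ, ?_, ?_⟩
    · have : 0 < N * a * (X - 1 / Y) / (((2 - α) ^ 2 + a) / Y - β ^ 2 * Y) * (1 / 2 + 1 / q + y) :=
        mul_pos (div_pos hYX hφ) (by positivity)
      linarith
    · rw [div_mul_cancel₀ _ hφ.ne']
      have := mul_pos hη0 hφ₁
      linarith

lemma hasDerivAt_mul_exp (x η : ℝ) : HasDerivAt (fun s => x * exp (η * s)) (x * η) 0 := by
  have := (((hasDerivAt_id (0 : ℝ)).const_mul η).exp).const_mul x
  simpa using this

lemma inv_sqrt_div_eq {q b ℓ P : ℝ} (hq : 0 < q) (hb : 0 < b) (hℓ : 0 < ℓ) (hP : 0 < P) :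
    1 / √(P / b) = 1 / (ℓ * √(2 * q * P)) * (√(2 * q * b) * ℓ) := by
  rw [sqrt_div' _ hb.le, sqrt_mul (show 0 ≤ 2 * q by positivity) P,
    sqrt_mul (show 0 ≤ 2 * q by positivity) b]
  have h1 := sqrt_pos.2 hb
  have h2 := sqrt_pos.2 hP
  have h3 := sqrt_pos.2 (show 0 < 2 * q by positivity)
  field_simp

lemma launchEnergy_pos {b c X : ℝ} (hX : 1 < X) (hc : 0 ≤ c) (h : c * X ^ 2 < b) :
    0 < launchEnergy b c X := by
  have hX0 : 0 < X := by linarith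
  refine mul_pos (by linarith) ?_
  have : c * X ≤ c * X ^ 2 := mul_le_mul_of_nonneg_left (by nlinarith) hc
  have : c < b / X := by rw [lt_div_iff₀ hX0]; linarith
  linarith

lemma eventually_slow_test_curve {q N B k a ℓ X η : ℝ} (hq : 2 < q) (hB : 0 < B) (hk : 0 ≤ k)
    (ha : 0 < a) (hℓ : 0 < ℓ) (hX : IsTurningPoint (-(1 / q)) q B (k + a) ℓ X)
    (h1 : 2 * η * (k + a) < N * a)
    (h2 : η * (1 / 2 - 1 / q + 1 / (ℓ * √(2 * q * launchEnergy B (k + a) X))) < 1) :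
    ∀ᶠ s in nhdsWithin (0 : ℝ) {0}ᶜ, ∀ Z,
      IsTurningPoint (-(1 / q)) q B (k + a * exp (-N * s)) (ℓ * exp s) Z →
        0 < s * (Z - X * exp (η * s)) := by
  have hX1 := hX.1
  have hX0 : 0 < X := by linarith
  have hP := launchEnergy_pos hX1 (by positivity) hX.2.1
  have hiq : 1 / q < 1 / 2 := one_div_lt_one_div_of_lt two_pos hq
  have dX := hasDerivAt_mul_exp X η
  have dc := (hasDerivAt_mul_exp a (-N)).const_add k
  have dH := (dc.mul (dX.pow 2)).div_const B
  have dR := (((hasDerivAt_id (0 : ℝ)).exp).const_mul ℓ).const_mul √(2 * q * B)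
  refine eventually_turningPoint_compare (b := fun _ => B) (c := fun s => k + a * exp (-N * s))
    (ℓ := fun s => ℓ * exp s) (X := fun s => X * exp (η * s)) (by linarith) continuousAt_const
    (by fun_prop) (by simp; positivity) (by simpa using hX) dX dH dR ?_ ?_
  · simp only [Pi.pow_apply, mul_zero, exp_zero, mul_one]
    have : (a * -N * X ^ 2 + (k + a) * (((2 : ℕ) : ℝ) * X ^ (2 - 1) * (X * η))) / B
      = -((N * a - 2 * η * (k + a)) * X ^ 2 / B) := by push_cast; ring
    rw [this]
    have : 0 < N * a - 2 * η * (k + a) := by linarith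
    have : 0 < (N * a - 2 * η * (k + a)) * X ^ 2 / B := by positivity
    linarith
  · simp only [mul_zero, exp_zero, mul_one, id]
    rw [inv_sqrt_div_eq (q := q) (by linarith) hB hℓ hP]
    have hR : 0 < √(2 * q * B) * ℓ := by positivity
    have := mul_lt_mul_of_pos_right h2 hR
    calc _ = η * (1 / 2 - 1 / q + 1 / (ℓ * √(2 * q * launchEnergy B (k + a) X)))
          * (√(2 * q * B) * ℓ) := by
          generalize √(2 * q * B) * ℓ = R
          generalize 1 / (ℓ * √(2 * q * launchEnergy B (k + a) X)) = y
          field_simp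
          ring
      _ < _ := by linarith

lemma eventually_fast_test_curve {q N c k a ℓ Y η : ℝ} (hq : 2 < q) (hc : 0 < c) (hk : 0 ≤ k)
    (ha : 0 < a) (hN : 0 < N) (hℓ : 0 < ℓ) (hY : IsTurningPoint (1 / q) q (k + a) c ℓ Y)
    (h1 : 0 < η) (h2 : 1 - N * a / (2 * (k + a)) <
      η * (1 / 2 + 1 / q + 1 / (ℓ * √(2 * q * launchEnergy (k + a) c Y)))) :
    ∀ᶠ s in nhdsWithin (0 : ℝ) {0}ᶜ, ∀ Z,
      IsTurningPoint (1 / q) q (k + a * exp (-N * s)) c (ℓ * exp s) Z →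
        0 < s * (Y * exp (η * s) - Z) := by
  have hY1 := hY.1
  have hY0 : 0 < Y := by linarith
  have hq0 : 0 < q := by linarith
  have hP := launchEnergy_pos hY1 hc.le hY.2.1
  have hA : 0 < k + a := by linarith
  have dX := hasDerivAt_mul_exp Y (-η)
  have db := (hasDerivAt_mul_exp a N).const_add k
  have hb0 : k + a * exp (N * 0) = k + a := by simp
  have dH := (((dX.pow 2).const_mul c)).div db (by rw [hb0]; exact hA.ne')
  have dR := ((db.const_mul (2 * q)).sqrt (by rw [hb0]; positivity)).mul
    (hasDerivAt_mul_exp ℓ (-1))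
  have key := eventually_turningPoint_compare (κ := 1 / q) (q := q)
    (b := fun s => k + a * exp (N * s)) (c := fun _ => c)
    (ℓ := fun s => ℓ * exp (-1 * s)) (X := fun s => Y * exp (-η * s)) (by positivity)
    (by fun_prop) continuousAt_const hc (by simpa using hY) dX dH dR ?_ ?_
  · have hneg : Tendsto (fun s : ℝ => -s) (nhdsWithin (0 : ℝ) {0}ᶜ) (nhdsWithin (0 : ℝ) {0}ᶜ) := by
      rw [tendsto_nhdsWithin_iff]
      constructor
      · have : Tendsto (fun s : ℝ => -s) (nhds 0) (nhds (-0)) := continuous_neg.tendsto 0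
        rw [neg_zero] at this
        exact this.mono_left nhdsWithin_le_nhds
      · filter_upwards [self_mem_nhdsWithin] with s hs
        simpa using hs
    filter_upwards [hneg.eventually key] with s hs Z hZ
    have := hs Z (by simpa using hZ)
    simp only [neg_mul_neg] at this
    linarith
  · simp only [Pi.pow_apply, mul_zero, exp_zero, mul_one]
    have : (c * (((2 : ℕ) : ℝ) * Y ^ (2 - 1) * (Y * -η)) * (k + a) - c * Y ^ 2 * (a * N))
        / (k + a) ^ 2 = -((c * (2 * Y ^ 2 * η) * (k + a) + c * Y ^ 2 * (a * N)) / (k + a) ^ 2) := by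
      push_cast; ring
    rw [this]
    have : 0 < (c * (2 * Y ^ 2 * η) * (k + a) + c * Y ^ 2 * (a * N)) / (k + a) ^ 2 := by positivity
    linarith
  · simp only [mul_zero, exp_zero, mul_one]
    rw [inv_sqrt_div_eq hq0 hA hℓ hP]
    have hS : 0 < √(2 * q * (k + a)) := by positivity
    have hS2 : √(2 * q * (k + a)) ^ 2 = 2 * q * (k + a) := sq_sqrt (by positivity)
    have hR : 0 < √(2 * q * (k + a)) * ℓ := by positivity
    have := mul_lt_mul_of_pos_right h2 hR
    have e : 2 * q * (a * N) / (2 * √(2 * q * (k + a))) * ℓ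
        = N * a / (2 * (k + a)) * (√(2 * q * (k + a)) * ℓ) := by
      field_simp
      rw [hS2]
    rw [e]
    calc _ = -(η * (1 / 2 + 1 / q + 1 / (ℓ * √(2 * q * launchEnergy (k + a) c Y)))
          * (√(2 * q * (k + a)) * ℓ)) := by
          generalize √(2 * q * (k + a)) * ℓ = R
          generalize 1 / (ℓ * √(2 * q * launchEnergy (k + a) c Y)) = y
          field_simp
          ring
      _ < _ := by linarith

lemma hasDerivAt_launchEnergy {b c X : ℝ → ℝ} {b' c' X' : ℝ} (hb : HasDerivAt b b' 0)
    (hc : HasDerivAt c c' 0) (hX : HasDerivAt X X' 0) (h0 : 0 < X 0) :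
    HasDerivAt (fun s => launchEnergy (b s) (c s) (X s))
      (b' * (1 - 1 / X 0) - c' * (X 0 - 1) + X' / X 0 * (b 0 / X 0 - c 0 * X 0)) 0 := by
  have := (hX.sub_const 1).mul ((hb.div hX h0.ne').sub hc)
  refine HasDerivAt.congr_deriv this ?_
  simp only [Pi.sub_apply, Pi.div_apply]
  field_simp
  ring

lemma eventually_energy_gap {q N α β a ℓ X Y : ℝ} (hq : 2 < q) (hq6 : q ≤ 6)
    (hN : N * (q - 2) = 4 * q) (hα : 0 < α) (hα2 : α < 2) (hαβ : α < β)
    (ha : 3 / 2 * α ^ 2 < a) (hℓ : 0 < ℓ)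
    (hX : IsTurningPoint (-(1 / q)) q ((2 + β) ^ 2) (α ^ 2 + a) ℓ X)
    (hY : IsTurningPoint (1 / q) q ((2 - α) ^ 2 + a) (β ^ 2) ℓ Y)
    (hP : launchEnergy ((2 + β) ^ 2) (α ^ 2 + a) X = launchEnergy ((2 - α) ^ 2 + a) (β ^ 2) Y) :
    ∀ᶠ s in nhdsWithin (0 : ℝ) {0}ᶜ, ∀ Z W,
      IsTurningPoint (-(1 / q)) q ((2 + β) ^ 2) (α ^ 2 + a * exp (-N * s)) (ℓ * exp s) Z →
      IsTurningPoint (1 / q) q ((2 - α) ^ 2 + a * exp (-N * s)) (β ^ 2) (ℓ * exp s) W →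
      0 < s * (launchEnergy ((2 + β) ^ 2) (α ^ 2 + a * exp (-N * s)) Z
        - launchEnergy ((2 - α) ^ 2 + a * exp (-N * s)) (β ^ 2) W) := by
  have hX1 := hX.1
  have hY1 := hY.1
  have hX0 : 0 < X := by linarith
  have hY0 : 0 < Y := by linarith
  have hq0 : 0 < q := by linarith
  have hβ : 0 < β := by linarith
  have hN0 : 0 < N := by nlinarith
  have ha0 : 0 < a := by nlinarith [sq_nonneg α]
  have hPX := launchEnergy_pos hX1 (by positivity) hX.2.1
  obtain ⟨η₁, η₂, k1, k2, k3, k4, k5⟩ := exists_test_speeds hq hq6 hN hα hα2 hαβ ha hX1 hY1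
    hX.2.1 hY.2.1 (y := 1 / (ℓ * √(2 * q * launchEnergy ((2 + β) ^ 2) (α ^ 2 + a) X)))
    (by positivity) hP
  have e1 := eventually_slow_test_curve hq (by positivity) (by positivity) ha0 hℓ hX k1 k2
  rw [hP] at k4
  have e2 := eventually_fast_test_curve hq (by positivity) (by positivity) ha0 hN0 hℓ hY k3 k4
  have dX := hasDerivAt_mul_exp X η₁
  have dY := hasDerivAt_mul_exp Y η₂
  have dc := (hasDerivAt_mul_exp a (-N)).const_add (α ^ 2)
  have db := (hasDerivAt_mul_exp a (-N)).const_add ((2 - α) ^ 2)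
  have dP := (hasDerivAt_launchEnergy (hasDerivAt_const (0 : ℝ) ((2 + β) ^ 2)) dc dX
    (by simpa using hX0)).sub
    (hasDerivAt_launchEnergy db (hasDerivAt_const (0 : ℝ) (β ^ 2)) dY (by simpa using hY0))
  have e3 := eventually_mul_pos_of_hasDerivAt dP (by simp [hP]) (by
    simp only [mul_zero, exp_zero, mul_one]
    rw [mul_div_cancel_left₀ _ hX0.ne', mul_div_cancel_left₀ _ hY0.ne']
    refine lt_of_lt_of_eq k5 ?_
    ring)
  have e4 : ∀ᶠ s in nhds (0 : ℝ), (α ^ 2 + a * exp (-N * s)) * (X * exp (η₁ * s)) ^ 2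
      < (2 + β) ^ 2 :=
    ContinuousAt.eventually_lt (by fun_prop) continuousAt_const (by simpa using hX.2.1)
  have e5 : ∀ᶠ s in nhds (0 : ℝ), β ^ 2 * (Y * exp (η₂ * s)) ^ 2
      < (2 - α) ^ 2 + a * exp (-N * s) :=
    ContinuousAt.eventually_lt (by fun_prop) (by fun_prop) (by simpa using hY.2.1)
  filter_upwards [e1, e2, e3, nhdsWithin_le_nhds e4, nhdsWithin_le_nhds e5,
    self_mem_nhdsWithin] with s g1 g2 g3 g4 g5 g6 Z W hZ hW
  replace g1 := g1 Z hZ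
  replace g2 := g2 W hW
  have hZ1 := hZ.1
  have hW1 := hW.1
  simp only [Pi.sub_apply] at g3
  have hc : 0 ≤ α ^ 2 + a * exp (-N * s) := by positivity
  have hc' : 0 ≤ β ^ 2 := by positivity
  have hXs : 0 < X * exp (η₁ * s) := by positivity
  have hYs : 0 < Y * exp (η₂ * s) := by positivity
  rcases lt_or_gt_of_ne (show s ≠ 0 from g6) with hs | hs
  · have i1 := neg_of_mul_pos_right g1 hs.le
    have i2 := neg_of_mul_pos_right g2 hs.le
    have i3 := neg_of_mul_pos_right g3 hs.le
    have l1 := launchEnergy_le hc (by linarith) (sub_neg.1 i1).le g4.le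
    have l2 := launchEnergy_le hc' hYs (sub_neg.1 i2).le hW.2.1.le
    exact mul_pos_of_neg_of_neg hs (by linarith)
  · have i1 := pos_of_mul_pos_right g1 hs.le
    have i2 := pos_of_mul_pos_right g2 hs.le
    have i3 := pos_of_mul_pos_right g3 hs.le
    have l1 := launchEnergy_le hc hXs (sub_pos.1 i1).le hZ.2.1.le
    have l2 := launchEnergy_le hc' (by linarith) (sub_pos.1 i2).le g5.le
    exact mul_pos hs (by linarith)

/-- Two matched pairs of turning points on the curve `t ↦ (a e^{-N t}, ℓ e^t)` coincide. -/
theorem not_exists_two_matched {q N α β a ℓ T X₁ Y₁ X₂ Y₂ : ℝ} (hq : 2 < q) (hq6 : q ≤ 6)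
    (hN : N * (q - 2) = 4 * q) (hα : 0 < α) (hα2 : α < 2) (hαβ : α < β) (hℓ : 0 < ℓ) (hT : 0 < T)
    (ha : 3 / 2 * α ^ 2 < a * exp (-N * T))
    (hX₁ : IsTurningPoint (-(1 / q)) q ((2 + β) ^ 2) (α ^ 2 + a) ℓ X₁)
    (hY₁ : IsTurningPoint (1 / q) q ((2 - α) ^ 2 + a) (β ^ 2) ℓ Y₁)
    (hP₁ : launchEnergy ((2 + β) ^ 2) (α ^ 2 + a) X₁
      = launchEnergy ((2 - α) ^ 2 + a) (β ^ 2) Y₁)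
    (hX₂ : IsTurningPoint (-(1 / q)) q ((2 + β) ^ 2) (α ^ 2 + a * exp (-N * T)) (ℓ * exp T) X₂)
    (hY₂ : IsTurningPoint (1 / q) q ((2 - α) ^ 2 + a * exp (-N * T)) (β ^ 2) (ℓ * exp T) Y₂)
    (hP₂ : launchEnergy ((2 + β) ^ 2) (α ^ 2 + a * exp (-N * T)) X₂
      = launchEnergy ((2 - α) ^ 2 + a * exp (-N * T)) (β ^ 2) Y₂) : False := by
  have hq0 : 0 < q := by linarith
  have hβ : 0 < β := by linarith
  have hN0 : 0 < N := by nlinarith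
  have hiq : 1 / q < 1 / 2 := one_div_lt_one_div_of_lt two_pos hq
  have hiq0 : 0 < 1 / q := by positivity
  have haT : 0 < a * exp (-N * T) := by nlinarith [sq_nonneg α]
  have ha0 : 0 < a := by
    by_contra! h
    nlinarith [exp_pos (-N * T)]
  have hdec : ∀ t ∈ Set.Icc 0 T, a * exp (-N * T) ≤ a * exp (-N * t) ∧ a * exp (-N * t) ≤ a := by
    intro t ht
    constructor
    · gcongr a * exp ?_
      nlinarith [ht.2]
    · have : exp (-N * t) ≤ 1 := by
        rw [exp_le_one_iff]; nlinarith [ht.1]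
      nlinarith
  have hbc₁ : α ^ 2 + a < (2 + β) ^ 2 := by
    have := hX₁.1
    have := hX₁.2.1
    have : (α ^ 2 + a) * 1 ≤ (α ^ 2 + a) * X₁ ^ 2 :=
      mul_le_mul_of_nonneg_left (by nlinarith) (by positivity)
    linarith
  have hbc₂ : β ^ 2 < (2 - α) ^ 2 + a * exp (-N * T) := by
    have := hY₂.1
    have := hY₂.2.1
    have : β ^ 2 * 1 ≤ β ^ 2 * Y₂ ^ 2 :=
      mul_le_mul_of_nonneg_left (by nlinarith) (by positivity)
    linarith
  have exX : ∀ t : ℝ, ∃ Z, t ∈ Set.Icc 0 T → IsTurningPoint (-(1 / q)) q ((2 + β) ^ 2)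
      (α ^ 2 + a * exp (-N * t)) (ℓ * exp t) Z := by
    intro t
    by_cases ht : t ∈ Set.Icc 0 T
    · obtain ⟨Z, hZ⟩ := exists_isTurningPoint (κ := -(1 / q)) (q := q) (b := (2 + β) ^ 2)
        (c := α ^ 2 + a * exp (-N * t)) (ℓ := ℓ * exp t) (by linarith) (by linarith) hq0
        (by positivity) (by linarith [(hdec t ht).2]) (by positivity)
      exact ⟨Z, fun _ => hZ⟩
    · exact ⟨0, fun h => absurd h ht⟩
  have exY : ∀ t : ℝ, ∃ Z, t ∈ Set.Icc 0 T → IsTurningPoint (1 / q) q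
      ((2 - α) ^ 2 + a * exp (-N * t)) (β ^ 2) (ℓ * exp t) Z := by
    intro t
    by_cases ht : t ∈ Set.Icc 0 T
    · obtain ⟨Z, hZ⟩ := exists_isTurningPoint (κ := 1 / q) (q := q)
        (b := (2 - α) ^ 2 + a * exp (-N * t)) (c := β ^ 2) (ℓ := ℓ * exp t)
        (by linarith) (by linarith) hq0
        (by positivity) (by linarith [(hdec t ht).1]) (by positivity)
      exact ⟨Z, fun _ => hZ⟩
    · exact ⟨0, fun h => absurd h ht⟩
  choose X hX using exX
  choose Y hY using exY
  have cX := continuousOn_turningPoint (by linarith) continuous_const (by fun_prop) (by fun_prop)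
    (fun t _ => by positivity) hX
  have cY := continuousOn_turningPoint (by linarith) (by fun_prop) continuous_const (by fun_prop)
    (fun t _ => by positivity) hY
  let G : ℝ → ℝ := fun t => launchEnergy ((2 + β) ^ 2) (α ^ 2 + a * exp (-N * t)) (X t)
    - launchEnergy ((2 - α) ^ 2 + a * exp (-N * t)) (β ^ 2) (Y t)
  have cG : ContinuousOn G (Set.Icc 0 T) := by
    have hX0 : ∀ t ∈ Set.Icc 0 T, X t ≠ 0 := fun t ht => by linarith [(hX t ht).1]
    have hY0 : ∀ t ∈ Set.Icc 0 T, Y t ≠ 0 := fun t ht => by linarith [(hY t ht).1]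
    have c1 : ContinuousOn (fun t => α ^ 2 + a * exp (-N * t)) (Set.Icc 0 T) := by fun_prop
    have c2 : ContinuousOn (fun t => (2 - α) ^ 2 + a * exp (-N * t)) (Set.Icc 0 T) := by fun_prop
    exact ((cX.sub continuousOn_const).mul ((continuousOn_const.div cX hX0).sub c1)).sub
      ((cY.sub continuousOn_const).mul ((c2.div cY hY0).sub continuousOn_const))
  have m0 : (0 : ℝ) ∈ Set.Icc 0 T := ⟨le_rfl, hT.le⟩
  have mT : T ∈ Set.Icc 0 T := ⟨hT.le, le_rfl⟩
  have G0 : G 0 = 0 := by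
    have a1 := hX 0 m0
    have a2 := hY 0 m0
    simp only [mul_zero, exp_zero, mul_one] at a1 a2
    simp only [G, mul_zero, exp_zero, mul_one]
    rw [a1.unique hX₁ (by linarith) (by positivity) (by positivity),
      a2.unique hY₁ (by linarith) (by positivity) (by positivity), hP₁, sub_self]
  have GT : G T = 0 := by
    simp only [G]
    rw [(hX T mT).unique hX₂ (by linarith) (by positivity) (by positivity),
      (hY T mT).unique hY₂ (by linarith) (by positivity) (by positivity), hP₂, sub_self]
  have hgap : ∀ t ∈ Set.Icc 0 T, G t = 0 → ∀ᶠ s in nhdsWithin t {t}ᶜ, s ∈ Set.Icc 0 T →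
      0 < (s - t) * G s := by
    intro t ht hGt
    have key := eventually_energy_gap hq hq6 hN hα hα2 hαβ (ha.trans_le (hdec t ht).1)
      (by positivity) (hX t ht) (hY t ht) (sub_eq_zero.1 hGt)
    have hten : Tendsto (fun s => s - t) (nhdsWithin t {t}ᶜ) (nhdsWithin 0 {0}ᶜ) := by
      rw [tendsto_nhdsWithin_iff]
      constructor
      · have : Tendsto (fun s : ℝ => s - t) (nhds t) (nhds (t - t)) :=
          (continuous_id.sub continuous_const).tendsto t
        rw [sub_self] at this
        exact this.mono_left nhdsWithin_le_nhds
      · filter_upwards [self_mem_nhdsWithin] with s hs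
        exact sub_ne_zero.2 hs
    filter_upwards [hten.eventually key] with s hs hsI
    have ea : a * exp (-N * t) * exp (-N * (s - t)) = a * exp (-N * s) := by
      rw [mul_assoc, ← exp_add]; ring_nf
    have eℓ : ℓ * exp t * exp (s - t) = ℓ * exp s := by
      rw [mul_assoc, ← exp_add]; ring_nf
    rw [ea, eℓ] at hs
    exact hs (X s) (Y s) (hX s hsI) (hY s hsI)
  refine false_of_upcrossing hT cG GT ?_ ?_
  · have := (nhdsWithin_mono 0 (show Set.Ioi (0 : ℝ) ⊆ {0}ᶜ from fun x hx => ne_of_gt hx))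
      (hgap 0 m0 G0)
    filter_upwards [this, self_mem_nhdsWithin, nhdsWithin_le_nhds (gt_mem_nhds hT)] with s a1 a2 a3
    have a2 : 0 < s := a2
    have a1 := a1 ⟨a2.le, a3.le⟩
    rw [sub_zero] at a1
    exact pos_of_mul_pos_right a1 a2.le
  · intro x hx hGx
    have := (nhdsWithin_mono x (show Set.Iio x ⊆ {x}ᶜ from fun y hy => ne_of_lt hy))
      (hgap x ⟨hx.1.le, hx.2⟩ hGx)
    filter_upwards [this, self_mem_nhdsWithin, nhdsWithin_le_nhds (lt_mem_nhds hx.1)]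
      with s a1 a2 a3
    have a2 : s < x := a2
    have a1 := a1 ⟨a3.le, a2.le.trans hx.2⟩
    exact neg_of_mul_pos_right a1 (by linarith)

lemma isTurningPoint_of_speed {κ q b c₀ c L X : ℝ} {U : ℝ → ℝ} (hq : 0 < q) (hb : 0 < b)
    (hc₀ : 0 ≤ c₀) (hc : 0 < c) (hL : 0 < L) (hX1 : 1 < X) (hX : c₀ * X ^ 2 < b)
    (hU : ContinuousOn U (Set.Icc 0 L)) (hU0 : U 0 = 1) (hUL : U L = X)
    (hpos : ∀ x ∈ Set.Icc 0 L, 0 < U x) (hlt : ∀ x ∈ Set.Ioo 0 L, U x < X)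
    (hder : ∀ x ∈ Set.Ioo 0 L, HasDerivAt U (√(2 * q * c) * U x ^ (1 - κ) *
      √((X - U x) * (b / (X * U x) - c₀))) x) :
    IsTurningPoint κ q b c₀ (√c * L) X := by
  have hX0 : 0 < X := by linarith
  set h := c₀ * X ^ 2 / b with hh
  have hh0 : 0 ≤ h := by positivity
  have hh1 : h < 1 := by rw [hh, div_lt_one hb]; exact hX
  set K := 1 / 2 * (√(2 * q * c) * √b) * X ^ (-(κ + 1 / 2)) with hK
  let w : ℝ → ℝ := fun x => √(1 - U x / X)
  have hw1 : ∀ x ∈ Set.Icc 0 L, |w x| < 1 := by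
    intro x hx
    simp only [w]
    rw [abs_of_nonneg (sqrt_nonneg _), sqrt_lt' one_pos]
    have : 0 < U x / X := div_pos (hpos x hx) hX0
    linarith
  let Φ : ℝ → ℝ := fun x => (∫ z in (0 : ℝ)..w x, travelIntegrand κ h z) + K * x
  have hΦc : ContinuousOn Φ (Set.Icc 0 L) := by
    have hwc : ContinuousOn w (Set.Icc 0 L) :=
      (continuousOn_const.sub (hU.div_const X)).sqrt
    refine ContinuousOn.add ?_ (by fun_prop)
    intro x hx
    exact (hasDerivAt_integral_travelIntegrand hh1 (hw1 x hx)).continuousAt.comp_continuousWithinAt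
      (hwc x hx)
  have hΦd : ∀ x ∈ Set.Ioo 0 L, HasDerivAt Φ 0 x := by
    intro x hx
    have hxI := Set.Ioo_subset_Icc_self hx
    have u0 := hpos x hxI
    have uX := hlt x hx
    have hdw : 0 < 1 - U x / X := by
      have : U x / X < 1 := by rw [div_lt_one hX0]; exact uX
      linarith
    have d1 := (((hder x hx).div_const X).const_sub 1).sqrt hdw.ne'
    have d2 := (hasDerivAt_integral_travelIntegrand (κ := κ) hh1 (hw1 x hxI)).comp x d1
    have d3 := d2.add ((hasDerivAt_id x).const_mul K)
    refine HasDerivAt.congr_deriv d3 ?_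
    have hr : 0 < 1 - h * (U x / X) := by
      have : h * (U x / X) ≤ h * 1 := by
        apply mul_le_mul_of_nonneg_left _ hh0; linarith
      linarith
    have e1 : travelIntegrand κ h (w x) = U x ^ (κ - 1 / 2) * X ^ (-(κ - 1 / 2))
        / √(1 - h * (U x / X)) := by
      unfold travelIntegrand
      have : w x ^ 2 = 1 - U x / X := sq_sqrt hdw.le
      rw [this, sub_sub_cancel, div_rpow u0.le hX0.le, rpow_neg hX0.le, rpow_neg hr.le,
        ← sqrt_eq_rpow]
      field_simp
    have e2 : √((X - U x) * (b / (X * U x) - c₀)) =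
        √(1 - U x / X) * (√b * U x ^ (-(1 / 2) : ℝ)) * √(1 - h * (U x / X)) := by
      have : (X - U x) * (b / (X * U x) - c₀) =
          (1 - U x / X) * (b * (U x)⁻¹) * (1 - h * (U x / X)) := by
        rw [hh]; field_simp
      rw [this, sqrt_mul (by positivity), sqrt_mul hdw.le, sqrt_mul hb.le, rpow_neg u0.le,
        ← sqrt_eq_rpow, sqrt_inv]
    have e3 : U x ^ (κ - 1 / 2) * (U x ^ (1 - κ) * U x ^ (-(1 / 2) : ℝ)) = 1 := by
      rw [← rpow_add u0, ← rpow_add u0]; ring_nf; simp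
    have e4 : X ^ (-(κ - 1 / 2)) = X ^ (-(κ + 1 / 2)) * X := by
      rw [← rpow_add_one hX0.ne']; congr 1; ring
    have hs1 := sqrt_pos.2 hdw
    have hs2 := sqrt_pos.2 hr
    rw [e1, e2, e4, hK]
    generalize √(1 - U x / X) = s1 at *
    generalize √(1 - h * (U x / X)) = s2 at *
    have : U x ^ (κ - 1 / 2) * (X ^ (-(κ + 1 / 2)) * X) / s2 *
        (-(√(2 * q * c) * U x ^ (1 - κ) * (s1 * (√b * U x ^ (-(1 / 2) : ℝ)) * s2) / X) / (2 * s1))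
        = -(1 / 2 * (√(2 * q * c) * √b) * X ^ (-(κ + 1 / 2))) *
          (U x ^ (κ - 1 / 2) * (U x ^ (1 - κ) * U x ^ (-(1 / 2) : ℝ))) := by
      field_simp
    rw [this, e3]
    ring
  obtain ⟨ξ, hξ, hξ'⟩ := exists_hasDerivAt_eq_slope Φ (fun _ => 0) hL hΦc hΦd
  have hΦ : Φ L = Φ 0 := by
    have : Φ L - Φ 0 = 0 := by
      rw [sub_zero, eq_comm, div_eq_zero_iff] at hξ'
      exact hξ'.resolve_right hL.ne'
    linarith
  simp only [Φ, w, hU0, hUL, div_self hX0.ne', sub_self, sqrt_zero,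
    intervalIntegral.integral_same, mul_zero, add_zero, zero_add] at hΦ
  refine ⟨hX1, hX, ?_⟩
  unfold travelTime
  rw [← hΦ, hK, rpow_neg hX0.le]
  have hXp : 0 < X ^ (κ + 1 / 2) := by positivity
  have e : √(2 * q * c) * √b = √(2 * q * b) * √c := by
    rw [← sqrt_mul (by positivity), ← sqrt_mul (by positivity)]; congr 1; ring
  rw [e]
  field_simp

/-- A solution on half a period of constancy of the coefficients, released at rest at `L`. -/
structure HalfSolution (q c A B L : ℝ) (f v : ℝ → ℝ) : Prop where
  pos : ∀ x ∈ Set.Icc 0 L, 0 < f x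
  hasDeriv : ∀ x ∈ Set.Icc 0 L, HasDerivWithinAt f (v x) (Set.Icc 0 L) x
  hasDeriv_speed : ∀ x ∈ Set.Icc 0 L,
    HasDerivWithinAt v (c * (B * f x ^ (q - 1) - A * f x ^ (-q - 1))) (Set.Icc 0 L) x
  initial_eq : f 0 = 1
  rest : v L = 0

namespace HalfSolution

variable {q c A B L : ℝ} {f v : ℝ → ℝ}

lemma continuousOn (h : HalfSolution q c A B L f v) : ContinuousOn f (Set.Icc 0 L) :=
  fun x hx => (h.hasDeriv x hx).continuousWithinAt

lemma continuousOn_speed (h : HalfSolution q c A B L f v) : ContinuousOn v (Set.Icc 0 L) :=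
  fun x hx => (h.hasDeriv_speed x hx).continuousWithinAt

lemma force_eq (u : ℝ) (hu : 0 < u) :
    B * u ^ (q - 1) - A * u ^ (-q - 1) = u ^ (-q - 1) * (B * u ^ (2 * q) - A) := by
  have : u ^ (q - 1) = u ^ (-q - 1) * u ^ (2 * q) := by
    rw [← rpow_add hu]; congr 1; ring
  rw [this]; ring

/-- The displacement from the equilibrium keeps its sign and shrinks until the rest point. -/
lemma displacement (h : HalfSolution q c A B L f v) (hq : 0 < q) (hc : 0 < c) (hA : 0 < A)
    (hB : 0 < B) (hL : 0 < L) :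
    ∃ e : ℝ, 0 < e ∧ B * e ^ (2 * q) = A ∧ (f 0 = e → v 0 = 0) ∧
      (f 0 ≠ e → (∀ x ∈ Set.Icc 0 L, 0 < (f 0 - e) * (f x - e)) ∧
        ∀ x ∈ Set.Ico 0 L, (f 0 - e) * v x < 0) := by
  set e := (A / B) ^ (1 / (2 * q)) with he
  have he0 : 0 < e := by positivity
  have heq : B * e ^ (2 * q) = A := by
    rw [he, ← rpow_mul (by positivity)]
    have : 1 / (2 * q) * (2 * q) = 1 := by field_simp
    rw [this, rpow_one]; field_simp
  let F : ℝ → ℝ := fun u => B * u ^ (q - 1) - A * u ^ (-q - 1)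
  have hFe : F e = 0 := by simp only [F]; rw [force_eq e he0, heq]; ring
  have hsign : ∀ u, 0 < u → u ≠ e → 0 < (u - e) * F u := by
    intro u hu hne
    simp only [F]
    rw [force_eq u hu, ← heq]
    have hp : 0 < u ^ (-q - 1) := by positivity
    rcases lt_or_gt_of_ne hne with hl | hg
    · have := rpow_lt_rpow hu.le hl (show 0 < 2 * q by linarith)
      refine mul_pos_of_neg_of_neg (by linarith) (mul_neg_of_pos_of_neg hp ?_)
      nlinarith
    · have := rpow_lt_rpow he0.le hg (show 0 < 2 * q by linarith)
      refine mul_pos (by linarith) (mul_pos hp ?_)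
      nlinarith
  have hsign' : ∀ u, 0 < u → 0 ≤ (u - e) * F u := by
    intro u hu
    rcases eq_or_ne u e with rfl | hne
    · simp
    · exact (hsign u hu hne).le
  have m0 : (0 : ℝ) ∈ Set.Icc 0 L := ⟨le_rfl, hL.le⟩
  have mL : L ∈ Set.Icc 0 L := ⟨hL.le, le_rfl⟩
  have dg : ∀ x ∈ Set.Icc 0 L, HasDerivWithinAt (fun x => f x - e) (v x) (Set.Icc 0 L) x :=
    fun x hx => (h.hasDeriv x hx).sub_const e
  have cg := h.continuousOn.sub (continuousOn_const (c := e))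
  have dgv : ∀ x ∈ Set.Icc 0 L, HasDerivWithinAt (fun x => (f x - e) * v x)
      (v x * v x + (f x - e) * (c * F (f x))) (Set.Icc 0 L) x :=
    fun x hx => (dg x hx).mul (h.hasDeriv_speed x hx)
  have cgv : ContinuousOn (fun x => (f x - e) * v x) (Set.Icc 0 L) :=
    fun x hx => (dgv x hx).continuousWithinAt
  have hmono : MonotoneOn (fun x => (f x - e) * v x) (Set.Icc 0 L) := by
    refine monotoneOn_of_hasDerivWithinAt_nonneg (convex_Icc 0 L) cgv
      (fun x hx => (dgv x (interior_subset hx)).mono interior_subset) ?_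
    intro x hx
    have := hsign' (f x) (h.pos x (interior_subset hx))
    nlinarith [mul_nonneg hc.le this, mul_self_nonneg (v x)]
  have hle : ∀ x ∈ Set.Icc 0 L, (f x - e) * v x ≤ 0 := by
    intro x hx
    have := hmono hx mL hx.2
    simpa [h.rest] using this
  have dg2 : ∀ x ∈ Set.Icc 0 L, HasDerivWithinAt (fun x => (f x - e) ^ 2)
      (2 * ((f x - e) * v x)) (Set.Icc 0 L) x := by
    intro x hx
    refine ((dg x hx).pow 2).congr_deriv ?_
    push_cast; ring
  have hanti : AntitoneOn (fun x => (f x - e) ^ 2) (Set.Icc 0 L) := by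
    refine antitoneOn_of_hasDerivWithinAt_nonpos (convex_Icc 0 L)
      (fun x hx => (dg2 x hx).continuousWithinAt)
      (fun x hx => (dg2 x (interior_subset hx)).mono interior_subset) ?_
    intro x hx
    linarith [hle x (interior_subset hx)]
  refine ⟨e, he0, heq, ?_, ?_⟩
  · intro h0
    have hz : ∀ x ∈ Set.Icc 0 L, f x = e := by
      intro x hx
      have := hanti m0 hx hx.1
      simp only [h0, sub_self] at this
      nlinarith [sq_nonneg (f x - e)]
    have u1 := (h.hasDeriv 0 m0).congr (f₁ := fun _ => e) (fun x hx => (hz x hx).symm)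
      (hz 0 m0).symm
    exact (uniqueDiffOn_Icc hL 0 m0).eq_deriv _ u1 (hasDerivWithinAt_const _ _ _)
  · intro h0
    have hLne : f L ≠ e := by
      intro hfL
      have hFd : DifferentiableAt ℝ F e := by
        have d1 : HasDerivAt (fun u : ℝ => u ^ (q - 1)) _ e :=
          hasDerivAt_rpow_const (Or.inl he0.ne')
        have d2 : HasDerivAt (fun u : ℝ => u ^ (-q - 1)) _ e :=
          hasDerivAt_rpow_const (Or.inl he0.ne')
        exact ((d1.const_mul B).sub (d2.const_mul A)).differentiableAt
      have hFc : ContinuousOn F (Set.Ioi 0) := by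
        intro u hu
        have hu : 0 < u := hu
        refine ContinuousAt.continuousWithinAt ?_
        exact (continuousAt_const.mul (continuousAt_rpow_const _ _ (Or.inl hu.ne'))).sub
          (continuousAt_const.mul (continuousAt_rpow_const _ _ (Or.inl hu.ne')))
      have hds := (continuousOn_dslope (Ioi_mem_nhds he0)).2 ⟨hFc, hFd⟩
      obtain ⟨K, hK⟩ := isCompact_Icc.exists_bound_of_continuousOn
        (hds.comp h.continuousOn (fun x hx => h.pos x hx))
      have hFK : ∀ x ∈ Set.Icc 0 L, |F (f x)| ≤ K * |f x - e| := by
        intro x hx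
        have := sub_smul_dslope F e (f x)
        rw [hFe, sub_zero, smul_eq_mul] at this
        rw [← this, abs_mul, mul_comm]
        exact mul_le_mul_of_nonneg_right (hK x hx) (abs_nonneg _)
      have hK0 : 0 ≤ K := (norm_nonneg _).trans (hK 0 m0)
      have dH : ∀ x ∈ Set.Icc 0 L, HasDerivWithinAt
          (fun x => ((f x - e) ^ 2 + v x ^ 2) * exp ((1 + c * K) * x))
          ((2 * ((f x - e) * v x) + 2 * v x * (c * F (f x))) * exp ((1 + c * K) * x)
            + ((f x - e) ^ 2 + v x ^ 2) * (exp ((1 + c * K) * x) * (1 + c * K)))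
          (Set.Icc 0 L) x := by
        intro x hx
        have d1 := (h.hasDeriv_speed x hx).pow 2
        have d2 := (((hasDerivAt_id x).const_mul (1 + c * K)).exp).hasDerivWithinAt
          (s := Set.Icc 0 L)
        refine (((dg2 x hx).add d1).mul d2).congr_deriv ?_
        simp [F]
      have hm : MonotoneOn (fun x => ((f x - e) ^ 2 + v x ^ 2) * exp ((1 + c * K) * x))
          (Set.Icc 0 L) := by
        refine monotoneOn_of_hasDerivWithinAt_nonneg (convex_Icc 0 L)
          (fun x hx => (dH x hx).continuousWithinAt)
          (fun x hx => (dH x (interior_subset hx)).mono interior_subset) ?_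
        intro x hx
        have hx := interior_subset hx
        have b1 : 0 ≤ (f x - e + v x) ^ 2 := sq_nonneg _
        have b2 : |v x * F (f x)| ≤ K * ((f x - e) ^ 2 + v x ^ 2) / 2 := by
          rw [abs_mul]
          have c1 := mul_le_mul_of_nonneg_left (hFK x hx) (abs_nonneg (v x))
          have c2 : 0 ≤ K * (|v x| - |f x - e|) ^ 2 := by positivity
          rw [← sq_abs (f x - e), ← sq_abs (v x)]
          nlinarith
        have b3 := (abs_le.1 b2).1
        have b4 := mul_le_mul_of_nonneg_left b3 hc.le
        have b5 : 0 ≤ 2 * ((f x - e) * v x) + 2 * v x * (c * F (f x))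
            + ((f x - e) ^ 2 + v x ^ 2) * (1 + c * K) := by nlinarith
        have := mul_nonneg b5 (exp_pos ((1 + c * K) * x)).le
        linarith
      have := hm m0 mL hL.le
      simp only [hfL, h.rest, sub_self, mul_zero, exp_zero, mul_one] at this
      have h1 : 0 < (f 0 - e) ^ 2 := by
        have := sub_ne_zero.2 h0
        positivity
      nlinarith [sq_nonneg (v 0)]
    have hne : ∀ x ∈ Set.Icc 0 L, f x - e ≠ 0 := by
      intro x hx hz
      have := hanti hx mL hx.2
      simp only [hz] at this
      have h1 : 0 < (f L - e) ^ 2 := by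
        have := sub_ne_zero.2 hLne
        positivity
      linarith
    have hsame : ∀ x ∈ Set.Icc 0 L, 0 < (f 0 - e) * (f x - e) := by
      intro x hx
      by_contra! hcon
      have cgx : ContinuousOn (fun y => (f 0 - e) * (f y - e)) (Set.Icc 0 x) :=
        (continuousOn_const.mul cg).mono (Set.Icc_subset_Icc_right hx.2)
      have h1 : 0 ≤ (f 0 - e) * (f 0 - e) := mul_self_nonneg _
      obtain ⟨y, hy, hy'⟩ := intermediate_value_Icc' hx.1 cgx ⟨hcon, h1⟩
      exact (mul_ne_zero (sub_ne_zero.2 h0) (hne y ⟨hy.1, hy.2.trans hx.2⟩)) hy'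
    refine ⟨hsame, ?_⟩
    have hstrict : StrictMonoOn (fun x => (f x - e) * v x) (Set.Icc 0 L) := by
      refine strictMonoOn_of_hasDerivWithinAt_pos (convex_Icc 0 L) cgv
        (fun x hx => (dgv x (interior_subset hx)).mono interior_subset) ?_
      intro x hx
      have hx := interior_subset hx
      have := hsign (f x) (h.pos x hx) (sub_ne_zero.1 (hne x hx))
      nlinarith [mul_pos hc this, mul_self_nonneg (v x)]
    intro x hx
    have hxI : x ∈ Set.Icc 0 L := ⟨hx.1, hx.2.le⟩
    have k1 := hstrict hxI mL hx.2
    simp only [h.rest, mul_zero] at k1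
    have k2 := hsame x hxI
    have k3 : (f 0 - e) * v x * (f x - e) ^ 2 < 0 := by
      have : (f 0 - e) * v x * (f x - e) ^ 2 = ((f 0 - e) * (f x - e)) * ((f x - e) * v x) := by
        ring
      rw [this]
      exact mul_neg_of_pos_of_neg k2 k1
    by_contra! k4
    nlinarith [mul_nonneg k4 (sq_nonneg (f x - e))]

end HalfSolution

namespace HalfSolution

variable {q c A B L : ℝ} {f v : ℝ → ℝ}

lemma speed_zero_of_eq (h : HalfSolution q c A B L f v) (hq : 0 < q) (hc : 0 < c) (hA : 0 < A)
    (hB : 0 < B) (hL : 0 < L) (hAB : A = B) : v 0 = 0 := by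
  obtain ⟨e, he, heq, h0, -⟩ := h.displacement hq hc hA hB hL
  refine h0 ?_
  rw [h.initial_eq]
  by_contra hne
  have h1 : e ^ (2 * q) = 1 := by
    rw [hAB] at heq
    exact mul_left_cancel₀ hB.ne' (by rw [heq, mul_one])
  rcases lt_or_gt_of_ne hne with hl | hl
  · linarith [one_lt_rpow hl (show 0 < 2 * q by linarith)]
  · linarith [rpow_lt_one he.le hl (show 0 < 2 * q by linarith)]

lemma of_lt (h : HalfSolution q c A B L f v) (hq : 0 < q) (hc : 0 < c) (hA : 0 < A)
    (hB : 0 < B) (hL : 0 < L) (hAB : A < B) :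
    (∀ x ∈ Set.Icc 0 L, A < B * f x ^ (2 * q)) ∧ ∀ x ∈ Set.Ico 0 L, v x < 0 := by
  obtain ⟨e, he, heq, -, h1⟩ := h.displacement hq hc hA hB hL
  have hq2 : 0 < 2 * q := by linarith
  have he1 : e < 1 := by
    by_contra! hcon
    nlinarith [one_le_rpow hcon hq2.le]
  rw [h.initial_eq] at h1
  obtain ⟨h2, h3⟩ := h1 he1.ne'
  have he1 : 0 < 1 - e := by linarith
  refine ⟨fun x hx => ?_, fun x hx => ?_⟩
  · have h4 : e < f x := by linarith [(mul_pos_iff_of_pos_left he1).1 (h2 x hx)]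
    rw [← heq]
    exact mul_lt_mul_of_pos_left (rpow_lt_rpow he.le h4 hq2) hB
  · exact (pos_iff_neg_of_mul_neg (h3 x hx)).1 he1

lemma of_gt (h : HalfSolution q c A B L f v) (hq : 0 < q) (hc : 0 < c) (hA : 0 < A)
    (hB : 0 < B) (hL : 0 < L) (hAB : B < A) :
    (∀ x ∈ Set.Icc 0 L, B * f x ^ (2 * q) < A) ∧ ∀ x ∈ Set.Ico 0 L, 0 < v x := by
  obtain ⟨e, he, heq, -, h1⟩ := h.displacement hq hc hA hB hL
  have hq2 : 0 < 2 * q := by linarith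
  have he1 : 1 < e := by
    by_contra! hcon
    nlinarith [rpow_le_one he.le hcon hq2.le]
  rw [h.initial_eq] at h1
  obtain ⟨h2, h3⟩ := h1 he1.ne
  have he1 : 1 - e < 0 := by linarith
  refine ⟨fun x hx => ?_, fun x hx => ?_⟩
  · have h4 : f x < e := by linarith [(neg_iff_neg_of_mul_pos (h2 x hx)).1 he1]
    rw [← heq]
    exact mul_lt_mul_of_pos_left (rpow_lt_rpow (h.pos x hx).le h4 hq2) hB
  · exact (neg_iff_pos_of_mul_neg (h3 x hx)).1 he1

/-- Conservation of energy. -/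
lemma speed_sq (h : HalfSolution q c A B L f v) (hq : 0 < q) {x : ℝ} (hx : x ∈ Set.Icc 0 L) :
    v x ^ 2 = 2 * c / q * ((B * f x ^ q + A * f x ^ (-q)) - (B * f L ^ q + A * f L ^ (-q))) := by
  have d : ∀ y ∈ Set.Icc 0 L, HasDerivWithinAt
      (fun y => v y ^ 2 - 2 * c / q * (B * f y ^ q + A * f y ^ (-q))) 0 (Set.Icc 0 L) y := by
    intro y hy
    have hf := h.pos y hy
    have d1 := (h.hasDeriv y hy).rpow_const (p := q) (Or.inl hf.ne')
    have d2 := (h.hasDeriv y hy).rpow_const (p := -q) (Or.inl hf.ne')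
    refine (((h.hasDeriv_speed y hy).pow 2).sub
      (((d1.const_mul B).add (d2.const_mul A)).const_mul (2 * c / q))).congr_deriv ?_
    push_cast
    field_simp
    ring
  have hL : 0 ≤ L := hx.1.trans hx.2
  have key : ∀ y ∈ Set.Icc 0 L, v y ^ 2 - 2 * c / q * (B * f y ^ q + A * f y ^ (-q)) =
      v 0 ^ 2 - 2 * c / q * (B * f 0 ^ q + A * f 0 ^ (-q)) := by
    refine constant_of_has_deriv_right_zero (fun y hy => (d y hy).continuousWithinAt) ?_
    intro y hy
    exact (d y ⟨hy.1, hy.2.le⟩).mono_of_mem_nhdsWithin (Icc_mem_nhdsGE_of_mem hy)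
  have k1 := key x hx
  have k2 := key L ⟨hL, le_rfl⟩
  rw [← k2, h.rest] at k1
  linarith

/-- In the variable `f ^ (s q)`, which increases along the half solution, the half solution reaches
a turning point. -/
lemma isTurningPoint {s b c₀ : ℝ} (h : HalfSolution q c A B L f v) (hq : 0 < q) (hc : 0 < c)
    (hL : 0 < L) (hs : s ^ 2 = 1) (hb : 0 < b) (hc₀ : 0 < c₀)
    (hfun : ∀ u : ℝ, 0 < u → B * u ^ q + A * u ^ (-q) = b / u ^ (s * q) + c₀ * u ^ (s * q))
    (hv : ∀ x ∈ Set.Ico 0 L, 0 < s * v x) (hforce : c₀ * (f L ^ (s * q)) ^ 2 < b) :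
    IsTurningPoint (s / q) q b c₀ (√c * L) (f L ^ (s * q)) ∧
      v 0 ^ 2 = 2 * c / q * launchEnergy b c₀ (f L ^ (s * q)) := by
  have m0 : (0 : ℝ) ∈ Set.Icc 0 L := ⟨le_rfl, hL.le⟩
  have mL : L ∈ Set.Icc 0 L := ⟨hL.le, le_rfl⟩
  have hXp : 0 < f L ^ (s * q) := rpow_pos_of_pos (h.pos L mL) _
  have hE : ∀ x ∈ Set.Icc 0 L, v x ^ 2 = 2 * c / q *
      ((f L ^ (s * q) - f x ^ (s * q)) * (b / (f L ^ (s * q) * f x ^ (s * q)) - c₀)) := by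
    intro x hx
    have hU : 0 < f x ^ (s * q) := rpow_pos_of_pos (h.pos x hx) _
    rw [h.speed_sq hq hx, hfun _ (h.pos x hx), hfun _ (h.pos L mL)]
    congr 1
    field_simp
    ring
  have hd : ∀ x ∈ Set.Icc 0 L, HasDerivWithinAt (fun x => f x ^ (s * q))
      (q * f x ^ (s * q - 1) * (s * v x)) (Set.Icc 0 L) x := by
    intro x hx
    refine ((h.hasDeriv x hx).rpow_const (p := s * q) (Or.inl (h.pos x hx).ne')).congr_deriv ?_
    ring
  have hcont : ContinuousOn (fun x => f x ^ (s * q)) (Set.Icc 0 L) :=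
    fun x hx => (hd x hx).continuousWithinAt
  have hmono : StrictMonoOn (fun x => f x ^ (s * q)) (Set.Icc 0 L) := by
    refine strictMonoOn_of_hasDerivWithinAt_pos (convex_Icc 0 L) hcont
      (fun x hx => (hd x (interior_subset hx)).mono interior_subset) ?_
    intro x hx
    have h1 := rpow_pos_of_pos (h.pos x (interior_subset hx)) (s * q - 1)
    rw [interior_Icc] at hx
    have h2 := hv x ⟨hx.1.le, hx.2⟩
    positivity
  refine ⟨isTurningPoint_of_speed (U := fun x => f x ^ (s * q)) hq hb hc₀.le hc hL ?_ hforce hcont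
    ?_ rfl (fun x hx => rpow_pos_of_pos (h.pos x hx) _)
    (fun x hx => hmono ⟨hx.1.le, hx.2.le⟩ mL hx.2) ?_, ?_⟩
  · have := hmono m0 mL hL
    simpa [h.initial_eq] using this
  · simp [h.initial_eq]
  · intro x hx
    have hxI : x ∈ Set.Icc 0 L := ⟨hx.1.le, hx.2.le⟩
    have hf := h.pos x hxI
    refine ((hd x hxI).hasDerivAt (Icc_mem_nhds hx.1 hx.2)).congr_deriv ?_
    have e1 : (f x ^ (s * q)) ^ (1 - s / q) = f x ^ (s * q - 1) := by
      rw [← rpow_mul hf.le]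
      congr 1
      field_simp
      linarith
    have e2 : √(2 * q * c) * √((f L ^ (s * q) - f x ^ (s * q)) *
        (b / (f L ^ (s * q) * f x ^ (s * q)) - c₀)) = q * (s * v x) := by
      rw [← sqrt_mul (by positivity)]
      have hv' := hv x ⟨hx.1.le, hx.2⟩
      rw [sqrt_eq_iff_mul_self_eq_of_pos (by positivity)]
      have e3 : q * (s * v x) * (q * (s * v x)) = q ^ 2 * v x ^ 2 * s ^ 2 := by ring
      rw [e3, hs, hE x hxI]
      field_simp
    rw [e1]
    linear_combination -f x ^ (s * q - 1) * e2
  · rw [hE 0 m0, launchEnergy, h.initial_eq]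
    simp

lemma isTurningPoint_of_lt (h : HalfSolution q c A B L f v) (hq : 0 < q) (hc : 0 < c)
    (hA : 0 < A) (hB : 0 < B) (hL : 0 < L) (hAB : A < B) :
    IsTurningPoint (-(1 / q)) q B A (√c * L) (f L ^ (-q)) ∧
      v 0 ^ 2 = 2 * c / q * launchEnergy B A (f L ^ (-q)) := by
  obtain ⟨h1, h2⟩ := h.of_lt hq hc hA hB hL hAB
  have hfL := h.pos L ⟨hL.le, le_rfl⟩
  have := h.isTurningPoint (s := -1) (b := B) (c₀ := A) hq hc hL (by norm_num) hB hA ?_ ?_ ?_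
  · rwa [neg_one_mul, neg_div] at this
  · intro u hu
    rw [neg_one_mul, rpow_neg hu.le]
    have := rpow_pos_of_pos hu q
    field_simp
  · intro x hx
    linarith [h2 x hx]
  · rw [neg_one_mul, rpow_neg hfL.le]
    have h3 := h1 L ⟨hL.le, le_rfl⟩
    rw [mul_comm 2 q, rpow_mul hfL.le, rpow_two] at h3
    have := rpow_pos_of_pos hfL q
    rw [inv_pow, ← div_eq_mul_inv, div_lt_iff₀ (by positivity)]
    exact h3

lemma isTurningPoint_of_gt (h : HalfSolution q c A B L f v) (hq : 0 < q) (hc : 0 < c)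
    (hA : 0 < A) (hB : 0 < B) (hL : 0 < L) (hAB : B < A) :
    IsTurningPoint (1 / q) q A B (√c * L) (f L ^ q) ∧
      v 0 ^ 2 = 2 * c / q * launchEnergy A B (f L ^ q) := by
  obtain ⟨h1, h2⟩ := h.of_gt hq hc hA hB hL hAB
  have hfL := h.pos L ⟨hL.le, le_rfl⟩
  have := h.isTurningPoint (s := 1) (b := A) (c₀ := B) hq hc hL (by norm_num) hA hB ?_ ?_ ?_
  · rwa [one_mul] at this
  · intro u hu
    rw [one_mul, rpow_neg hu.le]
    have := rpow_pos_of_pos hu q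
    field_simp
    ring
  · intro x hx
    linarith [h2 x hx]
  · have h3 := h1 L ⟨hL.le, le_rfl⟩
    rwa [mul_comm 2 q, rpow_mul hfL.le, rpow_two, ← one_mul q] at h3

end HalfSolution

lemma force_lt_of_equal_speed {α β a p r : ℝ} (hα : 0 < α) (hα2 : α < 2) (hαβ : α < β) (ha0 : 0 ≤ a)
    (ha : a ≤ 3 / 2 * α ^ 2) (hAB : β ^ 2 < (2 - α) ^ 2 + a) (hp : 0 < p) (hr : 0 < r)
    (hE : (2 + β) ^ 2 * p + (α ^ 2 + a) / p - ((2 + β) ^ 2 + (α ^ 2 + a)) =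
      β ^ 2 * r + ((2 - α) ^ 2 + a) / r - (β ^ 2 + ((2 - α) ^ 2 + a)))
    (hφ : 0 < (2 + β) ^ 2 * p - (α ^ 2 + a) / p) :
    ((2 - α) ^ 2 + a) / r - β ^ 2 * r < (2 + β) ^ 2 * p - (α ^ 2 + a) / p := by
  have hβ : 0 < β := hα.trans hαβ
  obtain ⟨s, hs0, rfl⟩ : ∃ s : ℝ, 0 ≤ s ∧ s ^ 2 = a := ⟨√a, sqrt_nonneg a, sq_sqrt ha0⟩
  have hs : s ≤ 5 / 4 * α := by
    refine abs_le_of_sq_le_sq' ?_ (by linarith) |>.2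
    nlinarith [sq_nonneg α]
  set A := (2 - α) ^ 2 + s ^ 2 with hA
  obtain ⟨w, hw0, hw⟩ : ∃ w : ℝ, 0 ≤ w ∧ w ^ 2 = A := ⟨√A, sqrt_nonneg A, sq_sqrt (by positivity)⟩
  have hwβ : β < w := lt_of_pow_lt_pow_left₀ 2 hw0 (by rw [hw]; exact hAB)
  have hws : w ≤ 2 - α + s := by
    refine abs_le_of_sq_le_sq' ?_ (by linarith) |>.2
    nlinarith [mul_nonneg (by linarith : 0 ≤ 2 - α) hs0]
  obtain ⟨x, hx⟩ : ∃ x, x = (α ^ 2 + s ^ 2) / p := ⟨_, rfl⟩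
  obtain ⟨y, hy⟩ : ∃ y, y = A / r := ⟨_, rfl⟩
  have hxp : x * p = α ^ 2 + s ^ 2 := by rw [hx]; field_simp
  have hyr : y * r = A := by rw [hy]; field_simp
  have hy0 : 0 < y := by rw [hy]; exact div_pos (by rw [← hw]; nlinarith) hr
  rw [← hx] at hφ
  rw [← hx, ← hy] at hE
  rw [← hx, ← hy]
  obtain ⟨z, hz⟩ : ∃ z, z = β ^ 2 + A - (β ^ 2 * r + y) := ⟨_, rfl⟩
  have hz1 : z ≤ (w - β) ^ 2 := by
    have h1 : (2 * w * β) ^ 2 ≤ (β ^ 2 * r + y) ^ 2 := by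
      have : (2 * w * β) ^ 2 = 4 * β ^ 2 * (y * r) := by rw [hyr, ← hw]; ring
      nlinarith [sq_nonneg (β ^ 2 * r - y)]
    have h2 := abs_le_of_sq_le_sq' h1 (by positivity) |>.2
    rw [hz, ← hw]; linarith
  set m := 2 + β - α with hm
  have hm0 : 0 < m := by linarith
  have h4 : m * (2 * β - s) ≤ m ^ 2 - z := by
    have : m * (2 * β - s) ≤ m * (m - w + β) := mul_le_mul_of_nonneg_left (by linarith) hm0.le
    have := mul_pos (by linarith : 0 < m - w + β) (by linarith : 0 < w - β)
    linarith
  have h5 : s ^ 2 < (α + β) * (2 * β - s) := by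
    have e1 := mul_lt_mul_of_pos_right (by linarith : 2 * α < α + β) (by linarith : 0 < 2 * β - s)
    have e2 := mul_le_mul_of_nonneg_left (by linarith : 3 / 4 * α ≤ 2 * β - s)
      (by linarith : 0 ≤ 2 * α)
    linarith
  have h6 : m * s ^ 2 < (α + β) * (m ^ 2 - z) := by
    have e1 := mul_lt_mul_of_pos_left h5 hm0
    have e2 := mul_le_mul_of_nonneg_left h4 (by linarith : 0 ≤ α + β)
    linarith
  have h7 : ((2 + β) ^ 2 * p - x) ^ 2 - (y - β ^ 2 * r) ^ 2 =
      8 * ((α + β) * (m ^ 2 - z) - m * s ^ 2) := by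
    have e1 : ((2 + β) ^ 2 * p - x) ^ 2 =
        ((2 + β) ^ 2 * p + x) ^ 2 - 4 * (2 + β) ^ 2 * (x * p) := by ring
    have e2 : (y - β ^ 2 * r) ^ 2 = (β ^ 2 * r + y) ^ 2 - 4 * β ^ 2 * (y * r) := by ring
    have e3 : (2 + β) ^ 2 * p + x = (2 + β) ^ 2 + (α ^ 2 + s ^ 2) - z := by linarith
    have e4 : β ^ 2 * r + y = β ^ 2 + A - z := by linarith
    rw [e1, e2, e3, e4, hxp, hyr, hA, hm]
    ring
  exact lt_of_pow_lt_pow_left₀ 2 hφ.le (by linarith)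

namespace HalfSolution

lemma force_eq_div {q c A B u : ℝ} (hu : 0 < u) :
    c * (B * u ^ (q - 1) - A * u ^ (-q - 1)) = c * ((B * u ^ q - A / u ^ q) / u) := by
  rw [rpow_sub_one hu.ne', rpow_sub_one hu.ne', rpow_neg hu.le]
  field_simp

lemma force_signs_of_matched {q c α β a L : ℝ} {f g v w : ℝ → ℝ} (hq : 0 < q) (hc : 0 < c)
    (hα : 0 < α) (hα2 : α < 2) (hαβ : α < β) (ha : 0 ≤ a) (hL : 0 < L)
    (hf : HalfSolution q c (α ^ 2 + a) ((2 + β) ^ 2) L f v)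
    (hg : HalfSolution q c ((2 - α) ^ 2 + a) (β ^ 2) L g w) (hvw : v 0 = -w 0) :
    α ^ 2 + a < (2 + β) ^ 2 ∧ β ^ 2 < (2 - α) ^ 2 + a := by
  have hβ : 0 < β := hα.trans hαβ
  have hA : 0 < (2 - α) ^ 2 + a := add_pos_of_pos_of_nonneg (pow_pos (by linarith) 2) ha
  have m0 : (0 : ℝ) ∈ Set.Ico 0 L := ⟨le_rfl, hL⟩
  have hgt := hf.of_gt hq hc (by positivity) (by positivity) hL
  have heq := hf.speed_zero_of_eq hq hc (by positivity) (by positivity) hL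
  have hlt := hf.of_lt hq hc (by positivity) (by positivity) hL
  have hgt' := hg.of_gt hq hc hA (by positivity) hL
  have heq' := hg.speed_zero_of_eq hq hc hA (by positivity) hL
  have hlt' := hg.of_lt hq hc hA (by positivity) hL
  rcases lt_trichotomy (α ^ 2 + a) ((2 + β) ^ 2) with h | h | h
  · refine ⟨h, ?_⟩
    have h1 := (hlt h).2 0 m0
    rcases lt_trichotomy (β ^ 2) ((2 - α) ^ 2 + a) with h' | h' | h'
    · exact h'
    · linarith [heq' h'.symm]
    · linarith [(hlt' h').2 0 m0]
  · have h1 := heq h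
    rcases lt_trichotomy (β ^ 2) ((2 - α) ^ 2 + a) with h' | h' | h'
    · linarith [(hgt' h').2 0 m0]
    · exfalso; nlinarith
    · linarith [(hlt' h').2 0 m0]
  · have h1 := (hgt h).2 0 m0
    rcases lt_trichotomy (β ^ 2) ((2 - α) ^ 2 + a) with h' | h' | h'
    · linarith [(hgt' h').2 0 m0]
    · linarith [heq' h'.symm]
    · exfalso; nlinarith

/-- The source term of a matched pair cannot be small: otherwise the speed of one half solution
would only ever cross that of the other in one direction. -/
lemma lower_bound_of_matched {q c α β a L : ℝ} {f g v w : ℝ → ℝ} (hq : 0 < q) (hc : 0 < c)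
    (hα : 0 < α) (hα2 : α < 2) (hαβ : α < β) (ha : 0 ≤ a) (hL : 0 < L)
    (hf : HalfSolution q c (α ^ 2 + a) ((2 + β) ^ 2) L f v)
    (hg : HalfSolution q c ((2 - α) ^ 2 + a) (β ^ 2) L g w) (hvw : v 0 = -w 0) :
    3 / 2 * α ^ 2 < a := by
  by_contra! hcon
  obtain ⟨hAB, hAB'⟩ := force_signs_of_matched hq hc hα hα2 hαβ ha hL hf hg hvw
  have hβ : 0 < β := hα.trans hαβ
  have hA : 0 < (2 - α) ^ 2 + a := add_pos_of_pos_of_nonneg (pow_pos (by linarith) 2) ha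
  obtain ⟨hF, hv⟩ := hf.of_lt hq hc (by positivity) (by positivity) hL hAB
  obtain ⟨-, hw⟩ := hg.of_gt hq hc hA (by positivity) hL hAB'
  have m0 : (0 : ℝ) ∈ Set.Icc 0 L := ⟨le_rfl, hL.le⟩
  have hf1 : ∀ x ∈ Set.Icc 0 L, f x ≤ 1 := by
    intro x hx
    have : AntitoneOn f (Set.Icc 0 L) := by
      refine antitoneOn_of_hasDerivWithinAt_nonpos (convex_Icc 0 L) hf.continuousOn
        (fun y hy => (hf.hasDeriv y (interior_subset hy)).mono interior_subset) ?_
      intro y hy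
      rw [interior_Icc] at hy
      exact (hv y ⟨hy.1.le, hy.2⟩).le
    rw [← hf.initial_eq]
    exact this m0 hx hx.1
  have hg1 : ∀ x ∈ Set.Icc 0 L, 1 ≤ g x := by
    intro x hx
    have : MonotoneOn g (Set.Icc 0 L) := by
      refine monotoneOn_of_hasDerivWithinAt_nonneg (convex_Icc 0 L) hg.continuousOn
        (fun y hy => (hg.hasDeriv y (interior_subset hy)).mono interior_subset) ?_
      intro y hy
      rw [interior_Icc] at hy
      exact (hw y ⟨hy.1.le, hy.2⟩).le
    rw [← hg.initial_eq]
    exact this m0 hx hx.1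
  have hcross : ∀ x ∈ Set.Icc 0 L, v x + w x = 0 →
      ∃ D, 0 < D ∧ HasDerivWithinAt (fun x => v x + w x) D (Set.Icc 0 L) x := by
    intro x hx hz
    refine ⟨_, ?_, (hf.hasDeriv_speed x hx).add (hg.hasDeriv_speed x hx)⟩
    have hfx := hf.pos x hx
    have hgx := hg.pos x hx
    have hp := rpow_pos_of_pos hfx q
    have hr := rpow_pos_of_pos hgx q
    have hφ : 0 < (2 + β) ^ 2 * f x ^ q - (α ^ 2 + a) / f x ^ q := by
      have h1 := hF x hx
      rw [mul_comm 2 q, rpow_mul hfx.le, rpow_two] at h1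
      rw [sub_pos, div_lt_iff₀ hp]
      linarith
    have hE : (2 + β) ^ 2 * f x ^ q + (α ^ 2 + a) / f x ^ q - ((2 + β) ^ 2 + (α ^ 2 + a)) =
        β ^ 2 * g x ^ q + ((2 - α) ^ 2 + a) / g x ^ q - (β ^ 2 + ((2 - α) ^ 2 + a)) := by
      have e1 := hf.speed_sq hq hx
      have e2 := hf.speed_sq hq m0
      have e3 := hg.speed_sq hq hx
      have e4 := hg.speed_sq hq m0
      rw [hf.initial_eq, one_rpow, one_rpow] at e2
      rw [hg.initial_eq, one_rpow, one_rpow] at e4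
      rw [rpow_neg hfx.le] at e1
      rw [rpow_neg hgx.le] at e3
      rw [div_eq_mul_inv, div_eq_mul_inv]
      refine mul_left_cancel₀ (show 2 * c / q ≠ 0 by positivity) ?_
      have e5 : v x = -w x := by linarith
      rw [e5, neg_sq] at e1
      rw [hvw, neg_sq] at e2
      linarith
    have key := force_lt_of_equal_speed hα hα2 hαβ ha hcon hAB' hp hr hE hφ
    rw [force_eq_div hfx, force_eq_div hgx, ← mul_add]
    refine mul_pos hc ?_
    have k1 := le_div_self hφ.le hfx (hf1 x hx)
    have k2 : ((2 - α) ^ 2 + a) / g x ^ q - β ^ 2 * g x ^ q ≤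
        (2 + β) ^ 2 * f x ^ q - (α ^ 2 + a) / f x ^ q := key.le
    have k3 : (((2 - α) ^ 2 + a) / g x ^ q - β ^ 2 * g x ^ q) / g x <
        (2 + β) ^ 2 * f x ^ q - (α ^ 2 + a) / f x ^ q := by
      rw [div_lt_iff₀ hgx]
      nlinarith [mul_nonneg hφ.le (by linarith [hg1 x hx] : 0 ≤ g x - 1)]
    have k4 : (β ^ 2 * g x ^ q - ((2 - α) ^ 2 + a) / g x ^ q) / g x =
        -((((2 - α) ^ 2 + a) / g x ^ q - β ^ 2 * g x ^ q) / g x) := by ring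
    rw [k4]
    linarith
  refine false_of_upcrossing (G := fun x => v x + w x) hL
    (hf.continuousOn_speed.add hg.continuousOn_speed) ?_ ?_ ?_
  · simp [hf.rest, hg.rest]
  · have hz : v 0 + w 0 = 0 := by rw [hvw]; ring
    obtain ⟨D, hD, hd⟩ := hcross 0 m0 hz
    have hd' : HasDerivWithinAt (fun x => v x + w x) D (Set.Ioi 0) 0 :=
      (hd.mono_of_mem_nhdsWithin (Icc_mem_nhdsGT hL))
    have ht := (hasDerivWithinAt_iff_tendsto_slope' (by simp)).1 hd'
    filter_upwards [ht.eventually (lt_mem_nhds hD), self_mem_nhdsWithin] with s hs hs0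
    have hs0 : 0 < s := hs0
    rw [slope_def_field, hz, sub_zero, sub_zero] at hs
    exact (div_pos_iff_of_pos_right hs0).1 hs
  · intro x hx hz
    obtain ⟨D, hD, hd⟩ := hcross x ⟨hx.1.le, hx.2⟩ hz
    have hd' : HasDerivWithinAt (fun x => v x + w x) D (Set.Iio x) x :=
      hd.mono_of_mem_nhdsWithin (mem_of_superset (Ioo_mem_nhdsLT hx.1)
        (fun y hy => ⟨hy.1.le, hy.2.le.trans hx.2⟩))
    have ht := (hasDerivWithinAt_iff_tendsto_slope' (by simp)).1 hd'
    filter_upwards [ht.eventually (lt_mem_nhds hD), self_mem_nhdsWithin] with s hs hs0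
    have hs0 : s < x := hs0
    rw [slope_def_field] at hs
    rw [hz, sub_zero] at hs
    by_contra! hcon2
    exact absurd hs (not_lt.2 (div_nonpos_of_nonneg_of_nonpos hcon2 (by linarith)))

end HalfSolution

/-- A positive `2π`-periodic `C¹` solution of `f'' = c (B f ^ (q - 1) - A f ^ (- q - 1))`, where
`(A, B)` is `(A₁, B₁)` on `(0, π)` and `(A₂, B₂)` on `(-π, 0)`. -/
structure PeriodicSolution (q c A₁ B₁ A₂ B₂ : ℝ) (f : ℝ → ℝ) : Prop where
  periodic : Function.Periodic f (2 * π)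
  pos : ∀ x, 0 < f x
  contDiff : ContDiff ℝ 1 f
  hasDeriv_right : ∀ x ∈ Set.Ioo 0 π,
    HasDerivAt (deriv f) (c * (B₁ * f x ^ (q - 1) - A₁ * f x ^ (-q - 1))) x
  hasDeriv_left : ∀ x ∈ Set.Ioo (-π) 0,
    HasDerivAt (deriv f) (c * (B₂ * f x ^ (q - 1) - A₂ * f x ^ (-q - 1))) x

namespace PeriodicSolution

variable {q c A₁ B₁ A₂ B₂ : ℝ} {f g : ℝ → ℝ}

lemma hasDerivAt (h : PeriodicSolution q c A₁ B₁ A₂ B₂ f) (x : ℝ) : HasDerivAt f (deriv f x) x :=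
  (h.contDiff.differentiable one_ne_zero x).hasDerivAt

lemma continuous_deriv (h : PeriodicSolution q c A₁ B₁ A₂ B₂ f) : Continuous (deriv f) :=
  h.contDiff.continuous_deriv le_rfl

lemma hasDerivAt_deriv_comp_const_sub {a x D : ℝ} (h : HasDerivAt (deriv f) D (a - x)) :
    HasDerivAt (deriv fun x => f (a - x)) D x := by
  have : (deriv fun x => f (a - x)) = fun x => -deriv f (a - x) :=
    funext fun x => deriv_comp_const_sub f a x
  rw [this]
  exact (h.comp_const_sub a x).neg.congr_deriv (neg_neg D)

lemma reflect (h : PeriodicSolution q c A₁ B₁ A₂ B₂ f) :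
    PeriodicSolution q c A₂ B₂ A₁ B₁ (fun x => f (0 - x)) where
  periodic x := (congrArg f (by ring)).trans (h.periodic.sub_eq (0 - x))
  pos x := h.pos _
  contDiff := h.contDiff.comp (contDiff_const.sub contDiff_id)
  hasDeriv_right x hx := hasDerivAt_deriv_comp_const_sub
    (h.hasDeriv_left (0 - x) ⟨by linarith [hx.2], by linarith [hx.1]⟩)
  hasDeriv_left x hx := hasDerivAt_deriv_comp_const_sub
    (h.hasDeriv_right (0 - x) ⟨by linarith [hx.2], by linarith [hx.1]⟩)

lemma reflect_shift (h : PeriodicSolution q c A₁ B₁ A₂ B₂ f) :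
    PeriodicSolution q c A₁ B₁ A₂ B₂ (fun x => f (π - x)) where
  periodic x := (congrArg f (by ring)).trans (h.periodic.sub_eq (π - x))
  pos x := h.pos _
  contDiff := h.contDiff.comp (contDiff_const.sub contDiff_id)
  hasDeriv_right x hx := hasDerivAt_deriv_comp_const_sub
    (h.hasDeriv_right (π - x) ⟨by linarith [hx.2], by linarith [hx.1]⟩)
  hasDeriv_left x hx := by
    have : (fun x => f (π - x)) = fun x => f (-π - x) := by
      funext y
      rw [← h.periodic (-π - y)]
      congr 1; ring
    simp only [this, congrFun this x]
    exact hasDerivAt_deriv_comp_const_sub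
      (h.hasDeriv_left (-π - x) ⟨by linarith [hx.2], by linarith [hx.1]⟩)

lemma force_strictMono {A B u v : ℝ} (hq : 1 < q) (hc : 0 < c) (hA : 0 ≤ A) (hB : 0 < B)
    (hu : 0 < u) (huv : u < v) :
    c * (B * u ^ (q - 1) - A * u ^ (-q - 1)) < c * (B * v ^ (q - 1) - A * v ^ (-q - 1)) := by
  have h1 := mul_lt_mul_of_pos_left (rpow_lt_rpow hu.le huv (show 0 < q - 1 by linarith)) hB
  have h2 := mul_le_mul_of_nonneg_left
    (rpow_le_rpow_of_nonpos hu huv.le (show -q - 1 ≤ 0 by linarith)) hA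
  exact mul_lt_mul_of_pos_left (by linarith) hc

lemma le (hf : PeriodicSolution q c A₁ B₁ A₂ B₂ f) (hg : PeriodicSolution q c A₁ B₁ A₂ B₂ g)
    (hq : 1 < q) (hc : 0 < c) (hA₁ : 0 ≤ A₁) (hB₁ : 0 < B₁) (hA₂ : 0 ≤ A₂) (hB₂ : 0 < B₂) (x : ℝ) :
    f x ≤ g x := by
  have hcont : Continuous (fun y => f y - g y) := hf.contDiff.continuous.sub hg.contDiff.continuous
  have hper : Function.Periodic (fun y => f y - g y) (2 * π) := hf.periodic.sub hg.periodic
  obtain ⟨z, -, hz⟩ := (isCompact_Icc (a := -π) (b := π)).exists_isMaxOn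
    ⟨-π, le_rfl, by linarith [pi_pos]⟩ hcont.continuousOn
  have hzmax : ∀ y, f y - g y ≤ f z - g z := by
    intro y
    obtain ⟨y', hy', he⟩ := hper.exists_mem_Ico two_pi_pos y (-π)
    have he : f y - g y = f y' - g y' := he
    rw [he]
    exact hz ⟨hy'.1, by linarith [hy'.2]⟩
  obtain ⟨z', hz', he⟩ := hper.exists_mem_Ico two_pi_pos z (-π)
  have he : f z - g z = f z' - g z' := he
  rw [he] at hzmax
  by_contra! hcon
  have hpos : 0 < f z' - g z' := by linarith [hzmax x]
  have hd : ∀ y, HasDerivAt (fun y => f y - g y) (deriv f y - deriv g y) y :=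
    fun y => (hf.hasDerivAt y).sub (hg.hasDerivAt y)
  have hd0 : deriv f z' - deriv g z' = 0 :=
    IsLocalMax.hasDerivAt_eq_zero (Eventually.of_forall hzmax) (hd z')
  have hev : ∀ᶠ y in nhdsWithin z' (Set.Ioi z'), 0 < f y - g y :=
    (hcont.continuousAt.eventually (lt_mem_nhds hpos)).filter_mono nhdsWithin_le_nhds
  have hsecond : ∀ᶠ y in nhdsWithin z' (Set.Ioi z'), ∃ D, 0 < D ∧
      HasDerivAt (fun y => deriv f y - deriv g y) D y := by
    rcases lt_or_ge z' 0 with h0 | h0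
    · filter_upwards [hev, Ioo_mem_nhdsGT h0] with y hy hy'
      have hyI : y ∈ Set.Ioo (-π) 0 := ⟨hz'.1.trans_lt hy'.1, hy'.2⟩
      exact ⟨_, sub_pos.2 (force_strictMono hq hc hA₂ hB₂ (hg.pos y) (sub_pos.1 hy)),
        (hf.hasDeriv_left y hyI).sub (hg.hasDeriv_left y hyI)⟩
    · have h1 : z' < π := by linarith [hz'.2]
      filter_upwards [hev, Ioo_mem_nhdsGT h1] with y hy hy'
      have hyI : y ∈ Set.Ioo 0 π := ⟨h0.trans_lt hy'.1, hy'.2⟩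
      exact ⟨_, sub_pos.2 (force_strictMono hq hc hA₁ hB₁ (hg.pos y) (sub_pos.1 hy)),
        (hf.hasDeriv_right y hyI).sub (hg.hasDeriv_right y hyI)⟩
  obtain ⟨r, hr, hI⟩ := mem_nhdsGT_iff_exists_Ioo_subset.1 hsecond
  have hr : z' < r := hr
  have hmono : StrictMonoOn (fun y => deriv f y - deriv g y) (Set.Ico z' r) := by
    refine strictMonoOn_of_deriv_pos (convex_Ico z' r)
      (hf.continuous_deriv.sub hg.continuous_deriv).continuousOn ?_
    intro y hy
    rw [interior_Ico] at hy
    obtain ⟨D, hD, hD'⟩ := hI hy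
    rw [hD'.deriv]
    exact hD
  have hmono' : StrictMonoOn (fun y => f y - g y) (Set.Ico z' r) := by
    refine strictMonoOn_of_deriv_pos (convex_Ico z' r) hcont.continuousOn ?_
    intro y hy
    rw [interior_Ico] at hy
    rw [(hd y).deriv, ← hd0]
    exact hmono ⟨le_rfl, hr⟩ ⟨hy.1.le, hy.2⟩ hy.1
  have hm : (z' + r) / 2 ∈ Set.Ico z' r := ⟨by linarith, by linarith⟩
  have := hmono' ⟨le_rfl, hr⟩ hm (by linarith)
  exact absurd (hzmax ((z' + r) / 2)) (not_le.2 this)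

lemma deriv_half_pi (hf : PeriodicSolution q c A₁ B₁ A₂ B₂ f)
    (hq : 1 < q) (hc : 0 < c) (hA₁ : 0 ≤ A₁) (hB₁ : 0 < B₁) (hA₂ : 0 ≤ A₂) (hB₂ : 0 < B₂) :
    deriv f (π / 2) = 0 := by
  have hs : f = fun x => f (π - x) := by
    funext x
    exact le_antisymm (hf.le hf.reflect_shift hq hc hA₁ hB₁ hA₂ hB₂ x)
      (hf.reflect_shift.le hf hq hc hA₁ hB₁ hA₂ hB₂ x)
  have h1 : deriv f (π / 2) = -deriv f (π - π / 2) := by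
    conv_lhs => rw [hs]
    exact deriv_comp_const_sub f π (π / 2)
  have h2 : π - π / 2 = π / 2 := by ring
  rw [h2] at h1
  linarith

lemma halfSolution (hf : PeriodicSolution q c A₁ B₁ A₂ B₂ f)
    (hq : 1 < q) (hc : 0 < c) (hA₁ : 0 ≤ A₁) (hB₁ : 0 < B₁) (hA₂ : 0 ≤ A₂) (hB₂ : 0 < B₂)
    (h0 : f 0 = 1) : HalfSolution q c A₁ B₁ (π / 2) f (deriv f) where
  pos x _ := hf.pos x
  hasDeriv x _ := (hf.hasDerivAt x).hasDerivWithinAt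
  hasDeriv_speed x hx := by
    have hpi := pi_pos
    rcases hx.1.eq_or_lt with rfl | hx0
    · have hmem : Set.Ioo 0 π ∈ nhdsWithin (0 : ℝ) (Set.Ioi 0) := Ioo_mem_nhdsGT hpi
      refine (hasDerivWithinAt_Ici_of_tendsto_deriv (s := Set.Ioo 0 π)
        (fun y hy => (hf.hasDeriv_right y hy).differentiableAt.differentiableWithinAt)
        hf.continuous_deriv.continuousWithinAt hmem ?_).mono Set.Icc_subset_Ici_self
      have hc0 : ContinuousAt
          (fun y => c * (B₁ * f y ^ (q - 1) - A₁ * f y ^ (-q - 1))) 0 := by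
        have hfc := hf.contDiff.continuous.continuousAt (x := 0)
        exact continuousAt_const.mul
          ((continuousAt_const.mul (hfc.rpow_const (Or.inl (hf.pos 0).ne'))).sub
            (continuousAt_const.mul (hfc.rpow_const (Or.inl (hf.pos 0).ne'))))
      refine (hc0.tendsto.mono_left nhdsWithin_le_nhds).congr' ?_
      filter_upwards [hmem] with y hy
      exact (hf.hasDeriv_right y hy).deriv.symm
    · exact (hf.hasDeriv_right x ⟨hx0, by linarith [hx.2]⟩).hasDerivWithinAt
  initial_eq := h0
  rest := hf.deriv_half_pi hq hc hA₁ hB₁ hA₂ hB₂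

end PeriodicSolution

namespace PeriodicSolution

lemma exists_matched_turningPoints {q c α β a : ℝ} {f : ℝ → ℝ} (hq : 1 < q) (hc : 0 < c)
    (hα : 0 < α) (hα2 : α < 2) (hαβ : α < β) (ha : 0 ≤ a)
    (h : PeriodicSolution q c (α ^ 2 + a) ((2 + β) ^ 2) ((2 - α) ^ 2 + a) (β ^ 2) f)
    (h0 : f 0 = 1) :
    3 / 2 * α ^ 2 < a ∧ ∃ X Y,
      IsTurningPoint (-(1 / q)) q ((2 + β) ^ 2) (α ^ 2 + a) (√c * (π / 2)) X ∧
      IsTurningPoint (1 / q) q ((2 - α) ^ 2 + a) (β ^ 2) (√c * (π / 2)) Y ∧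
      launchEnergy ((2 + β) ^ 2) (α ^ 2 + a) X = launchEnergy ((2 - α) ^ 2 + a) (β ^ 2) Y := by
  have hβ : 0 < β := hα.trans hαβ
  have hA : 0 < (2 - α) ^ 2 + a := add_pos_of_pos_of_nonneg (pow_pos (by linarith) 2) ha
  have hL : 0 < π / 2 := by positivity
  have hq0 : 0 < q := by linarith
  have hf := h.halfSolution hq hc (by positivity) (by positivity) hA.le (by positivity) h0
  have hg := h.reflect.halfSolution hq hc hA.le (by positivity) (by positivity) (by positivity)
    (by simpa using h0)
  have hvw : deriv f 0 = -deriv (fun x => f (0 - x)) 0 := by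
    rw [deriv_comp_const_sub]; simp
  obtain ⟨h1, h2⟩ := HalfSolution.force_signs_of_matched hq0 hc hα hα2 hαβ ha hL hf hg hvw
  obtain ⟨hX, hX'⟩ := hf.isTurningPoint_of_lt hq0 hc (by positivity) (by positivity) hL h1
  obtain ⟨hY, hY'⟩ := hg.isTurningPoint_of_gt hq0 hc hA (by positivity) hL h2
  refine ⟨HalfSolution.lower_bound_of_matched hq0 hc hα hα2 hαβ ha hL hf hg hvw,
    _, _, hX, hY, ?_⟩
  rw [hvw, neg_sq, hY'] at hX'
  exact (mul_left_cancel₀ (by positivity) hX').symm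

lemma false_of_lt {q N α β K d₁ d₂ : ℝ} {f g : ℝ → ℝ} (hq : 2 < q) (hq6 : q ≤ 6)
    (hN : N * (q - 2) = 4 * q) (hα : 0 < α) (hα2 : α < 2) (hαβ : α < β) (hK : 0 ≤ K)
    (hd₁ : 0 < d₁) (hd : d₁ < d₂)
    (hf : PeriodicSolution q (d₁ ^ (q - 2) / (2 * q)) (α ^ 2 + K * d₁ ^ (-(2 * q))) ((2 + β) ^ 2)
      ((2 - α) ^ 2 + K * d₁ ^ (-(2 * q))) (β ^ 2) f)
    (hg : PeriodicSolution q (d₂ ^ (q - 2) / (2 * q)) (α ^ 2 + K * d₂ ^ (-(2 * q))) ((2 + β) ^ 2)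
      ((2 - α) ^ 2 + K * d₂ ^ (-(2 * q))) (β ^ 2) g)
    (hf0 : f 0 = 1) (hg0 : g 0 = 1) : False := by
  have hd₂ : 0 < d₂ := hd₁.trans hd
  have hq1 : 1 < q := by linarith
  obtain ⟨-, X₁, Y₁, hX₁, hY₁, hP₁⟩ := hf.exists_matched_turningPoints hq1 (by positivity) hα hα2
    hαβ (by positivity) hf0
  obtain ⟨ha, X₂, Y₂, hX₂, hY₂, hP₂⟩ := hg.exists_matched_turningPoints hq1 (by positivity) hα hα2
    hαβ (by positivity) hg0
  have hlog : 0 < log d₂ - log d₁ := sub_pos.2 (log_lt_log hd₁ hd)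
  obtain ⟨T, hT⟩ : ∃ T, T = (q - 2) / 2 * (log d₂ - log d₁) := ⟨_, rfl⟩
  have hT0 : 0 < T := by rw [hT]; exact mul_pos (by linarith) hlog
  have ea : K * d₂ ^ (-(2 * q)) = K * d₁ ^ (-(2 * q)) * exp (-N * T) := by
    rw [mul_assoc, rpow_def_of_pos hd₁, rpow_def_of_pos hd₂, ← exp_add]
    congr 2
    rw [hT]
    linear_combination ((log d₂ - log d₁) / 2) * hN
  have ec : √(d₂ ^ (q - 2) / (2 * q)) = √(d₁ ^ (q - 2) / (2 * q)) * exp T := by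
    have : d₂ ^ (q - 2) / (2 * q) = d₁ ^ (q - 2) / (2 * q) * exp T ^ 2 := by
      have e : d₂ ^ (q - 2) = d₁ ^ (q - 2) * exp T ^ 2 := by
        rw [← exp_nat_mul, rpow_def_of_pos hd₁, rpow_def_of_pos hd₂, ← exp_add, hT]
        congr 1
        push_cast
        ring
      rw [e]; ring
    rw [this, sqrt_mul (by positivity), sqrt_sq (exp_pos T).le]
  have el : √(d₂ ^ (q - 2) / (2 * q)) * (π / 2) =
      √(d₁ ^ (q - 2) / (2 * q)) * (π / 2) * exp T := by rw [ec]; ring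
  rw [ea] at ha hX₂ hY₂ hP₂
  rw [el] at hX₂ hY₂
  exact not_exists_two_matched hq hq6 hN hα hα2 hαβ (by positivity) hT0 ha hX₁ hY₁ hP₁ hX₂ hY₂ hP₂

end PeriodicSolution

lemma qex_bounds {n : ℕ} (hn : 3 ≤ n) :
    2 < qex n ∧ qex n ≤ 6 ∧ 2 * (n : ℝ) * (qex n - 2) = 4 * qex n := by
  have h : (3 : ℝ) ≤ n := by exact_mod_cast hn
  have h2 : 0 < (n : ℝ) - 2 := by linarith
  refine ⟨?_, ?_, ?_⟩ <;> unfold qex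
  · rw [lt_div_iff₀ h2]; linarith
  · rw [div_le_iff₀ h2]; linarith
  · field_simp; ring

lemma kap_pos {n : ℕ} (hn : 3 ≤ n) : 0 < kap n := by
  have h : (3 : ℝ) ≤ n := by exact_mod_cast hn
  exact div_pos (by linarith) (by linarith)

namespace IsModelSolution

variable {n : ℕ} {t γ η μ d : ℝ} {ψ : ℝ → ℝ}

lemma hasDerivAt_deriv (h : IsModelSolution n t γ η 0 d ψ) (hn : 3 ≤ n) (hd : 0 < d) {x : ℝ}
    (hx : sin x ≠ 0) :
    HasDerivAt (deriv ψ) (d ^ (qex n - 2) / (2 * qex n) * ((t + lam x) ^ 2 * ψ x ^ (qex n - 1) -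
      ((γ + lam x) ^ 2 + 2 * η ^ 2 / kap n * d ^ (-(2 * qex n))) * ψ x ^ (-qex n - 1))) x := by
  obtain ⟨-, -, -, h4⟩ := h
  have hxk : ∀ k : ℤ, x ≠ (k : ℝ) * π := by
    rintro k rfl
    exact hx (sin_int_mul_pi k)
  obtain ⟨h5, h6⟩ := h4 x hxk
  have hk := kap_pos hn
  have hq := (qex_bounds hn).1
  have hD : 0 < d ^ (qex n - 2) := rpow_pos_of_pos hd _
  refine h5.hasDerivAt.congr_deriv ?_
  rw [rpow_neg hd.le (qex n - 2), zero_mul, zero_add] at h6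
  have hq0 : qex n ≠ 0 := by linarith
  generalize d ^ (qex n - 2) = D at *
  generalize d ^ (-(2 * qex n)) = E at *
  generalize ψ x ^ (qex n - 1) = Z at *
  generalize ψ x ^ (-qex n - 1) = Y at *
  generalize deriv (deriv ψ) x = W at *
  generalize kap n = κ at *
  generalize qex n = q at *
  field_simp at h6 ⊢
  linarith

lemma periodicSolution (h : IsModelSolution n t γ η 0 d ψ) (hn : 3 ≤ n) (hd : 0 < d) :
    PeriodicSolution (qex n) (d ^ (qex n - 2) / (2 * qex n))
      ((γ + 1) ^ 2 + 2 * η ^ 2 / kap n * d ^ (-(2 * qex n))) ((t + 1) ^ 2)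
      ((γ - 1) ^ 2 + 2 * η ^ 2 / kap n * d ^ (-(2 * qex n))) ((t - 1) ^ 2) ψ where
  periodic := h.1
  pos := h.2.1
  contDiff := h.2.2.1
  hasDeriv_right x hx := by
    have hs := sin_pos_of_mem_Ioo hx
    have := h.hasDerivAt_deriv hn hd hs.ne'
    rwa [lam, if_pos hs] at this
  hasDeriv_left x hx := by
    have hs := sin_neg_of_neg_of_neg_pi_lt hx.2 hx.1
    have := h.hasDerivAt_deriv hn hd hs.ne
    rwa [lam, if_neg hs.not_gt, ← sub_eq_add_neg, ← sub_eq_add_neg] at this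

lemma not_lt_of_eq_one {d₁ d₂ : ℝ} {ψ₁ ψ₂ : ℝ → ℝ} (hn : 3 ≤ n) (hγ : -1 < γ ∧ γ < 1)
    (ht : |t - γ| > 2) (hd₁ : 0 < d₁) (h₁ : IsModelSolution n t γ η 0 d₁ ψ₁)
    (h₂ : IsModelSolution n t γ η 0 d₂ ψ₂) (e₁ : ψ₁ 0 = 1) (e₂ : ψ₂ 0 = 1) : ¬d₁ < d₂ := by
  intro hd
  obtain ⟨hq, hq6, hN⟩ := qex_bounds hn
  have hK : 0 ≤ 2 * η ^ 2 / kap n := div_nonneg (by positivity) (kap_pos hn).le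
  have p₁ := h₁.periodicSolution hn hd₁
  have p₂ := h₂.periodicSolution hn (hd₁.trans hd)
  rcases lt_abs.1 ht with ht | ht
  · have q1 : (t + 1) ^ 2 = (2 + (t - 1)) ^ 2 := by ring
    have q2 : (γ - 1) ^ 2 = (2 - (γ + 1)) ^ 2 := by ring
    rw [q1, q2] at p₁ p₂
    exact PeriodicSolution.false_of_lt hq hq6 hN (by linarith) (by linarith) (by linarith) hK hd₁ hd
      p₁ p₂ e₁ e₂
  · have q1 : (t + 1) ^ 2 = (-1 - t) ^ 2 := by ring
    have q2 : (t - 1) ^ 2 = (2 + (-1 - t)) ^ 2 := by ring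
    have q3 : (γ + 1) ^ 2 = (2 - (1 - γ)) ^ 2 := by ring
    have q4 : (γ - 1) ^ 2 = (1 - γ) ^ 2 := by ring
    rw [q1, q2, q3, q4] at p₁ p₂
    exact PeriodicSolution.false_of_lt hq hq6 hN (by linarith) (by linarith) (by linarith) hK hd₁ hd
      p₁.reflect p₂.reflect (by simpa using e₁) (by simpa using e₂)

end IsModelSolution

/-- Near-CMC uniqueness (Proposition 3.17). -/
theorem near_cmc_uniqueness (n : ℕ) (hn : 3 ≤ n) (t γ η μ : ℝ)
    (hγ : -1 < γ ∧ γ < 1) (ht : |t - γ| > 2) (hμ : μ = 0) :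
    ∀ d₁ d₂ : ℝ, 0 < d₁ → 0 < d₂ →
      ∀ ψ₁ ψ₂ : ℝ → ℝ,
        IsModelSolution n t γ η μ d₁ ψ₁ → IsModelSolution n t γ η μ d₂ ψ₂ →
        ψ₁ 0 = 1 → ψ₂ 0 = 1 → d₁ = d₂ := by
  subst hμ
  intro d₁ d₂ hd₁ hd₂ ψ₁ ψ₂ h₁ h₂ e₁ e₂
  exact le_antisymm (not_lt.1 (h₂.not_lt_of_eq_one hn hγ ht hd₂ h₁ e₂ e₁))
    (not_lt.1 (h₁.not_lt_of_eq_one hn hγ ht hd₁ h₂ e₁ e₂))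
end

section
/- Small-TT existence (Theorem 3.5 / Proposition 3.21): Suppose |t| > |γ| and |t| ≠ 1. Then there exists ε₀ > 0 such that whenever (η, μ) ≠ (0, 0) and η² + μ² < ε₀², there exist d > 0 and a solution ψ of the model Lichnerowicz equation L_d (with parameters t, γ, η, μ) satisfying ψ(0) = 1. -/
open Real Filter

open Set Topology NNReal in
/-- A nonpositivity (maximum) principle on `[0, L]` with a Dirichlet condition at `0` and a Neumann
condition at `L`. -/
lemma nonpos_of_mixed_boundary {L : ℝ} (hL : 0 ≤ L) {z z' z'' : ℝ → ℝ}
    (h1 : ∀ x ∈ Icc 0 L, HasDerivAt z (z' x) x) (h2 : ∀ x ∈ Icc 0 L, HasDerivAt z' (z'' x) x)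
    (h0 : z 0 ≤ 0) (hz' : z' L ≤ 0) (h : ∀ x ∈ Icc 0 L, 0 < z x → 0 ≤ z'' x) :
    ∀ x ∈ Icc 0 L, z x ≤ 0 := by
  have hpos : ∀ (k : ℕ) (y : ℝ),
      HasDerivAt (fun y : ℝ => max y 0 ^ (k + 2)) ((k + 2) * max y 0 ^ (k + 1)) y := by
    intro k y
    rcases lt_trichotomy y 0 with hy | rfl | hy
    · have he : (fun y : ℝ => max y 0 ^ (k + 2)) =ᶠ[𝓝 y] fun _ => 0 := by
        filter_upwards [Iio_mem_nhds hy] with w hw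
        simp [max_eq_right (le_of_lt (mem_Iio.1 hw))]
      rw [max_eq_right hy.le]
      simpa using (hasDerivAt_const y (0 : ℝ)).congr_of_eventuallyEq he
    · have he : HasDerivAt (fun y : ℝ => |y| ^ 1 * y) 0 0 := by
        rw [hasDerivAt_iff_isLittleO_nhds_zero]
        have : (fun h : ℝ => |h| * h) =o[𝓝 0] fun h : ℝ => h := by
          have h1 : (fun h : ℝ => |h|) =o[𝓝 0] fun _ : ℝ => (1 : ℝ) := by
            rw [Asymptotics.isLittleO_one_iff]
            simpa using (continuous_abs.tendsto (0 : ℝ))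
          simpa using h1.mul_isBigO (Asymptotics.isBigO_refl (fun h : ℝ => h) (𝓝 0))
        simpa using this
      rw [hasDerivAt_iff_isLittleO_nhds_zero] at he ⊢
      refine Asymptotics.IsBigO.trans_isLittleO ?_ he
      refine Asymptotics.IsBigO.of_bound 1 ?_
      filter_upwards [Metric.ball_mem_nhds (0 : ℝ) one_pos] with w hw
      rw [Metric.mem_ball, dist_zero_right, Real.norm_eq_abs] at hw
      have hm : |max w 0| ≤ |w| := by
        rcases le_total w 0 with h | h <;> simp [h]
      simp only [zero_add, max_self, ne_eq, Nat.add_eq_zero_iff, OfNat.ofNat_ne_zero, and_false,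
        not_false_eq_true, zero_pow, sub_zero, one_ne_zero, mul_zero, smul_zero, Real.norm_eq_abs,
        pow_one, abs_mul, abs_abs, one_mul, abs_pow, abs_zero]
      calc |max w 0| ^ (k + 2) ≤ |w| ^ (k + 2) := by gcongr
        _ = |w| ^ k * (|w| * |w|) := by ring
        _ ≤ 1 * (|w| * |w|) := by
          gcongr
          exact pow_le_one₀ (abs_nonneg w) hw.le
        _ = _ := by ring
    · have he : (fun y : ℝ => max y 0 ^ (k + 2)) =ᶠ[𝓝 y] fun y => y ^ (k + 2) := by
        filter_upwards [Ioi_mem_nhds hy] with w hw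
        simp only [max_eq_left (le_of_lt (mem_Ioi.1 hw))]
      rw [max_eq_left hy.le]
      have := (hasDerivAt_pow (k + 2) y).congr_of_eventuallyEq he
      simpa using this
  have hφ : ∀ x ∈ Icc 0 L, HasDerivAt (fun x => max (z x) 0 ^ 2 * z' x)
      (2 * max (z x) 0 * z' x * z' x + max (z x) 0 ^ 2 * z'' x) x := by
    intro x hx
    exact (((hpos 0 (z x)).comp x (h1 x hx)).mul (h2 x hx)).congr_deriv (by simp)
  have hmono : MonotoneOn (fun x => max (z x) 0 ^ 2 * z' x) (Icc 0 L) := by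
    refine monotoneOn_of_hasDerivWithinAt_nonneg (convex_Icc 0 L)
      (fun x hx => (hφ x hx).continuousAt.continuousWithinAt)
      (fun x hx => (hφ x (interior_subset hx)).hasDerivWithinAt) fun x hx => ?_
    have hx' := interior_subset hx
    have hm : 0 ≤ max (z x) 0 := le_max_right _ _
    refine add_nonneg (by nlinarith [mul_nonneg hm (mul_self_nonneg (z' x))]) ?_
    rcases le_or_gt (z x) 0 with hzx | hzx
    · simp [max_eq_right hzx]
    · exact mul_nonneg (sq_nonneg _) (h x hx' hzx)
  have hzero : ∀ x ∈ Icc 0 L, max (z x) 0 ^ 2 * z' x = 0 := by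
    intro x hx
    have ha := hmono (left_mem_Icc.2 hL) hx hx.1
    have hb := hmono hx (right_mem_Icc.2 hL) hx.2
    simp only [max_eq_right h0] at ha
    have : max (z L) 0 ^ 2 * z' L ≤ 0 := mul_nonpos_of_nonneg_of_nonpos (sq_nonneg _) hz'
    simp only at hb
    nlinarith
  have hcub : AntitoneOn (fun x => max (z x) 0 ^ 3) (Icc 0 L) := by
    have hd : ∀ x ∈ Icc 0 L, HasDerivAt (fun x => max (z x) 0 ^ 3) 0 x := by
      intro x hx
      refine ((hpos 1 (z x)).comp x (h1 x hx)).congr_deriv ?_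
      norm_num [mul_assoc, hzero x hx]
    exact antitoneOn_of_hasDerivWithinAt_nonpos (convex_Icc 0 L)
      (fun x hx => (hd x hx).continuousAt.continuousWithinAt)
      (fun x hx => (hd x (interior_subset hx)).hasDerivWithinAt) fun x hx => le_rfl
  intro x hx
  by_contra! hzx
  have := hcub (left_mem_Icc.2 hL) hx hx.1
  simp only [max_eq_right h0, max_eq_left hzx.le] at this
  have := pow_pos hzx 3
  simp at *
  linarith

open Set Topology in
lemma deriv_nonpos_of_nonpos_right {L s : ℝ} (hL : 0 < L) {z : ℝ → ℝ} (hz : HasDerivAt z s 0)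
    (h0 : z 0 = 0) (h : ∀ x ∈ Icc 0 L, z x ≤ 0) : s ≤ 0 := by
  have ht := (hasDerivAt_iff_tendsto_slope.1 hz).mono_left (nhdsGT_le_nhdsNE 0)
  refine le_of_tendsto ht ?_
  filter_upwards [Ioc_mem_nhdsGT hL] with x hx
  rw [slope_def_field, h0, sub_zero, sub_zero]
  exact div_nonpos_of_nonpos_of_nonneg (h x ⟨hx.1.le, hx.2⟩) hx.1.le

/-- `(u, v)` solves `u' = v`, `v' = f u` on `[0, L]` with `u 0 = 1` and `v L = 0`. -/
structure IsMixedSolution (f : ℝ → ℝ) (L : ℝ) (u v : ℝ → ℝ) : Prop where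
  deriv_fst : ∀ x ∈ Set.Icc 0 L, HasDerivAt u (v x) x
  deriv_snd : ∀ x ∈ Set.Icc 0 L, HasDerivAt v (f (u x)) x
  left : u 0 = 1
  right : v L = 0

open Set in
lemma IsMixedSolution.le_of_super {f : ℝ → ℝ} {L : ℝ} {u v w w' w'' : ℝ → ℝ} (hL : 0 < L)
    (hu : IsMixedSolution f L u v)
    (h1 : ∀ x ∈ Icc 0 L, HasDerivAt w (w' x) x) (h2 : ∀ x ∈ Icc 0 L, HasDerivAt w' (w'' x) x)
    (h0 : 1 ≤ w 0) (hw' : 0 ≤ w' L) (h : ∀ x ∈ Icc 0 L, w x < u x → w'' x ≤ f (u x)) :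
    (∀ x ∈ Icc 0 L, u x ≤ w x) ∧ (w 0 = 1 → v 0 ≤ w' 0) := by
  have key : ∀ x ∈ Icc 0 L, u x - w x ≤ 0 := by
    refine nonpos_of_mixed_boundary hL.le (fun x hx => (hu.deriv_fst x hx).sub (h1 x hx))
      (fun x hx => (hu.deriv_snd x hx).sub (h2 x hx)) (by rw [hu.left]; linarith)
      (by rw [hu.right]; linarith) fun x hx hz => sub_nonneg.2 (h x hx (by linarith))
  refine ⟨fun x hx => by linarith [key x hx], fun hw => ?_⟩
  have h00 : (0 : ℝ) ∈ Icc 0 L := left_mem_Icc.2 hL.le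
  have := deriv_nonpos_of_nonpos_right hL ((hu.deriv_fst 0 h00).sub (h1 0 h00))
    (by simp [hu.left, hw]) key
  linarith

open Set in
lemma IsMixedSolution.ge_of_sub {f : ℝ → ℝ} {L : ℝ} {u v w w' w'' : ℝ → ℝ} (hL : 0 < L)
    (hu : IsMixedSolution f L u v)
    (h1 : ∀ x ∈ Icc 0 L, HasDerivAt w (w' x) x) (h2 : ∀ x ∈ Icc 0 L, HasDerivAt w' (w'' x) x)
    (h0 : w 0 ≤ 1) (hw' : w' L ≤ 0) (h : ∀ x ∈ Icc 0 L, u x < w x → f (u x) ≤ w'' x) :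
    (∀ x ∈ Icc 0 L, w x ≤ u x) ∧ (w 0 = 1 → w' 0 ≤ v 0) := by
  have key : ∀ x ∈ Icc 0 L, w x - u x ≤ 0 := by
    refine nonpos_of_mixed_boundary hL.le (fun x hx => (h1 x hx).sub (hu.deriv_fst x hx))
      (fun x hx => (h2 x hx).sub (hu.deriv_snd x hx)) (by rw [hu.left]; linarith)
      (by rw [hu.right]; linarith) fun x hx hz => sub_nonneg.2 (h x hx (by linarith))
  refine ⟨fun x hx => by linarith [key x hx], fun hw => ?_⟩
  have h00 : (0 : ℝ) ∈ Icc 0 L := left_mem_Icc.2 hL.le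
  have := deriv_nonpos_of_nonpos_right hL ((h1 0 h00).sub (hu.deriv_fst 0 h00))
    (by simp [hu.left, hw]) key
  linarith

lemma hasDerivAt_parabola (L m x : ℝ) :
    HasDerivAt (fun x : ℝ => m * (L * x - x ^ 2 / 2)) (m * (L - x)) x := by
  have := ((hasDerivAt_id x).const_mul L |>.sub ((hasDerivAt_pow 2 x).div_const 2)).const_mul m
  exact this.congr_deriv (by simp)

lemma hasDerivAt_parabola_deriv (L m x : ℝ) :
    HasDerivAt (fun x : ℝ => m * (L - x)) (-m) x := by
  have := ((hasDerivAt_id x).const_sub L).const_mul m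
  simpa using this

/-- The initial slope depends on the nonlinearity in a Lipschitz way. -/
lemma IsMixedSolution.slope_le {f g : ℝ → ℝ} {L δ : ℝ} {u v u₁ v₁ : ℝ → ℝ} (hL : 0 < L)
    (hu : IsMixedSolution f L u v) (hu₁ : IsMixedSolution g L u₁ v₁) (hf : Monotone f)
    (hδ : 0 ≤ δ) (hfg : ∀ y, g y - δ ≤ f y) : v 0 ≤ v₁ 0 + δ * L := by
  have := (hu.le_of_super hL (w := fun x => u₁ x + δ * (L * x - x ^ 2 / 2))
    (fun x hx => (hu₁.deriv_fst x hx).add (hasDerivAt_parabola L δ x))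
    (fun x hx => (hu₁.deriv_snd x hx).add (hasDerivAt_parabola_deriv L δ x))
    (by simp [hu₁.left]) (by simp [hu₁.right]) ?_).2 (by simp [hu₁.left])
  · simpa using this
  · intro x hx hlt
    have hx2 : 0 ≤ L * x - x ^ 2 / 2 := by nlinarith [hx.1, hx.2]
    have := hf (show u₁ x ≤ u x by nlinarith [mul_nonneg hδ hx2])
    linarith [hfg (u₁ x)]

lemma IsMixedSolution.slope_le_of_lower_bound {f : ℝ → ℝ} {L δ m : ℝ} {u v : ℝ → ℝ} (hL : 0 < L)
    (hu : IsMixedSolution f L u v) (hδ : 0 ≤ δ) (hm : m * L ^ 2 ≤ 2 * δ)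
    (hf : ∀ y, 1 - δ ≤ y → m ≤ f y) : v 0 ≤ -m * L := by
  have := (hu.le_of_super hL (w := fun x => 1 + (-m) * (L * x - x ^ 2 / 2))
    (fun x hx => (hasDerivAt_parabola L (-m) x).const_add 1)
    (fun x hx => hasDerivAt_parabola_deriv L (-m) x)
    (by simp) (by simp) ?_).2 (by simp)
  · simpa using this
  · intro x hx hlt
    rw [neg_neg]
    refine hf _ (le_trans ?_ hlt.le)
    have hx2 : 0 ≤ L * x - x ^ 2 / 2 := by nlinarith [hx.1, hx.2]
    have hx3 : L * x - x ^ 2 / 2 ≤ L ^ 2 / 2 := by nlinarith [sq_nonneg (L - x)]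
    rcases le_total m 0 with h | h <;> nlinarith

lemma IsMixedSolution.le_slope_of_upper_bound {f : ℝ → ℝ} {L δ m : ℝ} {u v : ℝ → ℝ} (hL : 0 < L)
    (hu : IsMixedSolution f L u v) (hδ : 0 ≤ δ) (hm : -m * L ^ 2 ≤ 2 * δ)
    (hf : ∀ y, y ≤ 1 + δ → f y ≤ m) : -m * L ≤ v 0 := by
  have := (hu.ge_of_sub hL (w := fun x => 1 + (-m) * (L * x - x ^ 2 / 2))
    (fun x hx => (hasDerivAt_parabola L (-m) x).const_add 1)
    (fun x hx => hasDerivAt_parabola_deriv L (-m) x)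
    (by simp) (by simp) ?_).2 (by simp)
  · simpa using this
  · intro x hx hlt
    rw [neg_neg]
    refine hf _ (le_trans hlt.le ?_)
    have hx2 : 0 ≤ L * x - x ^ 2 / 2 := by nlinarith [hx.1, hx.2]
    have hx3 : L * x - x ^ 2 / 2 ≤ L ^ 2 / 2 := by nlinarith [sq_nonneg (L - x)]
    rcases le_total m 0 with h | h <;> nlinarith

open Set NNReal Metric in
lemma exists_isMixedSolution {f : ℝ → ℝ} {K : ℝ≥0} {M L : ℝ} (hL : 0 < L) (hf : LipschitzWith K f)
    (hM : ∀ y, |f y| ≤ M) : ∃ u v, IsMixedSolution f L u v := by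
  have hM0 : 0 ≤ M := (abs_nonneg _).trans (hM 0)
  set T : ℝ := L + 1 with hT
  have hT0 : 0 < T := by linarith
  set k : ℝ := 1 / (2 * T) with hk
  have hk0 : 0 < k := by positivity
  have hkT : k * T = 1 / 2 := by rw [hk]; field_simp
  set r : ℝ := M * T / k with hr
  have hr0 : 0 ≤ r := by positivity
  set F : ℝ × ℝ → ℝ × ℝ := fun p => (k * p.2, f p.1 / k) with hF
  have hFL : ∃ K', LipschitzWith K' F := by
    have h1 : LipschitzWith (‖k‖₊ * 1) (fun p : ℝ × ℝ => k * p.2) :=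
      (lipschitzWith_smul k).comp LipschitzWith.prod_snd
    have h2 : LipschitzWith (‖k⁻¹‖₊ * (K * 1)) (fun p : ℝ × ℝ => k⁻¹ * f p.1) :=
      (lipschitzWith_smul k⁻¹).comp (hf.comp LipschitzWith.prod_fst)
    have := h1.prodMk h2
    simp only [← div_eq_inv_mul] at this
    exact ⟨_, this⟩
  obtain ⟨K', hFL⟩ := hFL
  have h0 : (0 : ℝ) ∈ Icc (-1) T := ⟨by norm_num, hT0.le⟩
  set a : ℝ≥0 := (4 * r).toNNReal with ha
  have ha' : (a : ℝ) = 4 * r := Real.coe_toNNReal _ (by positivity)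
  set N : ℝ≥0 := (max (k * (4 * r)) (M / k)).toNNReal with hN
  have hN' : (N : ℝ) = max (k * (4 * r)) (M / k) := Real.coe_toNNReal _ (by positivity)
  have hr' : (r.toNNReal : ℝ) = r := Real.coe_toNNReal _ hr0
  have hpl : IsPicardLindelof (fun _ => F) (⟨0, h0⟩ : Icc (-1) T) ((1 : ℝ), (0 : ℝ)) a r.toNNReal N
      K' := by
    refine IsPicardLindelof.of_time_independent ?_ hFL.lipschitzOnWith ?_
    · rintro ⟨y, w⟩ hp
      rw [mem_closedBall, Prod.dist_eq, max_le_iff] at hp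
      have hw : |w| ≤ 4 * r := by simpa [ha'] using hp.2
      rw [Prod.norm_def, hN']
      refine max_le_max ?_ ?_
      · rw [Real.norm_eq_abs, abs_mul, abs_of_pos hk0]
        gcongr
      · rw [Real.norm_eq_abs, abs_div, abs_of_pos hk0]
        gcongr
        exact hM y
    · have : max (T - 0) (0 - (-1)) = T := by rw [max_eq_left] <;> linarith
      simp only [this, hN', ha', hr']
      rw [max_mul_of_nonneg _ _ hT0.le, max_le_iff]
      constructor
      · nlinarith
      · have : M / k * T = r := by rw [hr]; ring
        linarith
  obtain ⟨α, hα, L', hL'⟩ := hpl.exists_forall_mem_closedBall_eq_hasDerivWithinAt_lipschitzOnWith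
  have hmem : ∀ s ∈ Icc (-r) r, ((1 : ℝ), s) ∈ closedBall ((1 : ℝ), (0 : ℝ)) r.toNNReal := by
    intro s hs
    rw [mem_closedBall, Prod.dist_eq, hr']
    simpa [hr0] using abs_le.2 hs
  have hsub : ∀ x ∈ Icc 0 L, Icc (-1) T ∈ nhds x := fun x hx =>
    Icc_mem_nhds (by linarith [hx.1]) (by linarith [hx.2])
  have hd : ∀ s ∈ Icc (-r) r, ∀ x ∈ Icc 0 L, HasDerivAt (α (1, s)) (F (α (1, s) x)) x :=
    fun s hs x hx => ((hα _ (hmem s hs)).2 x (mem_of_mem_nhds (hsub x hx))).hasDerivAt (hsub x hx)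
  have hd1 : ∀ s ∈ Icc (-r) r, ∀ x ∈ Icc 0 L,
      HasDerivAt (fun x => (α (1, s) x).1) (k * (α (1, s) x).2) x := fun s hs x hx =>
    (hasFDerivAt_fst (p := α (1, s) x)).comp_hasDerivAt x (hd s hs x hx)
  have hd2 : ∀ s ∈ Icc (-r) r, ∀ x ∈ Icc 0 L,
      HasDerivAt (fun x => (α (1, s) x).2) (f (α (1, s) x).1 / k) x := fun s hs x hx =>
    (hasFDerivAt_snd (p := α (1, s) x)).comp_hasDerivAt x (hd s hs x hx)
  have hdiff : ∀ s ∈ Icc (-r) r, |(α (1, s) L).2 - s| ≤ r := by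
    intro s hs
    have := (convex_Icc 0 L).norm_image_sub_le_of_norm_hasDerivWithin_le (C := M / k)
      (fun x hx => (hd2 s hs x hx).hasDerivWithinAt) (fun x _ => by
        rw [Real.norm_eq_abs, abs_div, abs_of_pos hk0]; gcongr; exact hM _)
      (left_mem_Icc.2 hL.le) (right_mem_Icc.2 hL.le)
    have hz : (α (1, s) 0) = (1, s) := (hα _ (hmem s hs)).1
    rw [hz, Real.norm_eq_abs, Real.norm_eq_abs, sub_zero, abs_of_pos hL] at this
    refine this.trans ?_
    rw [hr, div_mul_eq_mul_div]
    gcongr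
    linarith
  have hcont : ContinuousOn (fun s => (α (1, s) L).2) (Icc (-r) r) := by
    refine continuous_snd.comp_continuousOn ?_
    exact (hL' L ⟨by linarith, by linarith⟩).continuousOn.comp (by fun_prop) hmem
  have hle : -r ≤ r := by linarith
  obtain ⟨s, hs, hs0⟩ : (0 : ℝ) ∈ (fun s => (α (1, s) L).2) '' Icc (-r) r := by
    refine intermediate_value_Icc hle hcont ⟨?_, ?_⟩
    · have := abs_le.1 (hdiff (-r) (left_mem_Icc.2 hle)); linarith [this.2]
    · have := abs_le.1 (hdiff r (right_mem_Icc.2 hle)); linarith [this.1]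
  refine ⟨fun x => (α (1, s) x).1, fun x => k * (α (1, s) x).2, ?_, ?_, ?_, ?_⟩
  · exact hd1 s hs
  · intro x hx
    have := (hd2 s hs x hx).const_mul k
    rwa [mul_div_cancel₀ _ hk0.ne'] at this
  · have hz : (α (1, s) 0) = (1, s) := (hα _ (hmem s hs)).1
    simp [hz]
  · simp only at hs0
    simp [hs0]

open Set MeasureTheory in
lemma primitive_reflect {g : ℝ → ℝ} {c : ℝ} (x : ℝ) (hg : ∀ y, g (2 * c - y) = g y) :
    ∫ y in c..(2 * c - x), g y = -∫ y in c..x, g y := by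
  have := intervalIntegral.integral_comp_sub_left g (a := x) (b := c) (2 * c)
  rw [show 2 * c - c = c by ring] at this
  rw [← this, intervalIntegral.integral_symm]
  simp_rw [hg]

open Set MeasureTheory in
lemma primitive_reflect_of_odd {g : ℝ → ℝ} {c : ℝ} (x : ℝ) (hg : ∀ y, g (2 * c - y) = -g y) :
    ∫ y in c..(2 * c - x), g y = ∫ y in c..x, g y := by
  have := intervalIntegral.integral_comp_sub_left g (a := x) (b := c) (2 * c)
  rw [show 2 * c - c = c by ring] at this
  rw [← this, intervalIntegral.integral_symm]
  simp_rw [hg]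
  rw [intervalIntegral.integral_neg, neg_neg]

open Set MeasureTheory in
/-- Two solutions of the half-period problems with matching slopes at `0` extend by reflection to a
`2π`-periodic function. -/
lemma exists_periodic_of_matching {f g : ℝ → ℝ} (hf : Continuous f) (hg : Continuous g)
    {u v w z : ℝ → ℝ} (hu : IsMixedSolution f (π / 2) u v) (hw : IsMixedSolution g (π / 2) w z)
    (hs : v 0 + z 0 = 0) :
    ∃ ψ : ℝ → ℝ, (∀ x, ψ (x + 2 * π) = ψ x) ∧ ContDiff ℝ 1 ψ ∧ ψ 0 = 1 ∧
      (∀ x, ∃ y ∈ Icc 0 (π / 2), ψ x = u y ∨ ψ x = w y) ∧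
      (∀ x, 0 < sin x → HasDerivAt (deriv ψ) (f (ψ x)) x) ∧
      (∀ x, sin x < 0 → HasDerivAt (deriv ψ) (g (ψ x)) x) := by
  have hπ := Real.pi_pos
  have hasr : ∀ x, arcsin (sin x) ∈ Icc (-(π / 2)) (π / 2) := fun x =>
    ⟨neg_pi_div_two_le_arcsin _, arcsin_le_pi_div_two _⟩
  set G₁ : ℝ → ℝ := fun x => f (u (max 0 (arcsin (sin x)))) with hG₁
  set G₂ : ℝ → ℝ := fun x => g (w (max 0 (-arcsin (sin x)))) with hG₂
  have hu_cont : ContinuousOn u (Icc 0 (π / 2)) := fun x hx =>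
    (hu.deriv_fst x hx).continuousAt.continuousWithinAt
  have hw_cont : ContinuousOn w (Icc 0 (π / 2)) := fun x hx =>
    (hw.deriv_fst x hx).continuousAt.continuousWithinAt
  have hG₁c : Continuous G₁ := by
    refine hf.comp (hu_cont.comp_continuous
      (continuous_const.max (continuous_arcsin.comp continuous_sin)) fun x => ?_)
    exact ⟨le_max_left _ _, max_le (by positivity) (hasr x).2⟩
  have hG₂c : Continuous G₂ := by
    refine hg.comp (hw_cont.comp_continuous
      (continuous_const.max (continuous_arcsin.comp continuous_sin).neg) fun x => ?_)
    exact ⟨le_max_left _ _, max_le (by positivity) (by linarith [(hasr x).1])⟩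
  set G : ℝ → ℝ := fun x => if 0 < sin x then G₁ x else G₂ x with hG
  have hGm : Measurable G := Measurable.ite
    (measurableSet_lt measurable_const continuous_sin.measurable) hG₁c.measurable hG₂c.measurable
  have hGi : ∀ a b, IntervalIntegrable G volume a b := by
    intro a b
    refine ((hG₁c.abs.add hG₂c.abs).intervalIntegrable a b).mono_fun hGm.aestronglyMeasurable ?_
    refine Filter.Eventually.of_forall fun x => ?_
    have h1 := abs_nonneg (G₁ x)
    have h2 := abs_nonneg (G₂ x)
    simp only [hG, Real.norm_eq_abs, Pi.add_apply]
    rw [abs_of_nonneg (add_nonneg h1 h2)]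
    split_ifs <;> linarith
  have hGsin : ∀ x y, sin x = sin y → G x = G y := by
    intro x y h
    simp only [hG, hG₁, hG₂, h]
  have hG_right : ∀ x ∈ Ioo 0 (π / 2), G x = f (u x) := by
    intro x hx
    have h1 : 0 < sin x := sin_pos_of_pos_of_lt_pi hx.1 (by linarith [hx.2])
    simp only [hG, hG₁, h1, if_true]
    rw [arcsin_sin (by linarith [hx.1]) hx.2.le, max_eq_right hx.1.le]
  have hG_left : ∀ x ∈ Ioo 0 (π / 2), G (-x) = g (w x) := by
    intro x hx
    have h1 : 0 < sin x := sin_pos_of_pos_of_lt_pi hx.1 (by linarith [hx.2])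
    have h2 : ¬ 0 < sin (-x) := by rw [sin_neg]; linarith
    simp only [hG, hG₂, h2, if_false]
    rw [arcsin_sin (by linarith [hx.2]) (by linarith [hx.1]), neg_neg, max_eq_right hx.1.le]
  set V : ℝ → ℝ := fun x => ∫ y in (π / 2)..x, G y with hV
  have hV_right : ∀ x ∈ Icc 0 (π / 2), V x = v x := by
    intro x hx
    have h1 : ∫ y in x..(π / 2), G y = ∫ y in x..(π / 2), f (u y) := by
      refine intervalIntegral.integral_congr_ae_restrict ?_
      rw [uIoc_of_le hx.2, ← restrict_Ioo_eq_restrict_Ioc]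
      filter_upwards [ae_restrict_mem measurableSet_Ioo] with y hy
      exact hG_right y ⟨hx.1.trans_lt hy.1, hy.2⟩
    have h2 : ∫ y in x..(π / 2), f (u y) = v (π / 2) - v x := by
      refine intervalIntegral.integral_eq_sub_of_hasDerivAt (fun y hy => ?_) ?_
      · rw [uIcc_of_le hx.2] at hy
        exact hu.deriv_snd y ⟨hx.1.trans hy.1, hy.2⟩
      · refine ContinuousOn.intervalIntegrable ?_
        rw [uIcc_of_le hx.2]
        exact hf.comp_continuousOn (hu_cont.mono (Icc_subset_Icc_left hx.1))
    simp only [hV]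
    rw [intervalIntegral.integral_symm, h1, h2, hu.right]
    ring
  have hV_left : ∀ x ∈ Icc 0 (π / 2), V (-x) = -z x + z (π / 2) := by
    intro x hx
    have h1 : ∫ y in (-x)..0, G y = ∫ y in 0..x, g (w y) := by
      have := intervalIntegral.integral_comp_neg G (a := 0) (b := x)
      rw [neg_zero] at this
      rw [← this]
      refine intervalIntegral.integral_congr_ae_restrict ?_
      rw [uIoc_of_le hx.1, ← restrict_Ioo_eq_restrict_Ioc]
      filter_upwards [ae_restrict_mem measurableSet_Ioo] with y hy
      exact hG_left y ⟨hy.1, hy.2.trans_le hx.2⟩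
    have h2 : ∫ y in 0..x, g (w y) = z x - z 0 := by
      refine intervalIntegral.integral_eq_sub_of_hasDerivAt (fun y hy => ?_) ?_
      · rw [uIcc_of_le hx.1] at hy
        exact hw.deriv_snd y ⟨hy.1, hy.2.trans hx.2⟩
      · refine ContinuousOn.intervalIntegrable ?_
        rw [uIcc_of_le hx.1]
        exact hg.comp_continuousOn (hw_cont.mono (Icc_subset_Icc_right hx.2))
    have h3 := hV_right 0 ⟨le_rfl, by positivity⟩
    have h4 := intervalIntegral.integral_add_adjacent_intervals (hGi (π / 2) 0) (hGi 0 (-x))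
    rw [intervalIntegral.integral_symm (-x) 0, h1, h2] at h4
    simp only [hV] at h3 ⊢
    rw [← h4, h3, hw.right]
    linarith
  have hVc : Continuous V := intervalIntegral.continuous_primitive hGi _
  have hVneg : ∀ x, V x = ∫ y in (-(π / 2))..x, G y := by
    intro x
    have h1 := hV_left (π / 2) ⟨by positivity, le_rfl⟩
    have h2 := intervalIntegral.integral_add_adjacent_intervals (hGi (π / 2) (-(π / 2)))
      (hGi (-(π / 2)) x)
    simp only [hV] at h1 ⊢
    rw [← h2, h1]
    ring
  have hV₁ : ∀ x, V (2 * (π / 2) - x) = -V x := fun x =>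
    primitive_reflect x fun y => hGsin _ _ (by
      rw [show 2 * (π / 2) - y = π - y by ring, sin_pi_sub])
  have hV₂ : ∀ x, V (2 * (-(π / 2)) - x) = -V x := by
    intro x
    rw [hVneg, hVneg]
    refine primitive_reflect x fun y => hGsin _ _ ?_
    rw [show 2 * (-(π / 2)) - y = -(y + π) by ring, sin_neg, sin_add_pi, neg_neg]
  set ψ : ℝ → ℝ := fun x => 1 + ∫ y in 0..x, V y with hψ
  have hψd : ∀ x, HasDerivAt ψ (V x) x := fun x =>
    (intervalIntegral.integral_hasDerivAt_right (hVc.intervalIntegrable _ _)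
      (hVc.stronglyMeasurableAtFilter _ _) hVc.continuousAt).const_add 1
  have hψderiv : deriv ψ = V := funext fun x => (hψd x).deriv
  have hψ0 : ψ 0 = 1 := by simp [hψ]
  have hψ_reflect : ∀ c, (∀ y, V (2 * c - y) = -V y) → ∀ x, ψ (2 * c - x) = ψ x := by
    intro c hc x
    have hc' : ∀ x, ψ x = ψ c + ∫ y in c..x, V y := by
      intro x
      have := intervalIntegral.integral_add_adjacent_intervals (hVc.intervalIntegrable 0 c)
        (hVc.intervalIntegrable (μ := volume) c x)
      simp only [hψ]
      linarith
    rw [hc', primitive_reflect_of_odd x hc, ← hc' x]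
  have hψ₁ : ∀ x, ψ (π - x) = ψ x := by
    intro x
    simpa [mul_div_cancel₀] using hψ_reflect _ hV₁ x
  have hψ₂ : ∀ x, ψ (-π - x) = ψ x := by
    intro x
    have := hψ_reflect _ hV₂ x
    rwa [show 2 * (-(π / 2)) - x = -π - x by ring] at this
  have hper : Function.Periodic ψ (2 * π) := by
    intro x
    rw [← hψ₁, ← hψ₂ x]
    congr 1
    ring
  have hψsin : ∀ x y, sin x = sin y → ψ x = ψ y := by
    intro x y h
    obtain ⟨k, hk | hk⟩ := sin_eq_sin_iff.1 h
    · have := hper.int_mul k x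
      rw [hk, ← this]
      congr 1
      ring
    · have := hper.int_mul k (π - x)
      rw [hψ₁] at this
      rw [hk, ← this]
      congr 1
      ring
  have hψ_right : ∀ x ∈ Icc 0 (π / 2), ψ x = u x := by
    intro x hx
    have h1 : ∫ y in 0..x, V y = u x - u 0 := by
      refine intervalIntegral.integral_eq_sub_of_hasDerivAt (fun y hy => ?_)
        (hVc.intervalIntegrable _ _)
      rw [uIcc_of_le hx.1] at hy
      have hy' : y ∈ Icc 0 (π / 2) := ⟨hy.1, hy.2.trans hx.2⟩
      rw [hV_right y hy']
      exact hu.deriv_fst y hy'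
    simp only [hψ]
    rw [h1, hu.left]
    ring
  have hψ_left : ∀ x ∈ Icc 0 (π / 2), ψ (-x) = w x := by
    intro x hx
    have h1 : ∫ y in 0..x, -V (-y) = w x - w 0 := by
      refine intervalIntegral.integral_eq_sub_of_hasDerivAt (fun y hy => ?_)
        ((hVc.comp continuous_neg).neg.intervalIntegrable _ _)
      rw [uIcc_of_le hx.1] at hy
      have hy' : y ∈ Icc 0 (π / 2) := ⟨hy.1, hy.2.trans hx.2⟩
      rw [hV_left y hy', hw.right, add_zero, neg_neg]
      exact hw.deriv_fst y hy'
    rw [intervalIntegral.integral_neg, intervalIntegral.integral_comp_neg, neg_zero,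
      ← intervalIntegral.integral_symm, hw.left] at h1
    simp only [hψ]
    rw [h1]
    ring
  have hψT : ∀ x, ψ x = ψ (arcsin (sin x)) := fun x =>
    hψsin _ _ (sin_arcsin (neg_one_le_sin x) (sin_le_one x)).symm
  have hψ_pos : ∀ x, 0 ≤ sin x → ψ x = u (max 0 (arcsin (sin x))) := by
    intro x hx
    have h0 := arcsin_nonneg.2 hx
    rw [hψT, max_eq_right h0, hψ_right _ ⟨h0, (hasr x).2⟩]
  have hψ_neg : ∀ x, sin x ≤ 0 → ψ x = w (max 0 (-arcsin (sin x))) := by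
    intro x hx
    have h0 := arcsin_nonpos.2 hx
    rw [hψT, max_eq_right (by linarith), ← hψ_left _ ⟨by linarith, by linarith [(hasr x).1]⟩,
      neg_neg]
  refine ⟨ψ, hper, ?_, hψ0, ?_, ?_, ?_⟩
  · rw [contDiff_one_iff_deriv, hψderiv]
    exact ⟨fun x => (hψd x).differentiableAt, hVc⟩
  · intro x
    rcases le_total 0 (sin x) with h | h
    · exact ⟨_, ⟨le_max_left _ _, max_le (by positivity) (hasr x).2⟩, Or.inl (hψ_pos x h)⟩
    · exact ⟨_, ⟨le_max_left _ _, max_le (by positivity) (by linarith [(hasr x).1])⟩,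
        Or.inr (hψ_neg x h)⟩
  · intro x hx
    have he : G =ᶠ[nhds x] G₁ := by
      filter_upwards [continuous_sin.continuousAt.eventually (lt_mem_nhds hx)] with y hy
      simp only [hG, hy, if_true]
    rw [hψderiv]
    have := intervalIntegral.integral_hasDerivAt_right (hGi (π / 2) x)
      hGm.stronglyMeasurable.stronglyMeasurableAtFilter
      (hG₁c.continuousAt.congr he.symm)
    rwa [he.eq_of_nhds, show G₁ x = f (ψ x) from (congrArg f (hψ_pos x hx.le)).symm] at this
  · intro x hx
    have he : G =ᶠ[nhds x] G₂ := by
      filter_upwards [continuous_sin.continuousAt.eventually (gt_mem_nhds hx)] with y hy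
      simp only [hG, not_lt.2 (le_of_lt hy), if_false]
    rw [hψderiv]
    have := intervalIntegral.integral_hasDerivAt_right (hGi (π / 2) x)
      hGm.stronglyMeasurable.stronglyMeasurableAtFilter
      (hG₂c.continuousAt.congr he.symm)
    rwa [he.eq_of_nhds, show G₂ x = g (ψ x) from (congrArg g (hψ_neg x hx.le)).symm] at this

/-- The nonlinearity `α y ^ p - β y ^ (-r)` with `y` truncated to `[a, b]`. -/
noncomputable def truncRhs (p r a b α β y : ℝ) : ℝ :=
  α * max a (min b y) ^ p - β * max a (min b y) ^ (-r)

lemma truncRhs_of_mem {p r a b α β y : ℝ} (h : y ∈ Set.Icc a b) :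
    truncRhs p r a b α β y = α * y ^ p - β * y ^ (-r) := by
  rw [truncRhs, min_eq_right h.2, max_eq_right h.1]

section truncRhs

variable {p r a b α β α' β' : ℝ}

lemma clamp_mem (hab : a ≤ b) (y : ℝ) : max a (min b y) ∈ Set.Icc a b :=
  ⟨le_max_left _ _, max_le hab (min_le_left _ _)⟩

lemma truncRhs_monotone (hp : 0 ≤ p) (hr : 0 ≤ r) (ha : 0 < a) (hα : 0 ≤ α) (hβ : 0 ≤ β) :
    Monotone (truncRhs p r a b α β) := by
  intro x y hxy
  have h0 : 0 < max a (min b x) := ha.trans_le (le_max_left _ _)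
  have h : max a (min b x) ≤ max a (min b y) := max_le_max_left _ (min_le_min_left _ hxy)
  exact sub_le_sub (mul_le_mul_of_nonneg_left (rpow_le_rpow h0.le h hp) hα)
    (mul_le_mul_of_nonneg_left (rpow_le_rpow_of_nonpos h0 h (by linarith)) hβ)

open Set in
lemma truncRhs_lipschitz (ha : 0 < a) (hab : a ≤ b) :
    ∃ K, LipschitzWith K (truncRhs p r a b α β) := by
  have hc : ContDiffOn ℝ 1 (fun c : ℝ => α * c ^ p - β * c ^ (-r)) (Icc a b) := by
    intro c hc
    have hc0 : c ≠ 0 := (ha.trans_le hc.1).ne'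
    exact ((contDiffAt_const.mul (contDiffAt_rpow_const_of_ne hc0)).sub
      (contDiffAt_const.mul (contDiffAt_rpow_const_of_ne hc0))).contDiffWithinAt
  obtain ⟨K, hK⟩ := hc.exists_lipschitzOnWith one_ne_zero (convex_Icc a b) isCompact_Icc
  have hcl : LipschitzOnWith 1 (fun y : ℝ => max a (min b y)) univ :=
    ((LipschitzWith.id.const_min b).const_max a).lipschitzOnWith
  exact ⟨_, lipschitzOnWith_univ.1 (hK.comp hcl fun y _ => clamp_mem hab y)⟩

lemma abs_truncRhs_le (hp : 0 ≤ p) (hr : 0 ≤ r) (ha : 0 < a) (hab : a ≤ b) (y : ℝ) :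
    |truncRhs p r a b α β y| ≤ |α| * b ^ p + |β| * a ^ (-r) := by
  have h := clamp_mem hab y
  have h0 := ha.trans_le h.1
  rw [truncRhs]
  refine (abs_sub _ _).trans ?_
  rw [abs_mul, abs_mul, abs_of_pos (rpow_pos_of_pos h0 _), abs_of_pos (rpow_pos_of_pos h0 _)]
  exact add_le_add (mul_le_mul_of_nonneg_left (rpow_le_rpow h0.le h.2 hp) (abs_nonneg _))
    (mul_le_mul_of_nonneg_left (rpow_le_rpow_of_nonpos ha h.1 (by linarith)) (abs_nonneg _))

lemma exists_isMixedSolution_truncRhs {L : ℝ} (hL : 0 < L) (hp : 0 ≤ p) (hr : 0 ≤ r) (ha : 0 < a)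
    (hab : a ≤ b) (α β : ℝ) : ∃ u v, IsMixedSolution (truncRhs p r a b α β) L u v :=
  have ⟨_, hK⟩ := truncRhs_lipschitz ha hab
  exists_isMixedSolution hL hK (abs_truncRhs_le hp hr ha hab)

lemma IsMixedSolution.truncRhs_slope_sub_le {L : ℝ} {u v u₁ v₁ : ℝ → ℝ} (hL : 0 < L) (hp : 0 ≤ p)
    (hr : 0 ≤ r) (ha : 0 < a) (hab : a ≤ b) (hα : 0 ≤ α) (hβ : 0 ≤ β)
    (hu : IsMixedSolution (truncRhs p r a b α β) L u v)
    (hu₁ : IsMixedSolution (truncRhs p r a b α' β') L u₁ v₁) :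
    v 0 - v₁ 0 ≤ (|α - α'| * b ^ p + |β - β'| * a ^ (-r)) * L := by
  have hb := ha.trans_le hab
  have := hu.slope_le hL hu₁ (truncRhs_monotone hp hr ha hα hβ)
    (δ := |α - α'| * b ^ p + |β - β'| * a ^ (-r))
    (add_nonneg (mul_nonneg (abs_nonneg _) (rpow_nonneg hb.le _))
      (mul_nonneg (abs_nonneg _) (rpow_nonneg ha.le _))) fun y => by
      have := (abs_le.1 (abs_truncRhs_le (α := α - α') (β := β - β') hp hr ha hab y)).1
      simp only [truncRhs] at this ⊢
      linarith
  linarith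

open Set in
lemma IsMixedSolution.mem_Icc_of_truncRhs {L C : ℝ} {u v : ℝ → ℝ} (hL : 0 < L) (hp : 1 ≤ p)
    (ha : 0 < a) (hb : 1 ≤ b) (hα : 0 ≤ α) (hβ : 0 ≤ β) (hαC : α ≤ C)
    (hsup : β * b ^ (-r) ≤ α * b ^ p) (haC : a * cosh (√C * L) ≤ 1)
    (hu : IsMixedSolution (truncRhs p r a b α β) L u v) : ∀ x ∈ Icc 0 L, u x ∈ Icc a b := by
  have hC : 0 ≤ C := hα.trans hαC
  have ha1 : a ≤ 1 := by nlinarith [one_le_cosh (√C * L)]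
  have hup := (hu.le_of_super hL (w := fun _ => b) (w' := fun _ => 0) (w'' := fun _ => 0)
    (fun x _ => hasDerivAt_const x b) (fun x _ => hasDerivAt_const x 0) hb le_rfl
    fun x hx hlt => by
      rw [truncRhs, min_eq_left hlt.le, max_eq_right (ha1.trans hb)]
      linarith).1
  set k := cosh (√C * L) with hk
  have hk0 : 0 < k := cosh_pos _
  have hd : ∀ x, HasDerivAt (fun x => √C * (L - x)) (-√C) x := fun x =>
    hasDerivAt_parabola_deriv L (√C) x
  have hge : ∀ x, a ≤ cosh (√C * (L - x)) / k := fun x => by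
    rw [le_div_iff₀ hk0]
    exact haC.trans (one_le_cosh _)
  have hlow := (hu.ge_of_sub hL (w := fun x => cosh (√C * (L - x)) / k)
    (w' := fun x => sinh (√C * (L - x)) * (-√C) / k)
    (w'' := fun x => cosh (√C * (L - x)) * (-√C) * (-√C) / k)
    (fun x _ => (hd x).cosh.div_const k) (fun x _ => ((hd x).sinh.mul_const _).div_const k)
    (by simp [← hk, div_self hk0.ne']) (by simp) fun x hx hlt => by
      set W := cosh (√C * (L - x)) / k with hW
      have hW1 : W ≤ 1 := by
        rw [hW, div_le_one hk0, hk, cosh_le_cosh,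
          abs_of_nonneg (mul_nonneg (sqrt_nonneg _) (by linarith [hx.2])),
          abs_of_nonneg (by positivity)]
        exact mul_le_mul_of_nonneg_left (by linarith [hx.1]) (sqrt_nonneg _)
      set c := max a (min b (u x)) with hc
      have hc0 : 0 < c := ha.trans_le (le_max_left _ _)
      have hcW : c ≤ W := max_le (hge x) ((min_le_right _ _).trans hlt.le)
      have hcp : c ^ p ≤ c := by
        simpa using rpow_le_rpow_of_exponent_ge hc0 (hcW.trans hW1) hp
      have h1 : cosh (√C * (L - x)) * (-√C) * (-√C) / k = C * W := by
        rw [hW]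
        calc _ = (√C * √C) * (cosh (√C * (L - x)) / k) := by ring
          _ = _ := by rw [mul_self_sqrt hC]
      rw [h1, truncRhs, ← hc]
      have h2 : 0 ≤ β * c ^ (-r) := mul_nonneg hβ (rpow_nonneg hc0.le _)
      have h3 : α * c ^ p ≤ C * W := mul_le_mul hαC (hcp.trans hcW) (rpow_nonneg hc0.le _) hC
      linarith).1
  exact fun x hx => ⟨(hge x).trans (hlow x hx), hup x hx⟩

end truncRhs

open Set in
/-- A continuous family of equations `ψ'' = α ψ ^ p - β ψ ^ (-r)` with piecewise constant
coefficients has a member with a periodic positive solution normalised by `ψ 0 = 1`, as soon as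
suitable barriers exist at the ends of the parameter interval. -/
lemma exists_periodic_solution {p r d₁ d₀ e : ℝ} {α₁ β₁ α₂ β₂ : ℝ → ℝ} (hp : 1 ≤ p) (hr : 0 ≤ r)
    (hd : d₁ ≤ d₀)
    (cα₁ : ContinuousOn α₁ (Icc d₁ d₀)) (cβ₁ : ContinuousOn β₁ (Icc d₁ d₀))
    (cα₂ : ContinuousOn α₂ (Icc d₁ d₀)) (cβ₂ : ContinuousOn β₂ (Icc d₁ d₀))
    (hα₁ : ∀ d ∈ Icc d₁ d₀, 0 < α₁ d) (hβ₁ : ∀ d ∈ Icc d₁ d₀, 0 ≤ β₁ d)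
    (hα₂ : ∀ d ∈ Icc d₁ d₀, 0 < α₂ d) (hβ₂ : ∀ d ∈ Icc d₁ d₀, 0 ≤ β₂ d)
    (h₁ : α₁ d₁ ≤ β₁ d₁) (h₂ : α₂ d₁ ≤ β₂ d₁) (he0 : 0 < e) (he1 : e ≤ 1)
    (hm₁ : α₁ d₀ * (π / 2) ^ 2 ≤ 2 * (1 - e)) (hm₂ : α₂ d₀ * (π / 2) ^ 2 ≤ 2 * (1 - e))
    (hm : (β₁ d₀ + β₂ d₀) * e ^ (-r) ≤ (α₁ d₀ + α₂ d₀) * e ^ p) :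
    ∃ d ∈ Icc d₁ d₀, ∃ ψ : ℝ → ℝ, (∀ x, ψ (x + 2 * π) = ψ x) ∧ (∀ x, 0 < ψ x) ∧
      ContDiff ℝ 1 ψ ∧ ψ 0 = 1 ∧
      (∀ x, 0 < sin x → HasDerivAt (deriv ψ) (α₁ d * ψ x ^ p - β₁ d * ψ x ^ (-r)) x) ∧
      (∀ x, sin x < 0 → HasDerivAt (deriv ψ) (α₂ d * ψ x ^ p - β₂ d * ψ x ^ (-r)) x) := by
  have hL : 0 < π / 2 := by positivity
  have hp0 : 0 ≤ p := by linarith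
  have hne : (Icc d₁ d₀).Nonempty := nonempty_Icc.2 hd
  obtain ⟨C, hC⟩ := (isCompact_Icc.image_of_continuousOn (cα₁.add cα₂)).bddAbove
  obtain ⟨B, hB⟩ := (isCompact_Icc.image_of_continuousOn (cβ₁.add cβ₂)).bddAbove
  obtain ⟨dm, hdm, hmin⟩ := isCompact_Icc.exists_isMinOn hne
    (f := fun d => min (α₁ d) (α₂ d)) (cα₁.inf cα₂)
  set c := min (α₁ dm) (α₂ dm) with hc
  have hc0 : 0 < c := lt_min (hα₁ dm hdm) (hα₂ dm hdm)
  have hC' : ∀ d ∈ Icc d₁ d₀, α₁ d + α₂ d ≤ C := fun d hd => hC (mem_image_of_mem _ hd)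
  have hB' : ∀ d ∈ Icc d₁ d₀, β₁ d + β₂ d ≤ B := fun d hd => hB (mem_image_of_mem _ hd)
  have hc' : ∀ d ∈ Icc d₁ d₀, c ≤ min (α₁ d) (α₂ d) := fun d hd => hmin hd
  have hl : d₁ ∈ Icc d₁ d₀ := left_mem_Icc.2 hd
  have hr' : d₀ ∈ Icc d₁ d₀ := right_mem_Icc.2 hd
  have hB0 : 0 ≤ B := by linarith [hB' d₁ hl, hβ₁ d₁ hl, hβ₂ d₁ hl]
  set b := 1 + B / c with hb
  have hb1 : 1 ≤ b := by rw [hb]; linarith [div_nonneg hB0 hc0.le]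
  have hcb : B ≤ c * b := by
    have : c * b = c + B := by rw [hb]; field_simp
    linarith
  have hsup : ∀ α β, c ≤ α → 0 ≤ β → β ≤ B → β * b ^ (-r) ≤ α * b ^ p := by
    intro α β hα hβ hβB
    have h1 : b ^ (-r) ≤ 1 := rpow_le_one_of_one_le_of_nonpos hb1 (by linarith)
    have h2 : b ≤ b ^ p := by simpa using rpow_le_rpow_of_exponent_le hb1 hp
    calc β * b ^ (-r) ≤ β * 1 := mul_le_mul_of_nonneg_left h1 hβ
      _ ≤ c * b := by linarith
      _ ≤ α * b ^ p := mul_le_mul hα h2 (by linarith) (by linarith)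
  set a := min e (1 / cosh (√C * (π / 2))) with ha
  have ha0 : 0 < a := lt_min he0 (div_pos one_pos (cosh_pos _))
  have hae : a ≤ e := min_le_left _ _
  have haC : a * cosh (√C * (π / 2)) ≤ 1 := by
    rw [← le_div_iff₀ (cosh_pos _)]
    exact min_le_right _ _
  have hab : a ≤ b := by linarith
  choose U V hUV using fun α β => exists_isMixedSolution_truncRhs hL hp0 hr ha0 hab α β
  have hcont : ∀ α β : ℝ → ℝ, ContinuousOn α (Icc d₁ d₀) → ContinuousOn β (Icc d₁ d₀) →
      (∀ d ∈ Icc d₁ d₀, 0 < α d) → (∀ d ∈ Icc d₁ d₀, 0 ≤ β d) →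
      ContinuousOn (fun d => V (α d) (β d) 0) (Icc d₁ d₀) := by
    intro α β cα cβ hα hβ d hd
    refine tendsto_iff_dist_tendsto_zero.2 ?_
    refine squeeze_zero' (g := fun x =>
      (|α x - α d| * b ^ p + |β x - β d| * a ^ (-r)) * (π / 2))
      (Eventually.of_forall fun _ => dist_nonneg) ?_ ?_
    · filter_upwards [self_mem_nhdsWithin] with x hx
      rw [Real.dist_eq, abs_sub_le_iff]
      refine ⟨(hUV (α x) (β x)).truncRhs_slope_sub_le hL hp0 hr ha0 hab (hα x hx).le (hβ x hx)
        (hUV _ _), ?_⟩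
      rw [abs_sub_comm (α x), abs_sub_comm (β x)]
      exact (hUV (α d) (β d)).truncRhs_slope_sub_le hL hp0 hr ha0 hab (hα d hd).le (hβ d hd)
        (hUV _ _)
    · have : ContinuousWithinAt (fun x =>
          (|α x - α d| * b ^ p + |β x - β d| * a ^ (-r)) * (π / 2)) (Icc d₁ d₀) d :=
        ((((cα d hd).sub continuousWithinAt_const).abs.mul continuousWithinAt_const).add
          (((cβ d hd).sub continuousWithinAt_const).abs.mul continuousWithinAt_const)).mul
          continuousWithinAt_const
      simpa [ContinuousWithinAt] using this
  have hstart : ∀ α β, 0 ≤ α → 0 ≤ β → α ≤ β → 0 ≤ V α β 0 := by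
    intro α β hα hβ hαβ
    have := (hUV α β).le_slope_of_upper_bound hL (δ := 0) (m := 0) le_rfl (by simp) fun y hy => by
      refine (truncRhs_monotone hp0 hr ha0 hα hβ (show y ≤ 1 by linarith)).trans ?_
      rw [truncRhs_of_mem ⟨hae.trans he1, hb1⟩]
      simpa using hαβ
    simpa using this
  have hend : ∀ α β, 0 ≤ α → 0 ≤ β → α * (π / 2) ^ 2 ≤ 2 * (1 - e) →
      V α β 0 ≤ -(α * e ^ p - β * e ^ (-r)) * (π / 2) := by
    intro α β hα hβ hαe
    refine (hUV α β).slope_le_of_lower_bound hL (δ := 1 - e) (by linarith) ?_ fun y hy => ?_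
    · refine le_trans (mul_le_mul_of_nonneg_right ?_ (sq_nonneg _)) hαe
      have h1 : e ^ p ≤ 1 := rpow_le_one he0.le he1 hp0
      have h2 : 0 ≤ β * e ^ (-r) := mul_nonneg hβ (rpow_nonneg he0.le _)
      nlinarith
    · rw [← truncRhs_of_mem (a := a) (b := b) ⟨hae, he1.trans hb1⟩]
      exact truncRhs_monotone hp0 hr ha0 hα hβ (by linarith)
  obtain ⟨d, hdI, hd0⟩ : (0 : ℝ) ∈ (fun d => V (α₁ d) (β₁ d) 0 + V (α₂ d) (β₂ d) 0) '' Icc d₁ d₀ := by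
    refine intermediate_value_Icc' hd
      ((hcont _ _ cα₁ cβ₁ hα₁ hβ₁).add (hcont _ _ cα₂ cβ₂ hα₂ hβ₂)) ⟨?_, ?_⟩
    · have h1 := hend _ _ (hα₁ _ hr').le (hβ₁ _ hr') hm₁
      have h2 := hend _ _ (hα₂ _ hr').le (hβ₂ _ hr') hm₂
      have h3 := mul_le_mul_of_nonneg_right hm hL.le
      show V (α₁ d₀) (β₁ d₀) 0 + V (α₂ d₀) (β₂ d₀) 0 ≤ 0
      linarith
    · exact add_nonneg (hstart _ _ (hα₁ _ hl).le (hβ₁ _ hl) h₁)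
        (hstart _ _ (hα₂ _ hl).le (hβ₂ _ hl) h₂)
  have hlip : ∀ α β, Continuous (truncRhs p r a b α β) := fun α β =>
    (truncRhs_lipschitz ha0 hab).choose_spec.continuous
  have hmem₁ := (hUV (α₁ d) (β₁ d)).mem_Icc_of_truncRhs hL hp ha0 hb1 (hα₁ d hdI).le (hβ₁ d hdI)
    (by linarith [hC' d hdI, hα₂ d hdI])
    (hsup _ _ ((hc' d hdI).trans (min_le_left _ _)) (hβ₁ d hdI)
      (by linarith [hB' d hdI, hβ₂ d hdI])) haC
  have hmem₂ := (hUV (α₂ d) (β₂ d)).mem_Icc_of_truncRhs hL hp ha0 hb1 (hα₂ d hdI).le (hβ₂ d hdI)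
    (by linarith [hC' d hdI, hα₁ d hdI])
    (hsup _ _ ((hc' d hdI).trans (min_le_right _ _)) (hβ₂ d hdI)
      (by linarith [hB' d hdI, hβ₁ d hdI])) haC
  obtain ⟨ψ, hper, hψC, hψ0, hval, hpos, hneg⟩ :=
    exists_periodic_of_matching (hlip _ _) (hlip _ _) (hUV (α₁ d) (β₁ d)) (hUV (α₂ d) (β₂ d)) hd0
  have hψI : ∀ x, ψ x ∈ Icc a b := by
    intro x
    obtain ⟨y, hy, h | h⟩ := hval x
    · exact h ▸ hmem₁ y hy
    · exact h ▸ hmem₂ y hy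
  refine ⟨d, hdI, ψ, hper, fun x => ha0.trans_le (hψI x).1, hψC, hψ0, fun x hx => ?_,
    fun x hx => ?_⟩
  · rw [← truncRhs_of_mem (hψI x)]
    exact hpos x hx
  · rw [← truncRhs_of_mem (hψI x)]
    exact hneg x hx

lemma exists_sq_le_of_ne_zero {t γ η μ k : ℝ} (hγ : |γ| ≤ 1) (hk : 1 ≤ k)
    (h : ¬(η = 0 ∧ μ = 0)) (X₀ : ℝ) :
    ∃ X ≥ X₀, ∀ s, |s| ≤ 1 → (t + s) ^ 2 ≤ k * η ^ 2 * X ^ 2 + (μ * X + γ + s) ^ 2 := by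
  have key : ∀ m : ℝ, m ≠ 0 → ∃ X ≥ X₀, |t| + 3 ≤ |m * X| := fun m hm => by
    have hm' := abs_pos.2 hm
    refine ⟨max X₀ ((|t| + 3) / |m|), le_max_left _ _, ?_⟩
    have h1 : |t| + 3 ≤ |m| * max X₀ ((|t| + 3) / |m|) := by
      rw [mul_comm, ← div_le_iff₀ hm']
      exact le_max_right _ _
    rw [abs_mul]
    exact h1.trans (mul_le_mul_of_nonneg_left (le_abs_self _) hm'.le)
  by_cases hμ : μ = 0
  · obtain ⟨X, hX, hle⟩ := key η fun hη => h ⟨hη, hμ⟩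
    refine ⟨X, hX, fun s hs => ?_⟩
    have h1 : (t + s) ^ 2 ≤ (η * X) ^ 2 := by
      rw [sq_le_sq]
      linarith [abs_add_le t s]
    nlinarith [sq_nonneg (η * X), sq_nonneg (μ * X + γ + s)]
  · obtain ⟨X, hX, hle⟩ := key μ hμ
    refine ⟨X, hX, fun s hs => ?_⟩
    have h1 : (t + s) ^ 2 ≤ (μ * X + γ + s) ^ 2 := by
      rw [sq_le_sq]
      have h2 : |μ * X| ≤ |μ * X + γ + s| + |s| + |γ| := by
        have := abs_add_three (μ * X + γ + s) (-s) (-γ)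
        rwa [abs_neg, abs_neg, show μ * X + γ + s + -s + -γ = μ * X by ring] at this
      linarith [abs_add_le t s]
    have : 0 ≤ k * η ^ 2 * X ^ 2 := by positivity
    linarith

lemma two_lt_qex {n : ℕ} (hn : 3 ≤ n) : 2 < qex n := by
  have : (3 : ℝ) ≤ n := by exact_mod_cast hn
  rw [qex, lt_div_iff₀ (by linarith)]
  linarith

lemma kap_le_one {n : ℕ} (hn : 3 ≤ n) : kap n ≤ 1 := by
  have : (3 : ℝ) ≤ n := by exact_mod_cast hn
  rw [kap, div_le_one (by linarith)]
  linarith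

lemma lam_of_sin_pos {x : ℝ} (h : 0 < sin x) : lam x = 1 := if_pos h

lemma lam_of_sin_neg {x : ℝ} (h : sin x < 0) : lam x = -1 := if_neg h.not_gt

/-- Coefficient of `ψ ^ (q - 1)` in the equation solved for `ψ''` where `λ = s`. -/
noncomputable def coeffPos (q t s d : ℝ) : ℝ := d ^ (q - 2) / (2 * q) * (t + s) ^ 2

/-- Coefficient of `-ψ ^ (-(q + 1))` in the equation solved for `ψ''` where `λ = s`. -/
noncomputable def coeffNeg (q κ γ η μ s d : ℝ) : ℝ :=
  d ^ (q - 2) / (2 * q) * (2 / κ * η ^ 2 * d ^ (-(2 * q)) + (μ * d ^ (-q) + γ + s) ^ 2)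

section coeff

variable {q κ t γ η μ s d : ℝ}

lemma coeffPos_pos (hq : 0 < q) (hd : 0 < d) (h : t + s ≠ 0) : 0 < coeffPos q t s d := by
  have := rpow_pos_of_pos hd (q - 2)
  rw [coeffPos]
  positivity

lemma coeffNeg_nonneg (hq : 0 < q) (hκ : 0 < κ) (hd : 0 < d) : 0 ≤ coeffNeg q κ γ η μ s d := by
  rw [coeffNeg]
  positivity

lemma continuousOn_coeffPos : ContinuousOn (coeffPos q t s) (Set.Ioi 0) := fun d hd =>
  (((continuousAt_rpow_const d _ (Or.inl (ne_of_gt hd))).div_const _).mul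
    continuousAt_const).continuousWithinAt

lemma continuousOn_coeffNeg : ContinuousOn (coeffNeg q κ γ η μ s) (Set.Ioi 0) := fun d hd => by
  have hd0 : d ≠ 0 := ne_of_gt hd
  have h : ∀ z : ℝ, ContinuousAt (fun x : ℝ => x ^ z) d := fun z =>
    continuousAt_rpow_const d z (Or.inl hd0)
  exact (((h _).div_const _).mul ((continuousAt_const.mul (h _)).add
    ((((continuousAt_const.mul (h _)).add continuousAt_const).add
      continuousAt_const).pow 2))).continuousWithinAt

lemma coeff_equation (hq : 0 < q) (hκ : 0 < κ) (hd : 0 < d) (y : ℝ) :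
    -2 * κ * q * d ^ (-(q - 2)) *
        (coeffPos q t s d * y ^ (q - 1) - coeffNeg q κ γ η μ s d * y ^ (-(q + 1)))
      - 2 * η ^ 2 * d ^ (-(2 * q)) * y ^ (-q - 1)
      - κ * (μ * d ^ (-q) + γ + s) ^ 2 * y ^ (-q - 1) + κ * (t + s) ^ 2 * y ^ (q - 1) = 0 := by
  have h : d ^ (q - 2) ≠ 0 := (rpow_pos_of_pos hd _).ne'
  rw [coeffPos, coeffNeg, rpow_neg hd.le (q - 2), show -(q + 1) = -q - 1 by ring]
  field_simp
  ring

end coeff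

lemma isModelSolution_of_hasDerivAt {n : ℕ} (hn : 3 ≤ n) {t γ η μ d : ℝ} (hd : 0 < d) {ψ : ℝ → ℝ}
    (hper : ∀ x, ψ (x + 2 * π) = ψ x) (hpos : ∀ x, 0 < ψ x) (hC : ContDiff ℝ 1 ψ)
    (h : ∀ x, sin x ≠ 0 → HasDerivAt (deriv ψ) (coeffPos (qex n) t (lam x) d * ψ x ^ (qex n - 1)
      - coeffNeg (qex n) (kap n) γ η μ (lam x) d * ψ x ^ (-(qex n + 1))) x) :
    IsModelSolution n t γ η μ d ψ := by
  refine ⟨hper, hpos, hC, fun x hx => ?_⟩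
  have hD := h x fun h0 => by
    obtain ⟨k, hk⟩ := sin_eq_zero_iff.1 h0
    exact hx k hk.symm
  refine ⟨hD.differentiableAt, ?_⟩
  rw [hD.deriv]
  exact coeff_equation (by linarith [two_lt_qex hn]) (kap_pos hn) hd _

lemma exists_pos_rpow_eq {z X : ℝ} (hz : z ≠ 0) (hX : 0 < X) : ∃ d > 0, d ^ z = X :=
  ⟨X ^ z⁻¹, rpow_pos_of_pos hX _, rpow_inv_rpow hX.le hz⟩

/-- For small data, the averaged coefficients at a fixed `d` are close to their values at
`η = μ = 0`. -/
lemma exists_ball_lt {A B γ c : ℝ} (hc : 1 + γ ^ 2 < c) :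
    ∃ ε > 0, ∀ η μ : ℝ, η ^ 2 + μ ^ 2 < ε ^ 2 →
      A * η ^ 2 * B ^ 2 + 1 + (μ * B + γ) ^ 2 < c := by
  have hcont : Continuous fun z : ℝ × ℝ => A * z.1 ^ 2 * B ^ 2 + 1 + (z.2 * B + γ) ^ 2 := by
    fun_prop
  have hev := (hcont.tendsto (0, 0)).eventually_lt_const (u := c) (by simpa using hc)
  obtain ⟨ε, hε, hball⟩ := Metric.eventually_nhds_iff.1 hev
  refine ⟨ε, hε, fun η μ h => hball (y := (η, μ)) ?_⟩
  rw [Prod.dist_eq, max_lt_iff, dist_zero_right, dist_zero_right]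
  exact ⟨abs_lt_of_sq_lt_sq (by nlinarith [sq_nonneg μ]) hε.le,
    abs_lt_of_sq_lt_sq (by nlinarith [sq_nonneg η]) hε.le⟩

/-- Small-TT existence (Theorem 3.5 / Proposition 3.21). -/
theorem small_TT_existence (n : ℕ) (hn : 3 ≤ n) (t γ : ℝ)
    (hγ : -1 < γ ∧ γ < 1) (ht : |γ| < |t|) (ht1 : |t| ≠ 1) :
    ∃ ε₀ : ℝ, 0 < ε₀ ∧
      ∀ η μ : ℝ, ¬(η = 0 ∧ μ = 0) → η ^ 2 + μ ^ 2 < ε₀ ^ 2 →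
        ∃ d : ℝ, 0 < d ∧ ∃ ψ : ℝ → ℝ, IsModelSolution n t γ η μ d ψ ∧ ψ 0 = 1 := by
  set q := qex n with hq
  set κ := kap n with hκ
  have hq2 : 2 < q := two_lt_qex hn
  have hq0 : 0 < q := by linarith
  have hκ0 : 0 < κ := kap_pos hn
  have ht2 : γ ^ 2 < t ^ 2 := sq_lt_sq.2 ht
  have htp : t + 1 ≠ 0 := fun h => ht1 (by rw [eq_neg_of_add_eq_zero_left h]; simp)
  have htm : t + -1 ≠ 0 := fun h => ht1 (by rw [eq_neg_of_add_eq_zero_left h]; simp)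
  obtain ⟨e, he0, he1, he⟩ : ∃ e : ℝ, 0 < e ∧ e < 1 ∧ 1 + γ ^ 2 < e ^ (2 * q) * (1 + t ^ 2) := by
    have ht0 : 0 < 1 + t ^ 2 := by positivity
    obtain ⟨c, hc1, hc2⟩ := exists_between ((div_lt_one ht0).2 (by linarith : 1 + γ ^ 2 < 1 + t ^ 2))
    have hc0 : 0 < c := lt_trans (by positivity) hc1
    refine ⟨c ^ (2 * q)⁻¹, rpow_pos_of_pos hc0 _, rpow_lt_one hc0.le hc2 (by positivity), ?_⟩
    rwa [rpow_inv_rpow hc0.le (by positivity), ← div_lt_iff₀ ht0]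
  have hT : 0 < (|t| + 1) ^ 2 * (π / 2) ^ 2 := by positivity
  obtain ⟨d₀, hd₀, hY⟩ := exists_pos_rpow_eq (z := q - 2)
    (X := 4 * q * (1 - e) / ((|t| + 1) ^ 2 * (π / 2) ^ 2)) (by linarith)
    (div_pos (mul_pos (by positivity) (by linarith)) hT)
  obtain ⟨ε, hε, hsmall⟩ := exists_ball_lt (A := 2 / κ) (B := d₀ ^ (-q)) he
  refine ⟨ε, hε, fun η μ hne hlt => ?_⟩
  obtain ⟨X, hX, hXle⟩ := exists_sq_le_of_ne_zero (t := t) (k := 2 / κ)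
    (abs_le.2 ⟨hγ.1.le, hγ.2.le⟩) ((one_le_div hκ0).2 (by linarith [kap_le_one hn])) hne (d₀ ^ (-q))
  obtain ⟨d₁, hd₁, hdX⟩ := exists_pos_rpow_eq (z := -q) (by linarith)
    ((rpow_pos_of_pos hd₀ _).trans_le hX)
  have hle : d₁ ≤ d₀ := by
    rw [← rpow_le_rpow_iff_of_neg hd₀ hd₁ (z := -q) (by linarith), hdX]
    exact hX
  have hsq : ∀ d : ℝ, 0 < d → d ^ (-(2 * q)) = (d ^ (-q)) ^ 2 := fun d hd => by
    rw [← rpow_natCast, ← rpow_mul hd.le]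
    congr 1
    push_cast
    ring
  have hIoi : Set.Icc d₁ d₀ ⊆ Set.Ioi 0 := fun d hd => hd₁.trans_le hd.1
  have hstart : ∀ s, |s| ≤ 1 → coeffPos q t s d₁ ≤ coeffNeg q κ γ η μ s d₁ := fun s hs => by
    rw [coeffPos, coeffNeg, hsq d₁ hd₁, hdX]
    exact mul_le_mul_of_nonneg_left (hXle s hs) (by positivity)
  have hend : ∀ s, |s| ≤ 1 → coeffPos q t s d₀ * (π / 2) ^ 2 ≤ 2 * (1 - e) := fun s hs => by
    have h1 : (t + s) ^ 2 ≤ (|t| + 1) ^ 2 := by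
      rw [sq_le_sq, abs_of_pos (by positivity : 0 < |t| + 1)]
      linarith [abs_add_le t s]
    have h0 : 0 < d₀ ^ (q - 2) := rpow_pos_of_pos hd₀ _
    have h2 : d₀ ^ (q - 2) * ((|t| + 1) ^ 2 * (π / 2) ^ 2) = 4 * q * (1 - e) := by
      rw [hY, div_mul_cancel₀ _ hT.ne']
    calc coeffPos q t s d₀ * (π / 2) ^ 2
        ≤ d₀ ^ (q - 2) / (2 * q) * (|t| + 1) ^ 2 * (π / 2) ^ 2 :=
          mul_le_mul_of_nonneg_right (mul_le_mul_of_nonneg_left h1 (by positivity)) (sq_nonneg _)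
      _ = d₀ ^ (q - 2) * ((|t| + 1) ^ 2 * (π / 2) ^ 2) / (2 * q) := by ring
      _ = 2 * (1 - e) := by rw [h2]; field_simp; ring
  have hmean : (coeffNeg q κ γ η μ 1 d₀ + coeffNeg q κ γ η μ (-1) d₀) * e ^ (-(q + 1)) ≤
      (coeffPos q t 1 d₀ + coeffPos q t (-1) d₀) * e ^ (q - 1) := by
    have h1 := (hsmall η μ hlt).le
    have h2 : e ^ (q - 1) = e ^ (2 * q) * e ^ (-(q + 1)) := by
      rw [← rpow_add he0]
      congr 1
      ring
    have h3 : 0 ≤ d₀ ^ (q - 2) / q * e ^ (-(q + 1)) := by positivity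
    have h4 := mul_le_mul_of_nonneg_left h1 h3
    rw [h2]
    simp only [coeffPos, coeffNeg, hsq d₀ hd₀]
    calc _ = d₀ ^ (q - 2) / q * e ^ (-(q + 1)) *
          (2 / κ * η ^ 2 * (d₀ ^ (-q)) ^ 2 + 1 + (μ * d₀ ^ (-q) + γ) ^ 2) := by field_simp; ring
      _ ≤ _ := h4
      _ = _ := by field_simp; ring
  have hs1 : |(1 : ℝ)| ≤ 1 := by simp
  have hs2 : |(-1 : ℝ)| ≤ 1 := by simp
  obtain ⟨d, hd, ψ, hper, hpos, hC, h0, hp, hm⟩ := exists_periodic_solution (p := q - 1)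
    (r := q + 1) (by linarith) (by linarith) hle
    (continuousOn_coeffPos.mono hIoi) (continuousOn_coeffNeg.mono hIoi)
    (continuousOn_coeffPos.mono hIoi) (continuousOn_coeffNeg.mono hIoi)
    (fun d hd => coeffPos_pos hq0 (hIoi hd) htp) (fun d hd => coeffNeg_nonneg hq0 hκ0 (hIoi hd))
    (fun d hd => coeffPos_pos hq0 (hIoi hd) htm) (fun d hd => coeffNeg_nonneg hq0 hκ0 (hIoi hd))
    (hstart 1 hs1) (hstart (-1) hs2) he0 he1.le (hend 1 hs1) (hend (-1) hs2) hmean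
  refine ⟨d, hIoi hd, ψ, isModelSolution_of_hasDerivAt hn (hIoi hd) hper hpos hC fun x hx => ?_, h0⟩
  rcases hx.lt_or_gt with h | h
  · rw [lam_of_sin_neg h]
    exact hm x h
  · rw [lam_of_sin_pos h]
    exact hp x h
end
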